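/- Let k be an algebraically closed field, let T_0 := k[x,y,t]_{(x,y,t)} be the localization of the polynomial ring k[x,y,t] at the maximal ideal (x,y,t) (a three-dimensional regular local ring with residue field k), and let K = k(x,y,t) be its quotient field. Then there exists a valuation φ of K which dominates T_0 and whose residue field V_φ/m_φ equals k, with the following property: for every regular local ring T of K which dominates T_0 and is dominated by φ, letting T̂ denote the m_T-adic completion of T, there does NOT exist a prime ideal p of T̂ with p ∩ T = (0) together with a valuation φ̂ of the quotient field of T̂/p which dominates T̂/p and extends φ (i.e., V_φ̂ ∩ K = V_φ under the inclusion K ⊆ QF(T̂/p) induced by T ↪ T̂/p), such that S^{T̂/p}(φ̂) = S^T(φ) under the natural inclusion S^T(φ) ⊆ S^{T̂/p}(φ̂); equivalently, for every such p and φ̂ there exists a nonzero h ∈ T̂/p such that φ̂(h) ≠ φ̂(f) for every nonzero f ∈ T. -/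

import Mathlib

noncomputable section

def Subring.inNonunits {F : Type*} [Field F] (S : Subring F) (x : F) : Prop :=
  x ∈ S ∧ ¬(x ≠ 0 ∧ x⁻¹ ∈ S)

def VDominates {F : Type*} [Field F] (W : ValuationSubring F) (S : Subring F) : Prop :=
  (S : Set F) ⊆ (W : Set F) ∧ ∀ x ∈ S, (W.valuation x < 1 ↔ S.inNonunits x)

def SDominates {F : Type*} [Field F] (B S : Subring F) : Prop :=
  S ≤ B ∧ ∀ x ∈ S, (B.inNonunits x ↔ S.inNonunits x)

def IsFractionSubring {F : Type*} [Field F] (S : Subring F) : Prop :=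
  ∀ x : F, ∃ a ∈ S, ∃ b ∈ S, b ≠ 0 ∧ x * b = a

def IsRegularLocal (R : Type*) [CommRing R] : Prop :=
  IsNoetherianRing R ∧ IsLocalRing R ∧
    ∃ s : Finset R, ((Ideal.span (s : Set R) : Ideal R) : Set R) = {x : R | ¬IsUnit x} ∧
      (s.card : WithBot (WithTop ℕ)) = ringKrullDim R

abbrev RP (k : Type*) [Field k] := MvPolynomial (Fin 3) k
abbrev KK (k : Type*) [Field k] := FractionRing (RP k)

def M0 (k : Type*) [Field k] : Submonoid (RP k) where
  carrier := {g | MvPolynomial.eval (0 : Fin 3 → k) g ≠ 0}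
  one_mem' := by simp
  mul_mem' := by
    intro a b ha hb
    simp only [Set.mem_setOf_eq, map_mul] at *
    exact mul_ne_zero ha hb

def T0 (k : Type*) [Field k] : Subring (KK k) :=
  (IsLocalization.lift (M := M0 k) (S := Localization (M0 k))
    (g := algebraMap (RP k) (KK k))
    (fun y => isUnit_iff_ne_zero.mpr (by
      have h0 : (y : RP k) ≠ 0 := by
        intro h
        have hy := y.2
        rw [h] at hy
        exact hy (map_zero _)
      exact (map_ne_zero_iff _ (IsFractionRing.injective (RP k) (KK k))).mpr h0))).range

/-- The group of rational numbers with denominator dividing `r ^ i`. -/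
def fracGroup (r i : ℕ) : AddSubgroup ℚ :=
  (Int.castAddHom ℚ).range.comap (AddMonoidHom.mulRight ((r : ℚ) ^ i))

theorem mem_fracGroup {r i : ℕ} {q : ℚ} :
    q ∈ fracGroup r i ↔ ∃ n : ℤ, (n : ℚ) = q * (r : ℚ) ^ i := by
  rfl

theorem fracGroup_mono (r : ℕ) : Monotone (fracGroup r) := by
  refine monotone_nat_of_le_succ fun i q hq => ?_
  obtain ⟨n, hn⟩ := mem_fracGroup.1 hq
  exact mem_fracGroup.2 ⟨n * r, by push_cast; rw [hn]; ring⟩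

theorem intCast_mem_fracGroup (r i : ℕ) (n : ℤ) : (n : ℚ) ∈ fracGroup r i :=
  mem_fracGroup.2 ⟨n * r ^ i, by push_cast; ring⟩

section Order

variable {A : Type*} [CommRing A] (w : AddValuation A (WithTop ℚ))

/-- The ideal of elements of value at least `γ`. -/
def valIdeal (hw0 : ∀ a, 0 ≤ w a) (γ : WithTop ℚ) : Ideal A where
  carrier := {a | γ ≤ w a}
  add_mem' ha hb := w.map_le_add ha hb
  zero_mem' := by simp
  smul_mem' c a ha := by
    simp only [Set.mem_ofPred_eq, smul_eq_mul, w.map_mul] at *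
    exact ha.trans (le_add_of_nonneg_left (hw0 c))

theorem card_values_le (hw0 : ∀ a, 0 ≤ w a) (c : A) (S : Finset ℚ)
    (hS : ∀ q ∈ S, (∃ g, w g = (q : WithTop ℚ)) ∧ (q : WithTop ℚ) ≤ w c) :
    (S.card : ℕ∞) ≤ Ring.ord A c + 1 := by
  obtain hS0 | ⟨n, hn⟩ : S.card = 0 ∨ ∃ n, S.card = n + 1 := by
    cases h : S.card with
    | zero => exact Or.inl rfl
    | succ n => exact Or.inr ⟨n, rfl⟩
  · simp [hS0]
  let e := S.orderEmbOfFin hn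
  let J : Fin (n + 1) → Submodule A (A ⧸ Ideal.span {c}) := fun i =>
    Submodule.map (Submodule.mkQ (Ideal.span {c})) (valIdeal w hw0 (e i.rev : ℚ))
  have hJ : StrictMono J := by
    intro i j hij
    have hlt : e j.rev < e i.rev := e.strictMono (Fin.rev_lt_rev.2 hij)
    refine lt_of_le_of_ne (Submodule.map_mono fun a ha => ?_) fun heq => ?_
    · exact (WithTop.coe_le_coe.2 hlt.le).trans ha
    · have hker : ∀ q ∈ S, Ideal.span {c} ≤ valIdeal w hw0 (q : ℚ) := by
        intro q hq
        rw [Ideal.span_singleton_le_iff_mem]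
        exact (hS q hq).2
      have hcomap : ∀ q ∈ S, Submodule.comap (Submodule.mkQ (Ideal.span {c}))
          (Submodule.map (Submodule.mkQ (Ideal.span {c})) (valIdeal w hw0 (q : ℚ))) =
            valIdeal w hw0 (q : ℚ) := by
        intro q hq
        rw [Submodule.comap_map_mkQ]
        exact sup_eq_right.2 (hker q hq)
      have h2 := congrArg (Submodule.comap (Submodule.mkQ (Ideal.span {c}))) heq
      simp only [J] at h2
      rw [hcomap _ (S.orderEmbOfFin_mem hn _), hcomap _ (S.orderEmbOfFin_mem hn _)] at h2
      obtain ⟨⟨g, hg⟩, -⟩ := hS _ (S.orderEmbOfFin_mem hn j.rev)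
      have hgm : g ∈ valIdeal w hw0 (e j.rev : ℚ) := hg.ge
      rw [← h2] at hgm
      have : ((e i.rev : ℚ) : WithTop ℚ) ≤ w g := hgm
      rw [hg] at this
      exact absurd (WithTop.coe_le_coe.1 this) (not_le.2 hlt)
  let s : LTSeries (Submodule A (A ⧸ Ideal.span {c})) := LTSeries.mk n J hJ
  have hs := Order.LTSeries.length_le_krullDim s
  rw [← Module.coe_length] at hs
  have : (n : ℕ∞) ≤ Module.length A (A ⧸ Ideal.span {c}) := by exact_mod_cast hs
  rw [hn]
  push_cast
  exact add_le_add_left this 1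

theorem ord_ne_top_of_dvd_pow [IsLocalRing A] [IsNoetherianRing A] (c : A)
    (hc : ∀ b ∈ IsLocalRing.maximalIdeal A, ∃ n : ℕ, c ∣ b ^ n) : Ring.ord A c ≠ ⊤ := by
  by_cases hu : IsUnit c
  · simp [Ring.ord_of_isUnit hu]
  have : Nontrivial (A ⧸ Ideal.span {c}) :=
    Ideal.Quotient.nontrivial_iff.2 (by rwa [Ne, Ideal.span_singleton_eq_top])
  obtain ⟨n, hn⟩ : ∃ n, IsLocalRing.maximalIdeal A ^ n ≤ Ideal.span {c} := by
    refine Ideal.exists_pow_le_of_le_radical_of_fg (fun b hb => ?_)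
      (IsNoetherian.noetherian _)
    obtain ⟨n, hn⟩ := hc b hb
    exact ⟨n, Ideal.mem_span_singleton.2 hn⟩
  have : IsLocalRing (A ⧸ Ideal.span {c}) :=
    IsLocalRing.of_surjective' (Ideal.Quotient.mk _) Ideal.Quotient.mk_surjective
  have : IsArtinianRing (A ⧸ Ideal.span {c}) := by
    rw [isArtinianRing_iff_isNilpotent_maximalIdeal]
    refine ⟨n, ?_⟩
    have hmap : IsLocalRing.maximalIdeal (A ⧸ Ideal.span {c}) =
        (IsLocalRing.maximalIdeal A).map (Ideal.Quotient.mk (Ideal.span {c})) := by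
      refine le_antisymm (fun z hz => ?_) ?_
      · obtain ⟨b, rfl⟩ := Ideal.Quotient.mk_surjective z
        refine Ideal.mem_map_of_mem _ ?_
        rw [IsLocalRing.mem_maximalIdeal] at hz ⊢
        exact fun h => hz (h.map _)
      · rw [Ideal.map_le_iff_le_comap]
        exact ((IsLocalRing.local_hom_TFAE (Ideal.Quotient.mk (Ideal.span {c}))).out 0 3).1
          (IsLocalHom.of_surjective _ Ideal.Quotient.mk_surjective)
    rw [hmap, ← Ideal.map_pow]
    rw [Ideal.zero_eq_bot, Ideal.map_eq_bot_iff_le_ker, Ideal.mk_ker]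
    exact hn
  have : IsArtinian A (A ⧸ Ideal.span {c}) :=
    isArtinian_of_surjective_algebraMap (Ideal.Quotient.mk_surjective (I := .span {c}))
  exact Module.length_ne_top

/-- The value group of a Noetherian local domain with an `m`-primary principal ideal is not
infinitely divisible. -/
theorem false_of_principal_primary [IsDomain A] [IsLocalRing A] [IsNoetherianRing A]
    (hw0 : ∀ a, 0 ≤ w a) (hwm : ∀ a, a ∈ IsLocalRing.maximalIdeal A ↔ 0 < w a)
    (hwt : ∀ a, w a = ⊤ → a = 0)
    (t : A) (ht : w t = ((1 : ℚ) : WithTop ℚ)) (r : ℕ) (β : ℕ → ℚ) (f : ℕ → A)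
    (hf : ∀ i, w (f i) = (β i : WithTop ℚ))
    (hβ : ∀ i, β i ∉ fracGroup r i) (hβ' : ∀ i, β i ∈ fracGroup r (i + 1))
    (c : A) (hcm : c ∈ IsLocalRing.maximalIdeal A)
    (hc : ∀ b ∈ IsLocalRing.maximalIdeal A, ∃ n : ℕ, c ∣ b ^ n) : False := by
  have ht0 : t ≠ 0 := by rintro rfl; simp at ht
  have hc0 : c ≠ 0 := by
    rintro rfl
    obtain ⟨n, hn⟩ := hc t ((hwm t).2 (by rw [ht]; exact_mod_cast zero_lt_one))
    exact ht0 (eq_zero_of_pow_eq_zero (zero_dvd_iff.1 hn))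
  obtain ⟨γ, hγ⟩ : ∃ γ : ℚ, w c = (γ : WithTop ℚ) :=
    (WithTop.ne_top_iff_exists.1 fun h => hc0 (hwt c h)).imp fun _ h => h.symm
  have hγ0 : 0 < γ := by
    have := (hwm c).1 hcm
    rw [hγ] at this
    exact_mod_cast this
  obtain ⟨ℓ, hℓ⟩ := ENat.ne_top_iff_exists.1 (ord_ne_top_of_dvd_pow c hc)
  have key : ∀ M : ℕ, ∃ S : Finset ℚ, S.card = 2 ^ M ∧ (∀ q ∈ S, ∃ g, w g = (q : WithTop ℚ)) ∧
      (∀ q ∈ S, q ∈ fracGroup r M) ∧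
      ∀ q ∈ S, ∀ q' ∈ S, (∃ n : ℤ, q - q' = n) → q = q' := by
    intro M
    induction M with
    | zero =>
      refine ⟨{0}, by simp, ?_, ?_, ?_⟩
      · rintro q hq
        rw [Finset.mem_singleton] at hq
        exact ⟨1, by simp [hq]⟩
      · rintro q hq
        rw [Finset.mem_singleton] at hq
        rw [hq]; exact zero_mem _
      · rintro q hq q' hq' -
        rw [Finset.mem_singleton] at hq hq'
        rw [hq, hq']
    | succ M ih =>
      obtain ⟨S, hS1, hS2, hS3, hS4⟩ := ih
      have hinj : Function.Injective fun q : ℚ => q + β M := fun a b h => by simpa using h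
      have hdis : ∀ q ∈ S, ∀ q' ∈ S, ¬ ∃ n : ℤ, q - (q' + β M) = n := by
        rintro q hq q' hq' ⟨n, hn⟩
        apply hβ M
        have : β M = q - q' - n := by rw [← hn]; ring
        rw [this]
        exact sub_mem (sub_mem (hS3 q hq) (hS3 q' hq')) (intCast_mem_fracGroup r M n)
      refine ⟨S ∪ S.image (fun q => q + β M), ?_, ?_, ?_, ?_⟩
      · rw [Finset.card_union_of_disjoint, Finset.card_image_of_injective _ hinj, hS1]
        · ring
        · rw [Finset.disjoint_left]
          intro q hq hmem
          obtain ⟨q', hq', rfl⟩ := Finset.mem_image.1 hmem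
          exact hdis _ hq q' hq' ⟨0, by simp⟩
      · intro q hq
        rcases Finset.mem_union.1 hq with hq | hq
        · exact hS2 q hq
        · obtain ⟨q', hq', rfl⟩ := Finset.mem_image.1 hq
          obtain ⟨g, hg⟩ := hS2 q' hq'
          exact ⟨g * f M, by rw [w.map_mul, hg, hf, ← WithTop.coe_add]⟩
      · intro q hq
        rcases Finset.mem_union.1 hq with hq | hq
        · exact fracGroup_mono r (Nat.le_succ M) (hS3 q hq)
        · obtain ⟨q', hq', rfl⟩ := Finset.mem_image.1 hq
          exact add_mem (fracGroup_mono r (Nat.le_succ M) (hS3 q' hq')) (hβ' M)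
      · intro q hq q' hq' h
        rcases Finset.mem_union.1 hq with hq | hq <;> rcases Finset.mem_union.1 hq' with hq' | hq'
        · exact hS4 q hq q' hq' h
        · obtain ⟨q₁, hq₁, rfl⟩ := Finset.mem_image.1 hq'
          exact absurd h (hdis q hq q₁ hq₁)
        · obtain ⟨q₁, hq₁, rfl⟩ := Finset.mem_image.1 hq
          obtain ⟨n, hn⟩ := h
          exact absurd ⟨-n, by push_cast; rw [← hn]; ring⟩ (hdis q' hq' q₁ hq₁)
        · obtain ⟨q₁, hq₁, rfl⟩ := Finset.mem_image.1 hq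
          obtain ⟨q₂, hq₂, rfl⟩ := Finset.mem_image.1 hq'
          obtain ⟨n, hn⟩ := h
          rw [hS4 q₁ hq₁ q₂ hq₂ ⟨n, by rw [← hn]; ring⟩]
  have bound : ∀ M L N : ℕ, ∀ C : ℚ, (∀ S : Finset ℚ, S.card = 2 ^ M →
      (∀ q ∈ S, ∃ g, w g = (q : WithTop ℚ)) →
      (∀ q ∈ S, ∀ q' ∈ S, (∃ n : ℤ, q - q' = n) → q = q') → (∀ q ∈ S, q ≤ C) →
      C + L ≤ N * γ → 2 ^ M * L ≤ N * ℓ + 1) := by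
    intro M L N C S hS1 hS2 hS4 hSC hN
    let S' : Finset ℚ := (S ×ˢ Finset.range L).image fun p => p.1 + p.2
    have hcard : S'.card = 2 ^ M * L := by
      rw [Finset.card_image_of_injOn, Finset.card_product, hS1, Finset.card_range]
      rintro ⟨q, a⟩ h ⟨q', a'⟩ h' heq
      simp only [Finset.coe_product, Set.mem_prod, Finset.mem_coe] at h h'
      simp only at heq
      have h1 := hS4 q h.1 q' h'.1 ⟨a' - a, by push_cast; linarith⟩
      subst h1
      simpa using heq
    have h := card_values_le w hw0 (c ^ N) S' (by
      intro q hq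
      obtain ⟨⟨q, a⟩, hqa, rfl⟩ := Finset.mem_image.1 hq
      obtain ⟨hq, ha⟩ := Finset.mem_product.1 hqa
      obtain ⟨g, hg⟩ := hS2 q hq
      constructor
      · refine ⟨g * t ^ a, ?_⟩
        rw [w.map_mul, w.map_pow, hg, ht, ← WithTop.coe_nsmul, ← WithTop.coe_add]
        simp
      · rw [w.map_pow, hγ, ← WithTop.coe_nsmul]
        refine WithTop.coe_le_coe.2 ?_
        have : (a : ℚ) ≤ L := by exact_mod_cast (Finset.mem_range.1 ha).le
        have := hSC q hq
        simp only [nsmul_eq_mul]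
        linarith)
    rw [hcard, Ring.ord_pow (mem_nonZeroDivisors_of_ne_zero hc0), ← hℓ] at h
    rw [nsmul_eq_mul] at h
    exact_mod_cast h
  obtain ⟨M, hM⟩ : ∃ M : ℕ, (ℓ : ℚ) / γ + 1 < 2 ^ M := pow_unbounded_of_one_lt _ one_lt_two
  obtain ⟨S, hS1, hS2, hS3, hS4⟩ := key M
  obtain ⟨C, hC⟩ : ∃ C : ℚ, ∀ q ∈ S, q ≤ C := by
    obtain ⟨C, hC⟩ := S.bddAbove
    exact ⟨C, fun q hq => hC hq⟩
  have hC0 : ∀ q ∈ S, q ≤ max C 0 := fun q hq => (hC q hq).trans (le_max_left _ _)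
  set C' := max C 0
  have hC'0 : 0 ≤ C' := le_max_right _ _
  obtain ⟨L, hL⟩ := exists_nat_gt ((ℓ : ℚ) * (C' / γ + 1) + 1)
  have hnn : (0 : ℚ) ≤ (C' + L) / γ := by positivity
  have hb := bound M L ⌈(C' + L) / γ⌉₊ C' S hS1 hS2 hS4 hC0 (by
    rw [← div_le_iff₀ hγ0]; exact Nat.le_ceil _)
  have hb' : (2 : ℚ) ^ M * L ≤ ⌈(C' + L) / γ⌉₊ * ℓ + 1 := by exact_mod_cast hb
  have hceil := (Nat.ceil_lt_add_one hnn).le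
  have hℓ0 : (0 : ℚ) ≤ ℓ := by positivity
  have h3 : (2 : ℚ) ^ M * L ≤ ((C' + L) / γ + 1) * ℓ + 1 :=
    hb'.trans (by gcongr)
  have hLpos : (0 : ℚ) < L := lt_of_le_of_lt (by positivity) hL
  have h4 : ((ℓ : ℚ) / γ + 1) * L < 2 ^ M * L := by gcongr
  have h5 : ((C' + L) / γ + 1) * ℓ + 1 = (ℓ : ℚ) * (C' / γ + 1) + 1 + ℓ / γ * L := by ring
  linarith

end Order

section Parameters

open IsLocalRing

variable {κ A : Type*} [Field κ] [CommRing A] [Algebra κ A] [IsLocalRing A]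

theorem exists_smul_pow_isUnit [Infinite κ] (n : ℕ) (c : ℕ → A)
    (hc : ∃ j ≤ n, c j ∉ maximalIdeal A) :
    ∃ μ : κ, IsUnit (∑ j ∈ Finset.range (n + 1), c j * algebraMap κ A μ ^ (n - j)) := by
  classical
  by_contra! h
  let p : Polynomial (ResidueField A) :=
    ∑ j ∈ Finset.range (n + 1), Polynomial.monomial (n - j) (residue A (c j))
  let φ : κ →+* ResidueField A := (residue A).comp (algebraMap κ A)
  have hp : p = 0 := by
    refine Polynomial.eq_zero_of_infinite_isRoot p
      ((Set.infinite_range_of_injective φ.injective).mono ?_)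
    rintro _ ⟨μ, rfl⟩
    have h1 : residue A (∑ j ∈ Finset.range (n + 1), c j * algebraMap κ A μ ^ (n - j)) = 0 :=
      (residue_eq_zero_iff _).2 ((mem_maximalIdeal _).2 (h μ))
    show p.IsRoot (φ μ)
    rw [Polynomial.IsRoot.def, Polynomial.eval_finsetSum, ← h1]
    simp [φ, Polynomial.eval_monomial]
  obtain ⟨j, hj, hcj⟩ := hc
  apply hcj
  rw [← residue_eq_zero_iff]
  have h2 : p.coeff (n - j) = 0 := by rw [hp, Polynomial.coeff_zero]
  rw [Polynomial.finsetSum_coeff, Finset.sum_eq_single j] at h2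
  · simpa using h2
  · intro i hi hij
    rw [Polynomial.coeff_monomial, if_neg]
    have := Finset.mem_range.1 hi
    omega
  · intro h3
    exact absurd (Finset.mem_range.2 (by omega)) h3

theorem exists_dvd_pow_pair [Infinite κ] (a b : A) (ha : a ∈ maximalIdeal A)
    (hb : b ∈ maximalIdeal A) (n : ℕ) (c : ℕ → A) (hc : ∃ j ≤ n, c j ∉ maximalIdeal A)
    (h : ∑ j ∈ Finset.range (n + 1), c j * a ^ (n - j) * b ^ j = 0) :
    ∃ a' ∈ maximalIdeal A, a' ∣ a ^ n ∧ a' ∣ b ^ n := by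
  obtain ⟨μ, hμ⟩ := exists_smul_pow_isUnit (κ := κ) n c hc
  set m := algebraMap κ A μ
  let q := Ideal.Quotient.mk (Ideal.span {a - m * b})
  have hq : q a = q (m * b) := by
    rw [Ideal.Quotient.eq]; exact Ideal.mem_span_singleton_self _
  have hbn : (a - m * b) ∣ b ^ n := by
    have h1 : q ((∑ j ∈ Finset.range (n + 1), c j * m ^ (n - j)) * b ^ n) = 0 := by
      rw [← map_zero q, ← h, Finset.sum_mul, map_sum, map_sum]
      refine Finset.sum_congr rfl fun j hj => ?_
      have hj' : n - j + j = n := Nat.sub_add_cancel (Nat.lt_succ_iff.1 (Finset.mem_range.1 hj))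
      rw [map_mul q (c j * a ^ (n - j)), map_mul q (c j) (a ^ _), map_pow q a, hq, ← map_pow q,
        ← map_mul q, ← map_mul q]
      congr 1
      calc c j * m ^ (n - j) * b ^ n = c j * m ^ (n - j) * b ^ (n - j + j) := by rw [hj']
        _ = _ := by ring
    rw [Ideal.Quotient.eq_zero_iff_mem, Ideal.mem_span_singleton] at h1
    exact (hμ.dvd_mul_left).1 h1
  refine ⟨a - m * b, sub_mem ha (Ideal.mul_mem_left _ _ hb), ?_, hbn⟩
  have h2 : q (a ^ n) = 0 := by
    rw [map_pow, hq, ← map_pow, mul_pow, map_mul]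
    rw [(Ideal.Quotient.eq_zero_iff_mem (a := b ^ n)).2 (Ideal.mem_span_singleton.2 hbn), mul_zero]
  rwa [Ideal.Quotient.eq_zero_iff_mem, Ideal.mem_span_singleton] at h2

/-- If any two elements of the maximal ideal are analytically dependent, then some principal
ideal is primary to the maximal ideal. -/
theorem exists_principal_primary [Infinite κ] [IsNoetherianRing A]
    (h : ∀ a ∈ maximalIdeal A, ∀ b ∈ maximalIdeal A, ∃ n : ℕ, ∃ c : ℕ → A,
      (∃ j ≤ n, c j ∉ maximalIdeal A) ∧
        ∑ j ∈ Finset.range (n + 1), c j * a ^ (n - j) * b ^ j = 0) :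
    ∃ c ∈ maximalIdeal A, ∀ b ∈ maximalIdeal A, ∃ n : ℕ, c ∣ b ^ n := by
  classical
  have key : ∀ s : Finset A, (∀ b ∈ s, b ∈ maximalIdeal A) →
      ∃ c ∈ maximalIdeal A, ∀ b ∈ s, ∃ n : ℕ, c ∣ b ^ n := by
    intro s
    induction s using Finset.induction_on with
    | empty => exact fun _ => ⟨0, zero_mem _, by simp⟩
    | insert b s _ ih =>
      intro hs
      obtain ⟨c, hcm, hc⟩ := ih fun z hz => hs z (Finset.mem_insert_of_mem hz)
      have hb := hs b (Finset.mem_insert_self _ _)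
      obtain ⟨n, e, he, hsum⟩ := h c hcm b hb
      obtain ⟨a', ha', h1, h2⟩ := exists_dvd_pow_pair (κ := κ) c b hcm hb n e he hsum
      refine ⟨a', ha', fun z hz => ?_⟩
      rcases Finset.mem_insert.1 hz with rfl | hz
      · exact ⟨n, h2⟩
      · obtain ⟨m, hm⟩ := hc z hz
        exact ⟨m * n, h1.trans (by rw [pow_mul]; exact pow_dvd_pow_of_dvd hm n)⟩
  obtain ⟨s, hs⟩ := (IsNoetherian.noetherian (maximalIdeal A) : (maximalIdeal A).FG)
  obtain ⟨c, hcm, hc⟩ := key s fun b hb => hs ▸ Submodule.subset_span hb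
  refine ⟨c, hcm, fun b hb => ?_⟩
  have hle : maximalIdeal A ≤ (Ideal.span {c}).radical := by
    rw [← hs]
    refine Submodule.span_le.2 fun z hz => ?_
    obtain ⟨n, hn⟩ := hc z hz
    exact ⟨n, Ideal.mem_span_singleton.2 hn⟩
  obtain ⟨n, hn⟩ := hle hb
  exact ⟨n, Ideal.mem_span_singleton.1 hn⟩

open Polynomial in
/-- Residually independent elements are independent over polynomials in `a` and `b / a`, when
`a, b` are analytically independent. -/
theorem eq_zero_of_analytically_independent {K : Type*} [Field K] [Algebra A K]
    [FaithfulSMul A K] (a b : A) (ha0 : a ≠ 0) (ha : a ∈ maximalIdeal A)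
    (hab : ∀ (n : ℕ) (c : ℕ → A),
      ∑ j ∈ Finset.range (n + 1), c j * a ^ (n - j) * b ^ j = 0 → ∀ j ≤ n, c j ∈ maximalIdeal A)
    {ι : Type*} [Fintype ι] (l : ι → A)
    (hl : ∀ c : ι → κ, ∑ i, algebraMap κ A (c i) * l i ∈ maximalIdeal A → ∀ i, c i = 0)
    (Q : ι → κ[X][X])
    (hQ : ∑ i, (Q i).eval₂ ((algebraMap A K).comp (aeval a : κ[X] →ₐ[κ] A).toRingHom)
      (algebraMap A K b / algebraMap A K a) * algebraMap A K (l i) = 0) : ∀ i, Q i = 0 := by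
  classical
  have hinj : Function.Injective (algebraMap A K) := FaithfulSMul.algebraMap_injective A K
  have haK : algebraMap A K a ≠ 0 := (map_ne_zero_iff _ hinj).2 ha0
  set ρ : κ[X] →+* A := (aeval a : κ[X] →ₐ[κ] A).toRingHom with hρ
  have hρX : ρ X = a := by simp [hρ]
  set u := algebraMap A K b / algebraMap A K a
  -- the lowest order terms in `a` vanish
  have step : ∀ Q : ι → κ[X][X],
      ∑ i, (Q i).eval₂ ((algebraMap A K).comp ρ) u * algebraMap A K (l i) = 0 →
      ∀ i j, ((Q i).coeff j).coeff 0 = 0 := by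
    intro Q hQ i j
    let N := j + ∑ i, (Q i).natDegree
    have hN : ∀ i, (Q i).natDegree < N + 1 := fun i =>
      Nat.lt_succ_of_le ((Finset.single_le_sum (f := fun i => (Q i).natDegree)
        (fun _ _ => Nat.zero_le _) (Finset.mem_univ i)).trans (Nat.le_add_left _ _))
    have h1 := hab N (fun j => ∑ i, ρ ((Q i).coeff j) * l i) (by
      apply hinj
      rw [map_zero, ← mul_zero (algebraMap A K a ^ N), ← hQ, map_sum, Finset.mul_sum]
      simp only [eval₂_eq_sum_range' _ (hN _), Finset.sum_mul, Finset.mul_sum, map_mul, map_sum,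
        map_pow]
      rw [Finset.sum_comm]
      refine Finset.sum_congr rfl fun i _ => Finset.sum_congr rfl fun j hj => ?_
      have hj' : N - j + j = N := Nat.sub_add_cancel (Nat.lt_succ_iff.1 (Finset.mem_range.1 hj))
      have : algebraMap A K a ^ N * u ^ j = algebraMap A K a ^ (N - j) * algebraMap A K b ^ j := by
        rw [← hj', pow_add, Nat.add_sub_cancel, mul_assoc, ← mul_pow, mul_div_cancel₀ _ haK]
      simp only [RingHom.comp_apply]
      linear_combination (-(algebraMap A K) (ρ ((Q i).coeff j)) * (algebraMap A K) (l i)) * this)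
      j (Nat.le_add_right _ _)
    refine hl (fun i => ((Q i).coeff j).coeff 0) ?_ i
    have h2 : ∑ i, ρ ((Q i).coeff j) * l i - ∑ i, algebraMap κ A (((Q i).coeff j).coeff 0) * l i
        ∈ maximalIdeal A := by
      rw [← Finset.sum_sub_distrib]
      refine sum_mem fun i _ => ?_
      rw [← sub_mul]
      refine Ideal.mul_mem_right _ _ ?_
      have h3 : ρ ((Q i).coeff j) =
          a * ρ ((Q i).coeff j).divX + algebraMap κ A (((Q i).coeff j).coeff 0) := by
        conv_lhs => rw [← X_mul_divX_add ((Q i).coeff j)]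
        rw [map_add, map_mul, hρX]
        simp [hρ]
      rw [h3, add_sub_cancel_right]
      exact Ideal.mul_mem_right _ _ ha
    simpa using sub_mem h1 h2
  have key : ∀ d : ℕ, ∀ Q : ι → κ[X][X],
      ∑ i, (Q i).eval₂ ((algebraMap A K).comp ρ) u * algebraMap A K (l i) = 0 →
      ∀ i j, ((Q i).coeff j).coeff d = 0 := by
    intro d
    induction d with
    | zero => exact step
    | succ d ih =>
      intro Q hQ
      have h0 := step Q hQ
      have hdvd : ∀ i, C X ∣ Q i := fun i =>
        (C_dvd_iff_dvd_coeff _ _).2 fun j => X_dvd_iff.2 (h0 i j)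
      choose Q' hQ' using hdvd
      have h1 : ∑ i, (Q' i).eval₂ ((algebraMap A K).comp ρ) u * algebraMap A K (l i) = 0 := by
        apply (mul_eq_zero.1 _).resolve_left haK
        rw [← hQ, Finset.mul_sum]
        refine Finset.sum_congr rfl fun i _ => ?_
        conv_rhs => rw [hQ' i]
        rw [eval₂_mul, eval₂_C, RingHom.comp_apply, hρX, mul_assoc]
      intro i j
      rw [hQ' i, coeff_C_mul, coeff_X_mul]
      exact ih Q' h1 i j
  intro i
  ext j d
  simpa using key d Q hQ i j

end Parameters

section TranscendenceDegreeTwo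

variable {κ K : Type*} [Field κ] [Field K] [Algebra κ K]

open scoped IntermediateField.algebraAdjoinAdjoin in
theorem exists_dependent_of_algebraicIndependent [Algebra.EssFiniteType κ K]
    (htr : Algebra.trdeg κ K ≤ 2) (z : Fin 2 → K) (hz : AlgebraicIndependent κ z) :
    ∃ d : ℕ, ∀ l : Fin (d + 1) → K, ∃ Q : Fin (d + 1) → MvPolynomial (Fin 2) κ,
      Q ≠ 0 ∧ ∑ i, MvPolynomial.aeval z (Q i) * l i = 0 := by
  have hb : IsTranscendenceBasis κ z :=
    hz.isTranscendenceBasis_of_lift_trdeg_le_of_finite (by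
      simpa using htr)
  have : Algebra.IsAlgebraic (IntermediateField.adjoin κ (Set.range z)) K := hb.isAlgebraic_field
  have : Algebra.EssFiniteType (IntermediateField.adjoin κ (Set.range z)) K :=
    Algebra.EssFiniteType.of_comp κ _ K
  have : Module.Finite (IntermediateField.adjoin κ (Set.range z)) K :=
    Algebra.finite_of_essFiniteType_of_isAlgebraic
  refine ⟨Module.finrank (IntermediateField.adjoin κ (Set.range z)) K, fun l => ?_⟩
  have hdep : ¬ LinearIndependent (Algebra.adjoin κ (Set.range z)) l := fun h => by
    have := ((LinearIndependent.iff_fractionRing (Algebra.adjoin κ (Set.range z))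
      (IntermediateField.adjoin κ (Set.range z))).1 h).fintype_card_le_finrank
    simp at this
  obtain ⟨g, hg, i₀, hi₀⟩ := Fintype.not_linearIndependent_iff.1 hdep
  have hex : ∀ i, ∃ Q : MvPolynomial (Fin 2) κ, MvPolynomial.aeval z Q = (g i : K) := fun i =>
    (Algebra.adjoin_range_eq_range_aeval κ z).le (g i).2
  choose Q hQ using hex
  refine ⟨Q, fun h => hi₀ ?_, ?_⟩
  · have := hQ i₀
    rw [h, Pi.zero_apply, map_zero] at this
    exact Subtype.ext this.symm
  · simpa [hQ, Algebra.smul_def] using hg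

/-- The isomorphism of a polynomial ring in two variables with an iterated polynomial ring,
as an injective map. -/
def toIterated (κ : Type*) [Field κ] : MvPolynomial (Fin 2) κ →ₐ[κ] Polynomial (Polynomial κ) :=
  MvPolynomial.aeval ![Polynomial.X, Polynomial.C Polynomial.X]

theorem eval₂_toIterated {B : Type*} [CommRing B] [Algebra κ B] (a u : B)
    (Q : MvPolynomial (Fin 2) κ) :
    (toIterated κ Q).eval₂ (Polynomial.aeval a : Polynomial κ →ₐ[κ] B).toRingHom u =
      MvPolynomial.aeval ![u, a] Q := by
  induction Q using MvPolynomial.induction_on with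
  | C c =>
    simp only [toIterated, MvPolynomial.algHom_C]
    rw [Polynomial.algebraMap_apply, Polynomial.eval₂_C]
    simp
  | add p q hp hq => rw [map_add, Polynomial.eval₂_add, hp, hq, map_add]
  | mul_X p i hp =>
    rw [map_mul, Polynomial.eval₂_mul, hp, map_mul]
    congr 1
    fin_cases i <;> simp [toIterated]

theorem toIterated_injective : Function.Injective (toIterated κ) := by
  refine Function.LeftInverse.injective (g := fun Q => Q.eval₂
    (Polynomial.aeval (MvPolynomial.X 1) : Polynomial κ →ₐ[κ] MvPolynomial (Fin 2) κ).toRingHom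
    (MvPolynomial.X 0)) fun Q => ?_
  show (toIterated κ Q).eval₂ _ _ = Q
  rw [eval₂_toIterated]
  conv_rhs => rw [← MvPolynomial.aeval_X_left_apply Q]
  congr 2
  ext i
  fin_cases i <;> simp

end TranscendenceDegreeTwo

section Valuation

open IsLocalRing

variable {κ K : Type*} [Field κ] [Field K] [Algebra κ K] [Algebra.EssFiniteType κ K]

/-- A Noetherian local ring birational to a two-dimensional function field with enough values has
finite residue degree over the coefficient field. -/
theorem exists_residue_spanning (htr : Algebra.trdeg κ K ≤ 2) {A : Type*} [CommRing A]
    [Algebra κ A] [Algebra A K] [IsScalarTower κ A K] [FaithfulSMul A K] [IsLocalRing A]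
    (a b : A) (ha0 : a ≠ 0) (ha : a ∈ maximalIdeal A)
    (hab : ∀ (n : ℕ) (c : ℕ → A),
      ∑ j ∈ Finset.range (n + 1), c j * a ^ (n - j) * b ^ j = 0 → ∀ j ≤ n, c j ∈ maximalIdeal A) :
    ∃ (n : ℕ) (l : Fin n → A), ∀ f : A, ∃ c : Fin n → κ,
      f - ∑ i, algebraMap κ A (c i) * l i ∈ maximalIdeal A := by
  classical
  let z : Fin 2 → K := ![algebraMap A K b / algebraMap A K a, algebraMap A K a]
  have hcomp : (algebraMap A K).comp
      (Polynomial.aeval a : Polynomial κ →ₐ[κ] A).toRingHom =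
      (Polynomial.aeval (algebraMap A K a) : Polynomial κ →ₐ[κ] K).toRingHom := by
    ext c
    · simp [← IsScalarTower.algebraMap_apply]
    · simp
  have hdep : ∀ (m : ℕ) (l : Fin m → A),
      (∀ c : Fin m → κ, ∑ i, algebraMap κ A (c i) * l i ∈ maximalIdeal A → ∀ i, c i = 0) →
      ∀ Q : Fin m → MvPolynomial (Fin 2) κ,
        ∑ i, MvPolynomial.aeval z (Q i) * algebraMap A K (l i) = 0 → Q = 0 := by
    intro m l hl Q hQ
    ext1 i
    refine toIterated_injective ?_
    rw [Pi.zero_apply, map_zero]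
    refine eq_zero_of_analytically_independent (κ := κ) (K := K) a b ha0 ha hab l hl
      (fun i => toIterated κ (Q i)) ?_ i
    rw [← hQ]
    refine Finset.sum_congr rfl fun i _ => ?_
    rw [hcomp, eval₂_toIterated]
  have hz : AlgebraicIndependent κ z := by
    rw [AlgebraicIndependent, injective_iff_map_eq_zero]
    intro Q hQ
    refine congrFun (hdep 1 (fun _ => 1) ?_ (fun _ => Q) (by simp [hQ])) 0
    intro c hc i
    by_contra hne
    rw [mem_maximalIdeal] at hc
    rw [Subsingleton.elim i 0] at hne
    apply hc
    simpa using (IsUnit.mk0 _ hne).map (algebraMap κ A)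
  obtain ⟨d, hd⟩ := exists_dependent_of_algebraicIndependent htr z hz
  let P : ℕ → Prop := fun m => ∃ l : Fin m → A,
    ∀ c : Fin m → κ, ∑ i, algebraMap κ A (c i) * l i ∈ maximalIdeal A → ∀ i, c i = 0
  have hP0 : P 0 := ⟨Fin.elim0, fun _ _ i => i.elim0⟩
  have hPd : ¬ P (d + 1) := by
    rintro ⟨l, hl⟩
    obtain ⟨Q, hQ0, hQ⟩ := hd fun i => algebraMap A K (l i)
    exact hQ0 (hdep _ l hl Q hQ)
  obtain ⟨m, ⟨l, hl⟩, hm⟩ : ∃ m, P m ∧ ¬ P (m + 1) := by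
    by_contra! h
    exact hPd (Nat.rec hP0 (fun m hm => h m hm) (d + 1))
  refine ⟨m, l, fun f => ?_⟩
  by_contra! hf
  refine hm ⟨Fin.cons f l, fun c hc => ?_⟩
  rw [Fin.sum_univ_succ] at hc
  simp only [Fin.cons_zero, Fin.cons_succ] at hc
  have hc0 : c 0 = 0 := by
    by_contra h0
    apply hf fun i => -((c 0)⁻¹ * c i.succ)
    have h1 := Ideal.mul_mem_left _ (algebraMap κ A (c 0)⁻¹) hc
    have h2 : algebraMap κ A (c 0)⁻¹ * algebraMap κ A (c 0) = 1 := by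
      rw [← map_mul, inv_mul_cancel₀ h0, map_one]
    convert h1 using 1
    rw [mul_add, ← mul_assoc, h2, one_mul, Finset.mul_sum, sub_eq_add_neg, ← Finset.sum_neg_distrib]
    congr 1
    refine Finset.sum_congr rfl fun i _ => ?_
    rw [map_neg, map_mul]
    ring
  rw [hc0, map_zero, zero_mul, zero_add] at hc
  intro i
  refine Fin.cases hc0 (fun j => hl _ hc j) i

end Valuation

section Approximation

open IsLocalRing

variable {κ A : Type*} [Field κ] [CommRing A] [Algebra κ A]
  (w : AddValuation A (WithTop ℚ))

theorem exists_pos_le_of_fg (hw0 : ∀ a, 0 ≤ w a) (s : Finset A) (hs : ∀ g ∈ s, 0 < w g) :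
    ∃ δ : ℚ, 0 < δ ∧ ∀ g ∈ Ideal.span (s : Set A), (δ : WithTop ℚ) ≤ w g := by
  classical
  suffices h : ∃ δ : ℚ, 0 < δ ∧ ∀ g ∈ s, (δ : WithTop ℚ) ≤ w g by
    obtain ⟨δ, hδ, h⟩ := h
    refine ⟨δ, hδ, fun g hg => ?_⟩
    have : Ideal.span (s : Set A) ≤ valIdeal w hw0 δ := Ideal.span_le.2 h
    exact this hg
  induction s using Finset.induction_on with
  | empty => exact ⟨1, one_pos, by simp⟩
  | insert g s _ ih =>
    obtain ⟨δ, hδ, h⟩ := ih fun g hg => hs g (Finset.mem_insert_of_mem hg)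
    obtain ⟨ε, hε, hε'⟩ : ∃ ε : ℚ, 0 < ε ∧ (ε : WithTop ℚ) ≤ w g := by
      have hg := hs g (Finset.mem_insert_self _ _)
      cases h : w g with
      | top => exact ⟨1, one_pos, le_top⟩
      | coe q => rw [h] at hg; exact ⟨q, WithTop.coe_lt_coe.1 hg, le_rfl⟩
    refine ⟨min δ ε, lt_min hδ hε, fun g' hg' => ?_⟩
    rcases Finset.mem_insert.1 hg' with rfl | hg'
    · exact (WithTop.coe_le_coe.2 (min_le_right _ _)).trans hε'
    · exact (WithTop.coe_le_coe.2 (min_le_left _ _)).trans (h g' hg')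

variable [IsLocalRing A] [IsNoetherianRing A]

/-- Every element of `A` is approximated by elements of a subalgebra, with denominators a power
of a fixed element. -/
theorem exists_approximation (hw0 : ∀ a, 0 ≤ w a)
    (hwm : ∀ a, a ∈ maximalIdeal A ↔ 0 < w a) {n : ℕ} (l : Fin n → A)
    (hl : ∀ f : A, ∃ c : Fin n → κ, f - ∑ i, algebraMap κ A (c i) * l i ∈ maximalIdeal A)
    (P : Subalgebra κ A) (hP : ∀ s : Finset A, ∃ d ∈ P, d ≠ 0 ∧ ∀ z ∈ s, d * z ∈ P) :
    ∃ δ : ℚ, 0 < δ ∧ ∃ d ∈ P, d ≠ 0 ∧ ∀ (N : ℕ) (f : A), ∃ g, d ^ N * g ∈ P ∧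
      ((N * δ : ℚ) : WithTop ℚ) ≤ w (f - g) := by
  classical
  obtain ⟨s, hs⟩ := (IsNoetherian.noetherian (maximalIdeal A) : (maximalIdeal A).FG)
  obtain ⟨δ, hδ, hsδ⟩ := exists_pos_le_of_fg w hw0 s fun g hg =>
    (hwm g).1 (hs ▸ Submodule.subset_span hg)
  obtain ⟨d, hdP, hd0, hd⟩ := hP (s ∪ Finset.univ.image l)
  refine ⟨δ, hδ, d, hdP, hd0, fun N => ?_⟩
  induction N with
  | zero => exact fun f => ⟨0, by simp [P.zero_mem], by simp [hw0]⟩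
  | succ N ih =>
    intro f
    obtain ⟨c, hc⟩ := hl f
    rw [← hs] at hc
    obtain ⟨e, -, he⟩ := Submodule.mem_span_finset.1 hc
    choose F hF hF' using ih
    refine ⟨∑ i, algebraMap κ A (c i) * l i + ∑ a ∈ s, F (e a) * a, ?_, ?_⟩
    · rw [mul_add, Finset.mul_sum, Finset.mul_sum]
      refine add_mem (sum_mem fun i _ => ?_) (sum_mem fun a ha => ?_)
      · have h1 : d * l i ∈ P := hd _ (by simp)
        have h2 := P.mul_mem (P.mul_mem (P.pow_mem hdP N) h1) (P.algebraMap_mem (c i))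
        convert h2 using 1
        ring
      · have h1 : d * a ∈ P := hd _ (by simp [ha])
        have h2 := P.mul_mem (hF (e a)) h1
        convert h2 using 1
        ring
    · have h1 : f - (∑ i, algebraMap κ A (c i) * l i + ∑ a ∈ s, F (e a) * a) =
          ∑ a ∈ s, (e a - F (e a)) * a := by
        rw [← sub_sub, ← he, ← Finset.sum_sub_distrib]
        exact Finset.sum_congr rfl fun a _ => by rw [smul_eq_mul]; ring
      rw [h1]
      refine w.map_le_sum fun a ha => ?_
      rw [w.map_mul]
      have h2 : (((N + 1 : ℕ) * δ : ℚ) : WithTop ℚ) = ((N * δ : ℚ) : WithTop ℚ) + (δ : ℚ) := by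
        rw [← WithTop.coe_add]; congr 1; push_cast; ring
      rw [h2]
      exact add_le_add (hF' _) (hsδ a (Submodule.subset_span ha))

end Approximation

/-- A Noetherian ring of nonnegative values cannot realise all the values `β i`, if the values
of a subalgebra `P` are so restricted. -/
theorem false_of_values {κ K : Type*} [Field κ] [Infinite κ] [Field K] [Algebra κ K]
    [Algebra.EssFiniteType κ K] (htr : Algebra.trdeg κ K ≤ 2)
    (v : AddValuation K (WithTop ℚ)) (A : Subalgebra κ K) [IsNoetherianRing A]
    (hA0 : ∀ a ∈ A, 0 ≤ v a) (hA1 : ∀ a ∈ A, v a = 0 → a⁻¹ ∈ A)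
    (P : Subalgebra κ K) (hPA : P ≤ A)
    (hP : ∀ s : Finset K, ∃ d ∈ P, d ≠ 0 ∧ ∀ z ∈ s, d * z ∈ P)
    (t : K) (htA : t ∈ A) (ht : v t = ((1 : ℚ) : WithTop ℚ)) (r : ℕ) (β : ℕ → ℚ) (f : ℕ → K)
    (hfA : ∀ i, f i ∈ A) (hf : ∀ i, v (f i) = (β i : WithTop ℚ))
    (hβ : ∀ i, β i ∉ fracGroup r i) (hβ' : ∀ i, β i ∈ fracGroup r (i + 1))
    (B : ℕ → ℚ) (hB : ∀ i, ∀ F ∈ P, (B i : WithTop ℚ) ≤ v F ∨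
      ∃ q ∈ fracGroup r i, v F = (q : WithTop ℚ))
    (hgrow : ∀ C : ℚ, ∃ i₀, ∀ i ≥ i₀, C * (β i + 1) < B i) : False := by
  classical
  have hunit : ∀ a : A, IsUnit a ↔ v (a : K) = 0 := by
    intro a
    constructor
    · rintro ⟨⟨a, b, hab, -⟩, rfl⟩
      have h1 : v ((a : K) * b) = 0 := by
        have : (a : K) * b = 1 := congrArg Subtype.val hab
        rw [this, v.map_one]
      rw [v.map_mul] at h1
      exact le_antisymm (h1 ▸ le_add_of_nonneg_right (hA0 b b.2)) (hA0 a a.2)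
    · intro h
      have ha0 : (a : K) ≠ 0 := by
        intro h0; rw [h0, v.map_zero] at h; exact absurd h (by simp)
      exact IsUnit.of_mul_eq_one ⟨(a : K)⁻¹, hA1 a a.2 h⟩ (Subtype.ext (mul_inv_cancel₀ ha0))
  have hnu : ∀ a : A, ¬ IsUnit a ↔ 0 < v (a : K) := fun a => by
    rw [hunit]
    exact ⟨fun h => lt_of_le_of_ne (hA0 a a.2) (Ne.symm h), fun h => h.ne'⟩
  have hloc : IsLocalRing A := by
    refine IsLocalRing.of_nonunits_add fun a b ha hb => ?_
    rw [mem_nonunits_iff, hnu] at *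
    exact v.map_lt_add ha hb
  let w : AddValuation A (WithTop ℚ) := v.comap A.val.toRingHom
  have hww : ∀ a : A, w a = v (a : K) := fun _ => rfl
  have hw0 : ∀ a, 0 ≤ w a := fun a => hA0 a a.2
  have hwm : ∀ a, a ∈ IsLocalRing.maximalIdeal A ↔ 0 < w a := fun a => by
    rw [IsLocalRing.mem_maximalIdeal, mem_nonunits_iff, hnu, hww]
  have hwt : ∀ a, w a = ⊤ → a = 0 := fun a h => Subtype.ext (v.top_iff.1 h)
  have hPA' : ∀ s : Finset A, ∃ d ∈ P.comap A.val, d ≠ 0 ∧ ∀ z ∈ s, d * z ∈ P.comap A.val := by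
    intro s
    obtain ⟨d, hd, hd0, h⟩ := hP (s.image Subtype.val)
    exact ⟨⟨d, hPA hd⟩, hd, fun h => hd0 (congrArg Subtype.val h),
      fun z hz => h z (Finset.mem_image_of_mem _ hz)⟩
  by_cases hdep : ∀ a ∈ IsLocalRing.maximalIdeal A, ∀ b ∈ IsLocalRing.maximalIdeal A,
      ∃ n : ℕ, ∃ c : ℕ → A, (∃ j ≤ n, c j ∉ IsLocalRing.maximalIdeal A) ∧
        ∑ j ∈ Finset.range (n + 1), c j * a ^ (n - j) * b ^ j = 0
  · obtain ⟨c, hcm, hc⟩ := exists_principal_primary (κ := κ) hdep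
    exact false_of_principal_primary w hw0 hwm hwt ⟨t, htA⟩ ht r β (fun i => ⟨f i, hfA i⟩) hf
      hβ hβ' c hcm hc
  · push Not at hdep
    obtain ⟨a, ha, b, hb, hab⟩ := hdep
    have hab' : ∀ (n : ℕ) (c : ℕ → A),
        ∑ j ∈ Finset.range (n + 1), c j * a ^ (n - j) * b ^ j = 0 →
        ∀ j ≤ n, c j ∈ IsLocalRing.maximalIdeal A := by
      intro n c h j hj
      by_contra hcj
      exact hab n c ⟨j, hj, hcj⟩ h
    have ha0 : a ≠ 0 := by
      rintro rfl
      refine hab 1 (fun j => if j = 0 then 1 else 0) ⟨0, by simp, ?_⟩ (by simp)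
      rw [if_pos rfl, hwm, w.map_one]; exact lt_irrefl _
    obtain ⟨n, l, hl⟩ := exists_residue_spanning (K := K) htr a b ha0 ha hab'
    obtain ⟨δ, hδ, d, hdP, hd0, happ⟩ := exists_approximation w hw0 hwm l hl (P.comap A.val) hPA'
    obtain ⟨η, hη⟩ : ∃ η : ℚ, w d = (η : WithTop ℚ) :=
      (WithTop.ne_top_iff_exists.1 fun h => hd0 (hwt d h)).imp fun _ h => h.symm
    have hη0 : 0 ≤ η := by
      have := hw0 d
      rw [hη] at this
      exact_mod_cast this
    have hβ0 : ∀ i, 0 ≤ β i := fun i => by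
      have := hA0 _ (hfA i)
      rw [hf] at this
      exact_mod_cast this
    obtain ⟨i, hi⟩ := hgrow (1 + η * (1 / δ + 1))
    have hi := hi i le_rfl
    have hηB : η < B i := by
      refine lt_of_le_of_lt ?_ hi
      have : 0 ≤ 1 / δ := by positivity
      nlinarith [hβ0 i, mul_nonneg hη0 (hβ0 i), mul_nonneg hη0 this,
        mul_nonneg (mul_nonneg hη0 this) (hβ0 i)]
    have hηG : η ∈ fracGroup r i := by
      rcases hB i d hdP with h | ⟨q, hq, h⟩
      · rw [← hww, hη] at h
        exact absurd (WithTop.coe_le_coe.1 h) (not_le.2 hηB)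
      · rw [← hww, hη] at h
        rwa [WithTop.coe_inj.1 h]
    obtain ⟨N, hN⟩ : ∃ N : ℕ, β i < N * δ ∧ (N : ℚ) ≤ β i / δ + 1 := by
      refine ⟨⌊β i / δ⌋₊ + 1, ?_, ?_⟩
      · rw [← div_lt_iff₀ hδ]; exact_mod_cast Nat.lt_floor_add_one _
      · push_cast
        have := Nat.floor_le (div_nonneg (hβ0 i) hδ.le)
        linarith
    obtain ⟨g, hg, hfg⟩ := happ N ⟨f i, hfA i⟩
    have hwg : w g = (β i : WithTop ℚ) := by
      rw [← hf i]
      refine w.map_eq_of_lt_sub (x := ⟨f i, hfA i⟩) ?_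
      rw [w.map_sub_swap]
      refine lt_of_lt_of_le ?_ hfg
      rw [hww, hf i]
      exact WithTop.coe_lt_coe.2 hN.1
    have hwF : w (d ^ N * g) = ((N * η + β i : ℚ) : WithTop ℚ) := by
      rw [w.map_mul, w.map_pow, hη, hwg, ← WithTop.coe_nsmul, ← WithTop.coe_add, nsmul_eq_mul]
    rcases hB i _ hg with h | ⟨q, hq, h⟩
    · change _ ≤ w _ at h
      rw [hwF] at h
      have h1 := WithTop.coe_le_coe.1 h
      have h2 : N * η ≤ (β i / δ + 1) * η := mul_le_mul_of_nonneg_right hN.2 hη0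
      have h3 : (1 + η * (1 / δ + 1)) * (β i + 1) =
          β i + (β i / δ + 1) * η + 1 + η / δ + η * β i := by
        field_simp; ring
      have h4 : 0 ≤ η / δ := by positivity
      have h5 := mul_nonneg hη0 (hβ0 i)
      linarith
    · change w _ = _ at h
      rw [hwF] at h
      have h1 := WithTop.coe_inj.1 h
      apply hβ i
      have : β i = q - N • η := by rw [← h1, nsmul_eq_mul]; ring
      rw [this]
      exact sub_mem hq (nsmul_mem hηG N)

section Hahn

open HahnSeries

variable {F : Type*} [Field F]

theorem le_addVal_iff {f : HahnSeries ℚ F} {γ : ℚ} :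
    (γ : WithTop ℚ) ≤ addVal ℚ F f ↔ ∀ q < γ, f.coeff q = 0 := by
  rw [addVal_apply]
  constructor
  · intro h q hq
    exact coeff_eq_zero_of_lt_orderTop (lt_of_lt_of_le (WithTop.coe_lt_coe.2 hq) h)
  · intro h
    by_contra hlt
    have hf : f ≠ 0 := by rintro rfl; simp at hlt
    rw [orderTop_of_ne_zero hf] at hlt
    have := h _ (WithTop.coe_lt_coe.1 (not_le.1 hlt))
    have h2 := coeff_order_eq_zero.not.2 hf
    rw [order_of_ne hf] at h2
    exact h2 this

theorem addVal_eq_of_coeff_ne_zero {f : HahnSeries ℚ F} {γ : ℚ}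
    (h : (γ : WithTop ℚ) ≤ addVal ℚ F f) (h' : f.coeff γ ≠ 0) : addVal ℚ F f = γ := by
  refine le_antisymm ?_ h
  rw [addVal_apply]
  exact orderTop_le_of_coeff_ne_zero h'

theorem coeff_ne_zero_of_addVal_eq {f : HahnSeries ℚ F} {γ : ℚ}
    (h : addVal ℚ F f = (γ : WithTop ℚ)) : f.coeff γ ≠ 0 := by
  rw [addVal_apply] at h
  exact coeff_orderTop_ne h

theorem lt_addVal_iff {f : HahnSeries ℚ F} {γ : ℚ} :
    (γ : WithTop ℚ) < addVal ℚ F f ↔ ∀ q ≤ γ, f.coeff q = 0 := by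
  constructor
  · intro h q hq
    rw [addVal_apply] at h
    exact coeff_eq_zero_of_lt_orderTop (lt_of_le_of_lt (WithTop.coe_le_coe.2 hq) h)
  · intro h
    refine lt_of_le_of_ne (le_addVal_iff.2 fun q hq => h q hq.le) fun heq => ?_
    exact coeff_ne_zero_of_addVal_eq heq.symm (h γ le_rfl)

theorem addVal_single {q : ℚ} {a : F} (ha : a ≠ 0) : addVal ℚ F (single q a) = (q : WithTop ℚ) := by
  rw [addVal_apply, orderTop_single ha]

theorem addVal_single_nonneg {q : ℚ} (hq : 0 ≤ q) (a : F) : 0 ≤ addVal ℚ F (single q a) := by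
  by_cases ha : a = 0
  · simp [ha]
  · rw [addVal_single ha]; exact_mod_cast hq

theorem coeff_mul_of_le {a b : HahnSeries ℚ F} {γ : ℚ} (ha : (γ : WithTop ℚ) ≤ addVal ℚ F a)
    (hb : 0 ≤ addVal ℚ F b) : (a * b).coeff γ = a.coeff γ * b.coeff 0 := by
  have h1 : (0 : WithTop ℚ) < addVal ℚ F (b - C (b.coeff 0)) := by
    refine (lt_addVal_iff (γ := 0)).2 fun q hq => ?_
    rcases hq.lt_or_eq with hq | rfl
    · rw [coeff_sub, (le_addVal_iff (γ := 0)).1 hb q hq, C_apply,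
        coeff_single_of_ne hq.ne, sub_zero]
    · simp
  have h2 : a * b = a * C (b.coeff 0) + a * (b - C (b.coeff 0)) := by ring
  have h3 : (γ : WithTop ℚ) < addVal ℚ F (a * (b - C (b.coeff 0))) := by
    rw [AddValuation.map_mul]
    by_cases ha0 : addVal ℚ F a = ⊤
    · rw [ha0]; simp
    · refine lt_of_le_of_lt ha ?_
      conv_lhs => rw [← add_zero (addVal ℚ F a)]
      exact WithTop.add_lt_add_left ha0 h1
  rw [h2, coeff_add, lt_addVal_iff.1 h3 γ le_rfl, add_zero, C_apply, coeff_mul_single_zero]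

theorem coeff_zero_pow {b : HahnSeries ℚ F} (hb : 0 ≤ addVal ℚ F b) (n : ℕ) :
    (b ^ n).coeff 0 = b.coeff 0 ^ n := by
  induction n with
  | zero => simp
  | succ n ih =>
    rw [pow_succ, coeff_mul_of_le _ hb, ih, pow_succ]
    rw [AddValuation.map_pow]
    exact nsmul_nonneg hb n

/-- Series of increasing orders converge. -/
theorem exists_limit (n : ℕ → ℕ) (hn : StrictMono n) (f : ℕ → HahnSeries ℚ F)
    (hf : ∀ j, ((n j : ℚ) : WithTop ℚ) ≤ addVal ℚ F (f j)) :
    ∃ y : HahnSeries ℚ F, ∀ N, ((n N : ℚ) : WithTop ℚ) ≤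
      addVal ℚ F (y - ∑ j ∈ Finset.range N, f j) := by
  have hcoeff : ∀ N j, N ≤ j → ∀ q : ℚ, q < n N → (f j).coeff q = 0 := by
    intro N j hj q hq
    refine le_addVal_iff.1 (hf j) q (hq.trans_le ?_)
    exact_mod_cast hn.monotone hj
  have hsum : ∀ N M, N ≤ M → ∀ q : ℚ, q < n N →
      (∑ j ∈ Finset.range M, f j).coeff q = (∑ j ∈ Finset.range N, f j).coeff q := by
    intro N M hNM q hq
    induction M, hNM using Nat.le_induction with
    | base => rfl
    | succ M hM ih => rw [Finset.sum_range_succ, coeff_add, ih, hcoeff N M hM q hq, add_zero]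
  let N : ℚ → ℕ := fun q => ⌊q⌋₊ + 1
  have hN : ∀ q, q < n (N q) := fun q => by
    have h1 : q < (N q : ℕ) := by simpa [N] using Nat.lt_floor_add_one q
    refine h1.trans_le ?_
    exact_mod_cast hn.le_apply
  let φ : ℚ → F := fun q => (∑ j ∈ Finset.range (N q), f j).coeff q
  have hφ : ∀ (M : ℕ) (q : ℚ), q < n M → φ q = (∑ j ∈ Finset.range M, f j).coeff q := by
    intro M q hq
    rw [← hsum M (max M (N q)) (le_max_left _ _) q hq,
      hsum (N q) (max M (N q)) (le_max_right _ _) q (hN q)]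
  have hwf : (Function.support φ).IsPWO := by
    rw [Set.isPWO_iff_isWF, Set.isWF_iff_no_descending_seq]
    intro s hs hmem
    have h0 := (∑ j ∈ Finset.range (N (s 0)), f j).isWF_support
    rw [Set.isWF_iff_no_descending_seq] at h0
    refine h0 s hs fun m => ?_
    have := hmem m
    rw [Function.mem_support, hφ (N (s 0))] at this
    · exact this
    · exact (hs.antitone (Nat.zero_le m)).trans_lt (hN _)
  refine ⟨⟨φ, hwf⟩, fun M => le_addVal_iff.2 fun q hq => ?_⟩
  rw [coeff_sub]
  exact sub_eq_zero.2 (hφ M q hq)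

theorem addVal_aeval_nonneg {R : Type*} [CommRing R] [Algebra R (HahnSeries ℚ F)]
    (hR : ∀ c : R, 0 ≤ addVal ℚ F (algebraMap R _ c)) (p : Polynomial R) {u : HahnSeries ℚ F}
    (hu : 0 ≤ addVal ℚ F u) : 0 ≤ addVal ℚ F (Polynomial.aeval u p) := by
  rw [Polynomial.aeval_eq_sum_range]
  refine AddValuation.map_le_sum _ fun i _ => ?_
  rw [Algebra.smul_def, AddValuation.map_mul, AddValuation.map_pow]
  exact add_nonneg (hR _) (nsmul_nonneg hu _)

variable (F) in
/-- The ring of Hahn series of nonnegative order. -/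
def nonnegSubring : Subring (HahnSeries ℚ F) where
  carrier := {f | 0 ≤ addVal ℚ F f}
  one_mem' := by
    change (0 : WithTop ℚ) ≤ addVal ℚ F 1
    rw [AddValuation.map_one]
  zero_mem' := by
    change (0 : WithTop ℚ) ≤ addVal ℚ F 0
    rw [AddValuation.map_zero]
    exact le_top
  mul_mem' {a b} ha hb := by
    change (0 : WithTop ℚ) ≤ addVal ℚ F (a * b)
    rw [AddValuation.map_mul]
    exact add_nonneg ha hb
  add_mem' {a b} ha hb := by
    change (0 : WithTop ℚ) ≤ addVal ℚ F (a + b)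
    exact AddValuation.map_le_add _ ha hb
  neg_mem' {a} ha := by
    change (0 : WithTop ℚ) ≤ addVal ℚ F (-a)
    rw [AddValuation.map_neg]
    exact ha

theorem mem_nonnegSubring {f : HahnSeries ℚ F} : f ∈ nonnegSubring F ↔ 0 ≤ addVal ℚ F f :=
  Iff.rfl

/-- First order behaviour of a polynomial near a simple root. -/
theorem lt_addVal_aeval_sub {R : Type*} [CommRing R] [Algebra R (HahnSeries ℚ F)]
    (hR : ∀ c : R, 0 ≤ addVal ℚ F (algebraMap R _ c)) (p : Polynomial R) {u ε : HahnSeries ℚ F}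
    (hu : 0 ≤ addVal ℚ F u) (hp : Polynomial.aeval u p = 0) {c e : ℚ}
    (hc : addVal ℚ F (Polynomial.aeval u p.derivative) = (c : WithTop ℚ))
    (hε : (e : WithTop ℚ) ≤ addVal ℚ F ε) (hce : c < e) :
    ((c + e : ℚ) : WithTop ℚ) <
      addVal ℚ F (Polynomial.aeval (u + ε) p - Polynomial.aeval u p.derivative * ε) := by
  have hc0 : 0 ≤ c := by
    have := addVal_aeval_nonneg hR p.derivative hu
    rw [hc] at this
    exact_mod_cast this
  have hε0 : 0 ≤ addVal ℚ F ε := le_trans (by exact_mod_cast (hc0.trans hce.le)) hε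
  let g : R →+* nonnegSubring F := (algebraMap R (HahnSeries ℚ F)).codRestrict (nonnegSubring F)
    fun c => mem_nonnegSubring.2 (hR c)
  have hg : (nonnegSubring F).subtype.comp g = algebraMap R (HahnSeries ℚ F) := rfl
  obtain ⟨κ, hκ⟩ := Polynomial.binomExpansion (p.map g)
    (⟨u, mem_nonnegSubring.2 hu⟩ : nonnegSubring F) ⟨ε, mem_nonnegSubring.2 hε0⟩
  have h2 := congrArg (nonnegSubring F).subtype hκ
  simp only [map_add, map_mul, map_pow, Polynomial.derivative_map, Polynomial.eval_map,
    Polynomial.hom_eval₂, hg] at h2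
  simp only [Subring.subtype_apply, ← Polynomial.aeval_def] at h2
  rw [h2, hp, zero_add, add_sub_cancel_left, AddValuation.map_mul, pow_two, AddValuation.map_mul]
  have h3 : (0 : WithTop ℚ) ≤ addVal ℚ F (κ : HahnSeries ℚ F) := mem_nonnegSubring.1 κ.2
  refine lt_of_lt_of_le ?_ (add_le_add h3 (add_le_add hε hε))
  rw [zero_add]
  exact_mod_cast add_lt_add_left hce e

/-- Recursive choice of a rapidly increasing sequence. -/
theorem exists_increasing_seq {G : Type*} [AddCommMonoid G] (b : G → ℕ) (τ : ℕ → ℕ → G) :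
    ∃ n : ℕ → ℕ, StrictMono n ∧ ∀ i, b (∑ j ∈ Finset.range i, τ j (n j)) < n i := by
  let st : ℕ → G × ℕ := fun i => Nat.rec (0, b 0 + 1)
    (fun i p => (p.1 + τ i p.2, max (b (p.1 + τ i p.2)) p.2 + 1)) i
  have hst : ∀ i, (st i).1 = ∑ j ∈ Finset.range i, τ j (st j).2 := by
    intro i
    induction i with
    | zero => rfl
    | succ i ih => rw [Finset.sum_range_succ, ← ih]
  refine ⟨fun i => (st i).2, strictMono_nat_of_lt_succ fun i => ?_, fun i => ?_⟩
  · exact Nat.lt_succ_of_le (le_max_right _ _)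
  · rw [← hst]
    cases i with
    | zero => exact Nat.lt_succ_self _
    | succ i => exact Nat.lt_succ_of_le (le_max_left _ _)

end Hahn

section Hahn

open HahnSeries

variable {k F : Type*} [Field k] [Field F] [Algebra k F]

/-- The coefficientwise algebra structure, to be preferred to the one through power series. -/
instance (priority := 2000) hahnAlgebra : Algebra k (HahnSeries ℚ F) :=
  HahnSeries.instAlgebra

/-- Hahn series with support in a given group and coefficients in a given field. -/
def suppSubalgebra (Γ : AddSubgroup ℚ) (E : IntermediateField k F) :
    Subalgebra k (HahnSeries ℚ F) where
  carrier := {f | ∀ q, f.coeff q ∈ E ∧ (f.coeff q ≠ 0 → q ∈ Γ)}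
  mul_mem' {a b} ha hb q := by
    rw [coeff_mul]
    constructor
    · exact sum_mem fun i _ => mul_mem (ha _).1 (hb _).1
    · intro h
      obtain ⟨i, hi, hne⟩ := Finset.exists_ne_zero_of_sum_ne_zero h
      rw [Finset.mem_antidiagonal] at hi
      rw [← hi.2.2]
      exact add_mem ((ha _).2 hi.1) ((hb _).2 hi.2.1)
  add_mem' {a b} ha hb q := by
    rw [coeff_add]
    refine ⟨add_mem (ha q).1 (hb q).1, fun h => ?_⟩
    by_cases h0 : a.coeff q = 0
    · exact (hb q).2 (by simpa [h0] using h)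
    · exact (ha q).2 h0
  algebraMap_mem' c q := by
    rw [HahnSeries.algebraMap_apply, C_apply]
    by_cases hq : q = 0
    · subst hq
      simp
    · rw [coeff_single_of_ne hq]
      simp

theorem single_mem_suppSubalgebra {Γ : AddSubgroup ℚ} {E : IntermediateField k F} {q : ℚ}
    (hq : q ∈ Γ) {a : F} (ha : a ∈ E) : single q a ∈ suppSubalgebra Γ E := by
  intro p
  by_cases hp : p = q
  · subst hp
    rw [coeff_single_same]
    exact ⟨ha, fun _ => hq⟩
  · rw [coeff_single_of_ne hp]
    simp

theorem exists_addVal_eq_of_mem_suppSubalgebra {Γ : AddSubgroup ℚ} {E : IntermediateField k F}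
    {f : HahnSeries ℚ F} (hf : f ∈ suppSubalgebra Γ E) (h0 : f ≠ 0) :
    ∃ q ∈ Γ, addVal ℚ F f = (q : WithTop ℚ) := by
  have h1 : addVal ℚ F f ≠ ⊤ := fun h => h0 ((AddValuation.top_iff _).1 h)
  obtain ⟨q, hq⟩ := WithTop.ne_top_iff_exists.1 h1
  exact ⟨q, (hf q).2 (coeff_ne_zero_of_addVal_eq hq.symm), hq.symm⟩

/-- The order of a polynomial expression in an element whose residue has large degree. -/
theorem exists_addVal_sum_eq {Γ : AddSubgroup ℚ} {E : IntermediateField k F} {θ : F} {D : ℕ}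
    (hlin : LinearIndependent E (fun j : Fin D => θ ^ (j : ℕ))) {W : HahnSeries ℚ F}
    (hW : 0 ≤ addVal ℚ F W) (hW0 : W.coeff 0 = θ) (a : Fin D → HahnSeries ℚ F)
    (ha : ∀ j, a j ∈ suppSubalgebra Γ E) (hne : ∃ j, a j ≠ 0) :
    ∃ q ∈ Γ, addVal ℚ F (∑ j, a j * W ^ (j : ℕ)) = (q : WithTop ℚ) := by
  obtain ⟨j₁, hj₁⟩ := hne
  obtain ⟨j₀, -, hj₀⟩ := Finset.exists_min_image Finset.univ (fun j => addVal ℚ F (a j))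
    ⟨j₁, Finset.mem_univ _⟩
  have h0 : a j₀ ≠ 0 := fun h => hj₁ <| by
    have := hj₀ j₁ (Finset.mem_univ _)
    rw [h, AddValuation.map_zero, top_le_iff] at this
    exact (AddValuation.top_iff _).1 this
  obtain ⟨q, hq, hqv⟩ := exists_addVal_eq_of_mem_suppSubalgebra (ha j₀) h0
  have hle : ∀ j, (q : WithTop ℚ) ≤ addVal ℚ F (a j) := fun j =>
    hqv ▸ hj₀ j (Finset.mem_univ _)
  refine ⟨q, hq, addVal_eq_of_coeff_ne_zero ?_ ?_⟩
  · refine AddValuation.map_le_sum _ fun j _ => ?_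
    rw [AddValuation.map_mul, AddValuation.map_pow]
    exact le_add_of_le_of_nonneg (hle j) (nsmul_nonneg hW _)
  · have hsum : (∑ j, a j * W ^ (j : ℕ)).coeff q =
        ∑ j : Fin D, (⟨(a j).coeff q, (ha j q).1⟩ : E) • θ ^ (j : ℕ) := by
      rw [coeff_sum]
      refine Finset.sum_congr rfl fun j _ => ?_
      rw [coeff_mul_of_le (hle j), coeff_zero_pow hW, hW0]
      · rfl
      · rw [AddValuation.map_pow]
        exact nsmul_nonneg hW _
    rw [hsum]
    intro hzero
    have := Fintype.linearIndependent_iff.1 hlin _ hzero j₀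
    exact coeff_ne_zero_of_addVal_eq hqv (congrArg Subtype.val this)

theorem linearIndependent_pow_of_transcendental {θ : F} (hθ : Transcendental k θ) {D : ℕ}
    (hD : 0 < D) :
    LinearIndependent (IntermediateField.adjoin k {θ ^ D}) (fun j : Fin D => θ ^ (j : ℕ)) := by
  open scoped IntermediateField.algebraAdjoinAdjoin in
  rw [← LinearIndependent.iff_fractionRing (R := Algebra.adjoin k {θ ^ D})]
  rw [Fintype.linearIndependent_iff]
  intro c hc
  have hrep : ∀ j, ∃ p : Polynomial k, Polynomial.aeval (θ ^ D) p = (c j : F) := fun j => by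
    have h := (Algebra.adjoin_singleton_eq_range_aeval k (θ ^ D)).le (c j).2
    exact h
  choose p hp using hrep
  have hsum : Polynomial.aeval θ
      (∑ j : Fin D, Polynomial.expand k D (p j) * Polynomial.X ^ (j : ℕ)) = 0 := by
    rw [map_sum, ← hc]
    refine Finset.sum_congr rfl fun j _ => ?_
    rw [map_mul, Polynomial.expand_aeval, hp, map_pow, Polynomial.aeval_X]
    rfl
  have hzero := (transcendental_iff.1 hθ) _ hsum
  intro j₀
  have hpj : p j₀ = 0 := by
    ext m
    have h1 := congrArg (fun f => Polynomial.coeff f (D * m + j₀)) hzero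
    simp only [Polynomial.finsetSum_coeff, Polynomial.coeff_mul_X_pow', Polynomial.coeff_zero,
      Polynomial.coeff_expand hD] at h1
    rw [Finset.sum_eq_single j₀] at h1
    · simpa [Nat.mul_div_cancel_left _ hD] using h1
    · intro j _ hj
      split_ifs with h2 h3
      · exfalso
        apply hj
        obtain ⟨z, hz⟩ := h3
        have h4 : D * m + j₀ = D * z + j := by omega
        have h5 := congrArg (· % D) h4
        simp only [Nat.mul_add_mod, Nat.mod_eq_of_lt j.2, Nat.mod_eq_of_lt j₀.2] at h5
        exact Fin.ext h5.symm
      · rfl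
      · rfl
    · simp
  have := hp j₀
  rw [hpj, map_zero] at this
  exact Subtype.ext this.symm

end Hahn

section Hahn

open HahnSeries

variable {k F : Type*} [Field k] [Field F] [Algebra k F]

theorem aeval_eq_add {S : Subalgebra k (HahnSeries ℚ F)} (G : Polynomial S) (n D : ℕ)
    (W : HahnSeries ℚ F) :
    ∃ M : ℕ, Polynomial.aeval (single (n : ℚ) 1 * W) G =
      ∑ j : Fin D, ((G.coeff j : HahnSeries ℚ F) * single (n : ℚ) 1 ^ (j : ℕ)) * W ^ (j : ℕ) +
      ∑ j ∈ Finset.range M, (G.coeff (D + j) : HahnSeries ℚ F) *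
        (single (n : ℚ) 1 * W) ^ (D + j) := by
  refine ⟨G.natDegree + 1, ?_⟩
  rw [Polynomial.aeval_eq_sum_range' (n := D + (G.natDegree + 1)) (by omega),
    Finset.sum_range_add, Fin.sum_univ_eq_sum_range
      (fun j => ((G.coeff j : HahnSeries ℚ F) * single (n : ℚ) 1 ^ j) * W ^ j)]
  congr 1
  refine Finset.sum_congr rfl fun j _ => ?_
  rw [mul_pow, mul_assoc]
  rfl

theorem single_natCast_pow_mem {Γ : AddSubgroup ℚ} {E : IntermediateField k F} {n : ℕ}
    (hn : (n : ℚ) ∈ Γ) (j : ℕ) : (single (n : ℚ) (1 : F)) ^ j ∈ suppSubalgebra Γ E :=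
  pow_mem (single_mem_suppSubalgebra hn (one_mem E)) j

theorem aeval_addVal_alternative {Γ : AddSubgroup ℚ} {E : IntermediateField k F} {θ : F} {D : ℕ}
    (hlin : LinearIndependent E (fun j : Fin D => θ ^ (j : ℕ)))
    {S : Subalgebra k (HahnSeries ℚ F)} (hS : S ≤ suppSubalgebra Γ E)
    (hS0 : ∀ s ∈ S, 0 ≤ addVal ℚ F s) {n : ℕ} (hn : (n : ℚ) ∈ Γ)
    {W : HahnSeries ℚ F} (hW : 0 ≤ addVal ℚ F W) (hW0 : W.coeff 0 = θ) (G : Polynomial S) :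
    ((D * n : ℚ) : WithTop ℚ) ≤ addVal ℚ F (Polynomial.aeval (single (n : ℚ) 1 * W) G) ∨
      ∃ q ∈ Γ, addVal ℚ F (Polynomial.aeval (single (n : ℚ) 1 * W) G) = (q : WithTop ℚ) := by
  obtain ⟨M, hM⟩ := aeval_eq_add G n D W
  rw [hM]
  have h2 : ((D * n : ℚ) : WithTop ℚ) ≤
      addVal ℚ F (∑ j ∈ Finset.range M, (G.coeff (D + j) : HahnSeries ℚ F) *
        (single (n : ℚ) 1 * W) ^ (D + j)) := by
    refine AddValuation.map_le_sum _ fun j _ => ?_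
    rw [_root_.pow_add, mul_pow, single_pow, one_pow, nsmul_eq_mul]
    rw [AddValuation.map_mul, AddValuation.map_mul, AddValuation.map_mul,
      addVal_single one_ne_zero, AddValuation.map_pow, AddValuation.map_pow]
    refine le_add_of_nonneg_of_le (hS0 _ (G.coeff _).2) ?_
    rw [add_assoc]
    refine le_add_of_nonneg_right (add_nonneg (nsmul_nonneg hW _) (nsmul_nonneg ?_ _))
    rw [AddValuation.map_mul]
    exact add_nonneg (addVal_single_nonneg n.cast_nonneg _) hW
  by_cases hne : ∃ j : Fin D, (G.coeff j : HahnSeries ℚ F) * single (n : ℚ) 1 ^ (j : ℕ) ≠ 0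
  · obtain ⟨q, hq, hqv⟩ := exists_addVal_sum_eq hlin hW hW0 _
      (fun j : Fin D => mul_mem (hS (G.coeff j).2) (single_natCast_pow_mem hn j)) hne
    rcases lt_or_ge q (D * n : ℚ) with hlt | hge
    · refine Or.inr ⟨q, hq, ?_⟩
      rw [AddValuation.map_add_eq_of_lt_left _
        (lt_of_lt_of_le (hqv ▸ WithTop.coe_lt_coe.2 hlt) h2), hqv]
    · exact Or.inl (AddValuation.map_le_add _ (hqv ▸ WithTop.coe_le_coe.2 hge) h2)
  · push Not at hne
    left
    rw [Finset.sum_eq_zero fun j _ => by rw [hne j, zero_mul], zero_add]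
    exact h2

theorem aeval_ne_zero_of_natDegree_lt {Γ : AddSubgroup ℚ} {E : IntermediateField k F} {θ : F}
    {D : ℕ} (hlin : LinearIndependent E (fun j : Fin D => θ ^ (j : ℕ)))
    {S : Subalgebra k (HahnSeries ℚ F)} (hS : S ≤ suppSubalgebra Γ E)
    {n : ℕ} (hn : (n : ℚ) ∈ Γ)
    {W : HahnSeries ℚ F} (hW : 0 ≤ addVal ℚ F W) (hW0 : W.coeff 0 = θ) {G : Polynomial S}
    (hG : G ≠ 0) (hdeg : G.natDegree < D) :
    Polynomial.aeval (single (n : ℚ) 1 * W) G ≠ 0 := by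
  obtain ⟨M, hM⟩ := aeval_eq_add G n D W
  rw [hM, Finset.sum_eq_zero (s := Finset.range M) fun j _ => by
    rw [Polynomial.coeff_eq_zero_of_natDegree_lt (by omega), ZeroMemClass.coe_zero, zero_mul],
    add_zero]
  have hlead : (G.coeff G.natDegree : HahnSeries ℚ F) ≠ 0 := by
    rw [Ne, ZeroMemClass.coe_eq_zero]
    exact Polynomial.leadingCoeff_ne_zero.2 hG
  obtain ⟨q, hq, hqv⟩ := exists_addVal_sum_eq hlin hW hW0 _
      (fun j : Fin D => mul_mem (hS (G.coeff j).2) (single_natCast_pow_mem hn j))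
      ⟨⟨_, hdeg⟩, mul_ne_zero hlead (pow_ne_zero _ (by simp))⟩
  intro h
  rw [h, AddValuation.map_zero] at hqv
  exact WithTop.coe_ne_top hqv.symm

theorem isSeparable_single {r i : ℕ} (hr : (r : k) ≠ 0) {α : ℚ} (hα : α ∈ fracGroup r i) :
    IsSeparable (IntermediateField.adjoin k {(single (1 : ℚ) 1 : HahnSeries ℚ F)})
      (single α 1 : HahnSeries ℚ F) := by
  set K₀ := IntermediateField.adjoin k {(single (1 : ℚ) 1 : HahnSeries ℚ F)}
  have hr0 : r ≠ 0 := by rintro rfl; simp at hr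
  obtain ⟨z, hz⟩ := mem_fracGroup.1 hα
  have ht : (single (1 : ℚ) 1 : HahnSeries ℚ F) ^ z = single (z : ℚ) 1 := by
    obtain ⟨n, rfl | rfl⟩ := z.eq_nat_or_neg
    · simp [single_pow]
    · simp [single_pow, inv_single]
  let a : K₀ := ⟨single (z : ℚ) 1, ht ▸ zpow_mem (IntermediateField.mem_adjoin_simple_self k _) z⟩
  have ha : a ≠ 0 := fun h => by
    have := congrArg Subtype.val h
    simp [a] at this
  have hr' : ((r ^ i : ℕ) : K₀) ≠ 0 := by
    rw [Nat.cast_pow]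
    refine pow_ne_zero _ fun h => hr ?_
    rw [← map_natCast (algebraMap k K₀)] at h
    exact (map_eq_zero _).1 h
  refine Polynomial.Separable.of_dvd (Polynomial.separable_X_pow_sub_C a hr' ha)
    (minpoly.dvd _ _ ?_)
  rw [map_sub, map_pow, Polynomial.aeval_X, Polynomial.aeval_C, sub_eq_zero]
  change _ = single (z : ℚ) 1
  rw [single_pow, one_pow, nsmul_eq_mul, hz]
  push_cast
  rw [mul_comm]

open scoped IntermediateField.algebraAdjoinAdjoin in
theorem exists_simple_root {r i : ℕ} (hr : (r : k) ≠ 0) (s : Finset ℕ) (α : ℕ → ℚ)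
    (hα : ∀ j ∈ s, α j ∈ fracGroup r i) :
    ∃ h : Polynomial (Algebra.adjoin k {(single (1 : ℚ) 1 : HahnSeries ℚ F)}),
      Polynomial.aeval (∑ j ∈ s, single (α j) 1 : HahnSeries ℚ F) h = 0 ∧
      Polynomial.aeval (∑ j ∈ s, single (α j) 1 : HahnSeries ℚ F) h.derivative ≠ 0 := by
  set u : HahnSeries ℚ F := ∑ j ∈ s, single (α j) 1
  set K₀ := IntermediateField.adjoin k {(single (1 : ℚ) 1 : HahnSeries ℚ F)}
  have hu : (minpoly K₀ u).Separable := by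
    change IsSeparable K₀ u
    rw [← mem_separableClosure_iff]
    exact sum_mem fun j hj => mem_separableClosure_iff.2 (isSeparable_single hr (hα j hj))
  obtain ⟨h, b, hbM, hb⟩ : ∃ h :
      Polynomial (Algebra.adjoin k {(single (1 : ℚ) 1 : HahnSeries ℚ F)}),
      ∃ b ∈ nonZeroDivisors (Algebra.adjoin k {(single (1 : ℚ) 1 : HahnSeries ℚ F)}),
      h.map (algebraMap _ K₀) = b • minpoly K₀ u :=
    ⟨_, IsLocalization.integerNormalization_spec _ _⟩
  have hb0 : (b : HahnSeries ℚ F) ≠ 0 := by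
    rw [Ne, ZeroMemClass.coe_eq_zero]
    exact nonZeroDivisors.ne_zero hbM
  have key : ∀ p : Polynomial (Algebra.adjoin k {(single (1 : ℚ) 1 : HahnSeries ℚ F)}),
      ∀ p' : Polynomial K₀, p.map (algebraMap _ K₀) = b • p' →
      Polynomial.aeval u p = b * Polynomial.aeval u p' := fun p p' hp => by
    rw [← Polynomial.aeval_map_algebraMap K₀, hp, ← algebraMap_smul K₀ b p', map_smul]
    rfl
  refine ⟨h, ?_, ?_⟩
  · rw [key _ _ hb, minpoly.aeval, mul_zero]
  · rw [key h.derivative (minpoly K₀ u).derivative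
      (by rw [← Polynomial.derivative_map, hb, Polynomial.derivative_smul])]
    exact mul_ne_zero hb0 (Polynomial.Separable.aeval_derivative_ne_zero hu (minpoly.aeval _ _))

end Hahn

section Hahn

open HahnSeries

variable {F : Type*} [Field F]

theorem addVal_C_nonneg (a : F) : 0 ≤ addVal ℚ F (C a : HahnSeries ℚ F) :=
  addVal_single_nonneg le_rfl a

theorem addVal_C {a : F} (ha : a ≠ 0) : addVal ℚ F (C a : HahnSeries ℚ F) = 0 :=
  addVal_single ha

/-- The series of nonnegative order which are limits of elements of a subfield. -/
def limitSubring (L : Subfield (HahnSeries ℚ F)) : Subring (HahnSeries ℚ F) where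
  carrier := {f | 0 ≤ addVal ℚ F f ∧
    ∀ N : ℕ, ∃ a ∈ L, 0 ≤ addVal ℚ F a ∧ ((N : ℚ) : WithTop ℚ) ≤ addVal ℚ F (a - f)}
  one_mem' := ⟨mem_nonnegSubring.1 (one_mem _), fun N => ⟨1, one_mem L,
    mem_nonnegSubring.1 (one_mem _), by rw [sub_self, AddValuation.map_zero]; exact le_top⟩⟩
  zero_mem' := ⟨mem_nonnegSubring.1 (zero_mem _), fun N => ⟨0, zero_mem L,
    mem_nonnegSubring.1 (zero_mem _), by rw [sub_self, AddValuation.map_zero]; exact le_top⟩⟩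
  mul_mem' {f g} hf hg := by
    refine ⟨mem_nonnegSubring.1 (mul_mem hf.1 hg.1), fun N => ?_⟩
    obtain ⟨a, haL, ha0, ha⟩ := hf.2 N
    obtain ⟨b, hbL, hb0, hb⟩ := hg.2 N
    refine ⟨a * b, mul_mem haL hbL, mem_nonnegSubring.1 (mul_mem ha0 hb0), ?_⟩
    rw [show a * b - f * g = a * (b - g) + (a - f) * g by ring]
    refine AddValuation.map_le_add _ ?_ ?_ <;> rw [AddValuation.map_mul]
    · exact le_add_of_nonneg_of_le ha0 hb
    · exact le_add_of_le_of_nonneg ha hg.1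
  add_mem' {f g} hf hg := by
    refine ⟨mem_nonnegSubring.1 (add_mem hf.1 hg.1), fun N => ?_⟩
    obtain ⟨a, haL, ha0, ha⟩ := hf.2 N
    obtain ⟨b, hbL, hb0, hb⟩ := hg.2 N
    refine ⟨a + b, add_mem haL hbL, mem_nonnegSubring.1 (add_mem ha0 hb0), ?_⟩
    rw [show a + b - (f + g) = (a - f) + (b - g) by ring]
    exact AddValuation.map_le_add _ ha hb
  neg_mem' {f} hf := by
    refine ⟨mem_nonnegSubring.1 (neg_mem hf.1), fun N => ?_⟩
    obtain ⟨a, haL, ha0, ha⟩ := hf.2 N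
    refine ⟨-a, neg_mem haL, mem_nonnegSubring.1 (neg_mem ha0), ?_⟩
    rw [show -a - -f = -(a - f) by ring, AddValuation.map_neg]
    exact ha

theorem mem_limitSubring {L : Subfield (HahnSeries ℚ F)} {f : HahnSeries ℚ F} :
    f ∈ limitSubring L ↔ 0 ≤ addVal ℚ F f ∧
      ∀ N : ℕ, ∃ a ∈ L, 0 ≤ addVal ℚ F a ∧ ((N : ℚ) : WithTop ℚ) ≤ addVal ℚ F (a - f) :=
  Iff.rfl

theorem mem_limitSubring_of_mem {L : Subfield (HahnSeries ℚ F)} {f : HahnSeries ℚ F}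
    (hf : f ∈ L) (h0 : 0 ≤ addVal ℚ F f) : f ∈ limitSubring L :=
  ⟨h0, fun N => ⟨f, hf, h0, by rw [sub_self, AddValuation.map_zero]; exact le_top⟩⟩

theorem coeff_zero_eq_of_addVal_sub_pos {a : HahnSeries ℚ F} {φ : F}
    (h : 0 < addVal ℚ F (a - C φ)) : a.coeff 0 = φ := by
  have := (lt_addVal_iff (γ := 0)).1 h 0 le_rfl
  rw [coeff_sub, C_apply, coeff_single_same] at this
  exact sub_eq_zero.1 this

theorem addVal_eq_zero_of_addVal_sub_pos {a : HahnSeries ℚ F} {φ : F} (hφ : φ ≠ 0)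
    (h : 0 < addVal ℚ F (a - C φ)) : addVal ℚ F a = 0 := by
  rw [← add_sub_cancel (C φ) a, AddValuation.map_add_eq_of_lt_left _ ((addVal_C hφ).trans_lt h),
    addVal_C hφ]

/-- The residues of the elements of a subfield. -/
def residueSubfield (L : Subfield (HahnSeries ℚ F)) : Subfield F where
  carrier := {φ | ∃ a ∈ L, 0 < addVal ℚ F (a - C φ)}
  one_mem' := ⟨1, one_mem L, by simp⟩
  zero_mem' := ⟨0, zero_mem L, by simp⟩
  mul_mem' {f g} hf hg := by
    obtain ⟨a, haL, ha⟩ := hf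
    obtain ⟨b, hbL, hb⟩ := hg
    refine ⟨a * b, mul_mem haL hbL, ?_⟩
    rw [map_mul, show a * b - C f * C g = (a - C f) * (b - C g) + C f * (b - C g) +
      (a - C f) * C g by ring]
    refine AddValuation.map_lt_add _ (AddValuation.map_lt_add _ ?_ ?_) ?_ <;>
      rw [AddValuation.map_mul]
    · exact ha.trans_le (le_add_of_nonneg_right hb.le)
    · exact hb.trans_le (le_add_of_nonneg_left (addVal_C_nonneg _))
    · exact ha.trans_le (le_add_of_nonneg_right (addVal_C_nonneg _))
  add_mem' {f g} hf hg := by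
    obtain ⟨a, haL, ha⟩ := hf
    obtain ⟨b, hbL, hb⟩ := hg
    refine ⟨a + b, add_mem haL hbL, ?_⟩
    rw [map_add, show a + b - (C f + C g) = (a - C f) + (b - C g) by ring]
    exact AddValuation.map_lt_add _ ha hb
  neg_mem' {f} hf := by
    obtain ⟨a, haL, ha⟩ := hf
    refine ⟨-a, neg_mem haL, ?_⟩
    rw [map_neg, show -a - -C f = -(a - C f) by ring, AddValuation.map_neg]
    exact ha
  inv_mem' f hf := by
    obtain ⟨a, haL, ha⟩ := hf
    by_cases hf0 : f = 0
    · exact ⟨0, zero_mem L, by simp [hf0]⟩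
    have ha0 : addVal ℚ F a = 0 := addVal_eq_zero_of_addVal_sub_pos hf0 ha
    have hane : a ≠ 0 := by rintro rfl; simp at ha0
    have hC : (C f : HahnSeries ℚ F) ≠ 0 := by simpa using hf0
    refine ⟨a⁻¹, inv_mem haL, ?_⟩
    have h1 : a * C f * (a⁻¹ - C f⁻¹) = -(a - C f) := by
      rw [map_inv₀]
      field_simp
      ring
    have h2 := congrArg (addVal ℚ F) h1
    rw [AddValuation.map_mul, AddValuation.map_mul, ha0, addVal_C hf0, zero_add, zero_add,
      AddValuation.map_neg] at h2
    rw [h2]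
    exact ha

theorem mem_residueSubfield {L : Subfield (HahnSeries ℚ F)} {φ : F} :
    φ ∈ residueSubfield L ↔ ∃ a ∈ L, 0 < addVal ℚ F (a - C φ) :=
  Iff.rfl

/-- One step of Newton's method for `q`-th roots. -/
theorem exists_addVal_sub_ge_two_mul {L : Subfield (HahnSeries ℚ F)} {q : ℕ} (hq : (q : F) ≠ 0)
    {φ s : F} (hφ : φ ≠ 0) (hs : φ ^ q = s) (hsL : C s ∈ L) {a : HahnSeries ℚ F} (ha : a ∈ L)
    (ha0 : 0 < addVal ℚ F (a - C φ)) :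
    ∃ a' ∈ L, 2 • addVal ℚ F (a - C φ) ≤ addVal ℚ F (a' - C φ) := by
  have hv : addVal ℚ F a = 0 := addVal_eq_zero_of_addVal_sub_pos hφ ha0
  have hane : a ≠ 0 := by rintro rfl; simp at hv
  have hqC : (q : HahnSeries ℚ F) = C (q : F) := (map_natCast C q).symm
  have hqne : (q : HahnSeries ℚ F) ≠ 0 := by rw [hqC]; exact (map_ne_zero C).2 hq
  have hqv : addVal ℚ F (q : HahnSeries ℚ F) = 0 := by rw [hqC, addVal_C hq]
  obtain ⟨κ, hκ⟩ := Polynomial.binomExpansion (Polynomial.X ^ q : Polynomial (nonnegSubring F))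
    ⟨a, mem_nonnegSubring.2 hv.ge⟩
    ⟨C φ - a, mem_nonnegSubring.2 (by rw [AddValuation.map_sub_swap]; exact ha0.le)⟩
  have h2 := congrArg (nonnegSubring F).subtype hκ
  simp only [Polynomial.eval_pow, Polynomial.eval_X, Polynomial.derivative_X_pow,
    Polynomial.eval_mul, Polynomial.eval_natCast, map_add, map_mul, map_pow, map_natCast,
    Subring.subtype_apply, add_sub_cancel] at h2
  refine ⟨a - (a ^ q - C s) / ((q : HahnSeries ℚ F) * a ^ (q - 1)),
    sub_mem ha (div_mem (sub_mem (pow_mem ha q) hsL)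
    (mul_mem (natCast_mem L q) (pow_mem ha _))), ?_⟩
  have hden : ((q : HahnSeries ℚ F) * a ^ (q - 1) : HahnSeries ℚ F) ≠ 0 :=
    mul_ne_zero hqne (pow_ne_zero _ hane)
  have h3 : ((q : HahnSeries ℚ F) * a ^ (q - 1)) *
      (a - (a ^ q - C s) / ((q : HahnSeries ℚ F) * a ^ (q - 1)) - C φ) =
      (κ : HahnSeries ℚ F) * (a - C φ) ^ 2 := by
    rw [← hs, map_pow, h2]
    field_simp
    ring
  have h4 := congrArg (addVal ℚ F) h3
  rw [AddValuation.map_mul, AddValuation.map_mul, AddValuation.map_mul, AddValuation.map_pow,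
    AddValuation.map_pow, hv, hqv, smul_zero, zero_add, zero_add] at h4
  rw [h4]
  exact le_add_of_nonneg_left (mem_nonnegSubring.1 κ.2)

theorem C_mem_limitSubring_of_pow {L : Subfield (HahnSeries ℚ F)} {q : ℕ} (hq : (q : F) ≠ 0)
    {φ s : F} (hφ : φ ≠ 0) (hs : φ ^ q = s) (hsL : C s ∈ L) (hφL : φ ∈ residueSubfield L) :
    C φ ∈ limitSubring L := by
  obtain ⟨a, haL, ha⟩ := mem_residueSubfield.1 hφL
  refine mem_limitSubring.2 ⟨addVal_C_nonneg _, fun N => ?_⟩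
  suffices h : ∃ b ∈ L, 0 < addVal ℚ F (b - C φ) ∧
      ((N : ℚ) : WithTop ℚ) ≤ addVal ℚ F (b - C φ) by
    obtain ⟨b, hbL, hb0, hb⟩ := h
    exact ⟨b, hbL, (addVal_eq_zero_of_addVal_sub_pos hφ hb0).ge, hb⟩
  by_cases htop : addVal ℚ F (a - C φ) = ⊤
  · exact ⟨a, haL, ha, htop ▸ le_top⟩
  obtain ⟨η, hη⟩ := WithTop.ne_top_iff_exists.1 htop
  have hη0 : 0 < η := by rw [← hη] at ha; exact_mod_cast ha
  have hstep : ∀ M : ℕ, ∃ b ∈ L, (((M + 1 : ℕ) * η : ℚ) : WithTop ℚ) ≤ addVal ℚ F (b - C φ) := by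
    intro M
    induction M with
    | zero => exact ⟨a, haL, by simp [hη]⟩
    | succ M ih =>
      obtain ⟨b, hbL, hb⟩ := ih
      have hb0 : 0 < addVal ℚ F (b - C φ) :=
        lt_of_lt_of_le (by exact_mod_cast mul_pos (by positivity) hη0) hb
      obtain ⟨b', hb'L, hb'⟩ := exists_addVal_sub_ge_two_mul hq hφ hs hsL hbL hb0
      refine ⟨b', hb'L, le_trans ?_ hb'⟩
      rw [two_nsmul]
      refine le_trans ?_ (add_le_add hb hb)
      norm_cast
      push_cast
      nlinarith [mul_nonneg (Nat.cast_nonneg (α := ℚ) M) hη0.le]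
  obtain ⟨M, hM⟩ := exists_nat_gt ((N : ℚ) / η)
  obtain ⟨b, hbL, hb⟩ := hstep M
  refine ⟨b, hbL, lt_of_lt_of_le (by exact_mod_cast mul_pos (by positivity) hη0) hb, le_trans ?_ hb⟩
  rw [div_lt_iff₀ hη0] at hM
  norm_cast
  push_cast
  nlinarith

end Hahn

section Hahn

open HahnSeries

variable {k F : Type*} [Field k] [Field F] [Algebra k F]

theorem addVal_nonneg_of_mem_adjoin {s : HahnSeries ℚ F}
    (hs : s ∈ Algebra.adjoin k {(single (1 : ℚ) 1 : HahnSeries ℚ F)}) : 0 ≤ addVal ℚ F s := by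
  induction hs using Algebra.adjoin_induction with
  | mem x hx => rw [Set.mem_singleton_iff.1 hx]; exact addVal_single_nonneg zero_le_one _
  | algebraMap c => exact addVal_C_nonneg _
  | add x y _ _ hx hy => exact AddValuation.map_le_add _ hx hy
  | mul x y _ _ hx hy => rw [AddValuation.map_mul]; exact add_nonneg hx hy

theorem adjoin_le_suppSubalgebra {Γ : AddSubgroup ℚ} (hΓ : 1 ∈ Γ) (E : IntermediateField k F) :
    Algebra.adjoin k {(single (1 : ℚ) 1 : HahnSeries ℚ F)} ≤ suppSubalgebra Γ E :=
  Algebra.adjoin_le (Set.singleton_subset_iff.2 (single_mem_suppSubalgebra hΓ (one_mem E)))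

theorem coeff_add_mul {a b : HahnSeries ℚ F} {c e : ℚ} (ha : (c : WithTop ℚ) ≤ addVal ℚ F a)
    (hb : (e : WithTop ℚ) ≤ addVal ℚ F b) :
    (a * b).coeff (c + e) = a.coeff c * b.coeff e := by
  have h1 : ((c + e : ℚ) : WithTop ℚ) ≤ addVal ℚ F (a * single e 1) := by
    rw [AddValuation.map_mul, addVal_single one_ne_zero]
    exact add_le_add_left ha _
  have h2 : 0 ≤ addVal ℚ F (single (-e) 1 * b) := by
    refine (le_addVal_iff (γ := 0)).2 fun q hq => ?_
    rw [coeff_single_mul, one_mul, sub_neg_eq_add]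
    exact le_addVal_iff.1 hb _ (by linarith)
  have h3 : a * b = (a * single e 1) * (single (-e) 1 * b) := by
    rw [mul_assoc, ← mul_assoc (single e 1), single_mul_single, add_neg_cancel, mul_one,
      single_zero_one, one_mul]
  rw [h3, coeff_mul_of_le h1 h2, coeff_single_mul, coeff_mul_single]
  simp

/-- The leading term of a polynomial near a simple root. -/
theorem aeval_near_root {R : Type*} [CommRing R] [Algebra R (HahnSeries ℚ F)]
    (hR : ∀ c : R, 0 ≤ addVal ℚ F (algebraMap R _ c)) (p : Polynomial R) {u y : HahnSeries ℚ F}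
    (hu : 0 ≤ addVal ℚ F u) (hp : Polynomial.aeval u p = 0) {c e : ℚ}
    (hc : addVal ℚ F (Polynomial.aeval u p.derivative) = (c : WithTop ℚ)) (hce : c < e) {μ : F}
    (hμ : μ ≠ 0) (hy : (e : WithTop ℚ) < addVal ℚ F (y - (u + single e μ))) :
    addVal ℚ F (Polynomial.aeval y p) = ((c + e : ℚ) : WithTop ℚ) ∧
      (Polynomial.aeval y p).coeff (c + e) =
        (Polynomial.aeval u p.derivative).coeff c * μ := by
  have hε : (e : WithTop ℚ) ≤ addVal ℚ F (y - u) := by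
    rw [show y - u = (y - (u + single e μ)) + single e μ by ring]
    exact AddValuation.map_le_add _ hy.le (addVal_single hμ).ge
  have hεc : (y - u).coeff e = μ := by
    rw [show y - u = (y - (u + single e μ)) + single e μ by ring, coeff_add,
      lt_addVal_iff.1 hy e le_rfl, zero_add, coeff_single_same]
  have h1 := lt_addVal_aeval_sub hR p hu hp hc hε hce
  rw [add_sub_cancel] at h1
  have h2 : (Polynomial.aeval y p).coeff (c + e) =
        (Polynomial.aeval u p.derivative).coeff c * μ := by
    rw [← hεc, ← coeff_add_mul hc.ge hε]
    have := lt_addVal_iff.1 h1 _ le_rfl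
    rwa [coeff_sub, sub_eq_zero] at this
  refine ⟨addVal_eq_of_coeff_ne_zero ?_ (h2 ▸ mul_ne_zero (coeff_ne_zero_of_addVal_eq hc) hμ), h2⟩
  rw [← sub_add_cancel (Polynomial.aeval y p) (Polynomial.aeval u p.derivative * (y - u))]
  refine AddValuation.map_le_add _ h1.le ?_
  rw [AddValuation.map_mul, hc]
  exact add_le_add_right hε _

theorem aeval_mem_subring {A B : Type*} [CommRing A] [CommRing B] [Algebra A B] (S : Subring B)
    (hA : ∀ a : A, algebraMap A B a ∈ S) {b : B} (hb : b ∈ S) (p : Polynomial A) :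
    Polynomial.aeval b p ∈ S := by
  rw [Polynomial.aeval_eq_sum_range]
  refine sum_mem fun i _ => ?_
  rw [Algebra.smul_def]
  exact mul_mem (hA _) (pow_mem hb _)

theorem addVal_sub_C_coeff_zero_pos {Z : HahnSeries ℚ F} (hZ : 0 ≤ addVal ℚ F Z) :
    0 < addVal ℚ F (Z - C (Z.coeff 0)) := by
  refine (lt_addVal_iff (γ := 0)).2 fun q hq => ?_
  rcases hq.lt_or_eq with hq | rfl
  · rw [coeff_sub, (le_addVal_iff (γ := 0)).1 hZ q hq, C_apply, coeff_single_of_ne hq.ne, sub_zero]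
  · simp

theorem pow_mem_residueSubfield {L : Subfield (HahnSeries ℚ F)}
    (htL : (single (1 : ℚ) 1 : HahnSeries ℚ F) ∈ L) {z : HahnSeries ℚ F} (hz : z ∈ limitSubring L)
    {γ : ℚ} (hγ : addVal ℚ F z = (γ : WithTop ℚ)) {m M : ℕ} (hM : m * γ = M) :
    z.coeff γ ^ m ∈ residueSubfield L := by
  set Z : HahnSeries ℚ F := single (-γ) 1 * z
  have hZ0 : Z.coeff 0 = z.coeff γ := by simp [Z, coeff_single_mul]
  have hZ : 0 ≤ addVal ℚ F Z := by
    rw [AddValuation.map_mul, hγ, addVal_single one_ne_zero]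
    norm_cast
    simp
  have hzZ : single (M : ℚ) 1 * Z ^ m = z ^ m := by
    rw [mul_pow, single_pow, one_pow, ← mul_assoc, single_mul_single, nsmul_eq_mul, mul_neg, hM,
      add_neg_cancel, mul_one, single_zero_one, one_mul]
  obtain ⟨a, haL, -, ha⟩ := (mem_limitSubring.1 (pow_mem hz m)).2 (M + 1)
  have hs : (single (-M : ℚ) 1 : HahnSeries ℚ F) ∈ L := by
    have : (single (-M : ℚ) 1 : HahnSeries ℚ F) = (single (1 : ℚ) 1 ^ M)⁻¹ := by
      rw [single_pow, inv_single]
      simp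
    rw [this]
    exact inv_mem (pow_mem htL M)
  refine mem_residueSubfield.2 ⟨single (-M : ℚ) 1 * a, mul_mem hs haL, ?_⟩
  have hsplit : single (-M : ℚ) 1 * a - C (z.coeff γ ^ m) =
      single (-M : ℚ) 1 * (a - z ^ m) + (Z ^ m - C ((Z ^ m).coeff 0)) := by
    rw [coeff_zero_pow hZ, hZ0, ← hzZ, mul_sub, ← mul_assoc, single_mul_single, neg_add_cancel,
      mul_one, single_zero_one, one_mul]
    ring
  rw [hsplit]
  refine AddValuation.map_lt_add _ ?_ (addVal_sub_C_coeff_zero_pos ?_)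
  · rw [AddValuation.map_mul, addVal_single one_ne_zero]
    refine lt_of_lt_of_le ?_ (add_le_add_right ha _)
    norm_cast
    push_cast
    linarith
  · rw [AddValuation.map_pow]
    exact nsmul_nonneg hZ m

theorem C_mem_limitSubring_of_near_root {L : Subfield (HahnSeries ℚ F)}
    (hkL : ∀ c : k, (C (algebraMap k F c) : HahnSeries ℚ F) ∈ L)
    (htL : (single (1 : ℚ) 1 : HahnSeries ℚ F) ∈ L) {r i q : ℕ}
    (hcop : (r ^ i).Coprime q) (hq : (q : F) ≠ 0) {θ s : F} (hθ : θ ≠ 0) (hs : θ ^ q = s)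
    (hsL : C s ∈ L) {y u : HahnSeries ℚ F} (hy : y ∈ limitSubring L) (hu : 0 ≤ addVal ℚ F u)
    {h : Polynomial (Algebra.adjoin k {(single (1 : ℚ) 1 : HahnSeries ℚ F)})}
    (hroot : Polynomial.aeval u h = 0) {c : ℚ} (hcr : c ∈ fracGroup r i) (hc0 : 0 ≤ c)
    (hc : addVal ℚ F (Polynomial.aeval u h.derivative) = (c : WithTop ℚ))
    (hck : (Polynomial.aeval u h.derivative).coeff c ∈ (⊥ : IntermediateField k F))
    {n : ℕ} (hcn : c < n)
    (hyn : ((n : ℚ) : WithTop ℚ) < addVal ℚ F (y - (u + single (n : ℚ) θ))) :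
    C θ ∈ limitSubring L := by
  obtain ⟨hz, hzc⟩ := aeval_near_root (fun c => addVal_nonneg_of_mem_adjoin c.2) h hu hroot hc hcn
    hθ hyn
  have hadj : ∀ a : Algebra.adjoin k {(single (1 : ℚ) 1 : HahnSeries ℚ F)},
      (a : HahnSeries ℚ F) ∈ limitSubring L := fun ⟨a, ha⟩ => by
    refine mem_limitSubring_of_mem ?_ (addVal_nonneg_of_mem_adjoin ha)
    change a ∈ L
    induction ha using Algebra.adjoin_induction with
    | mem x hx => rw [Set.mem_singleton_iff.1 hx]; exact htL
    | algebraMap c => exact hkL c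
    | add x y _ _ hx hy => exact add_mem hx hy
    | mul x y _ _ hx hy => exact mul_mem hx hy
  have hzL := aeval_mem_subring (limitSubring L) hadj hy h
  obtain ⟨z, hz'⟩ := mem_fracGroup.1 hcr
  have hz0 : 0 ≤ z := by
    have : (0 : ℚ) ≤ z := by rw [hz']; positivity
    exact_mod_cast this
  lift z to ℕ using hz0
  have hres := pow_mem_residueSubfield htL hzL hz (m := r ^ i) (M := z + r ^ i * n) (by
    push_cast at hz' ⊢
    rw [hz']
    ring)
  rw [hzc, mul_pow] at hres
  obtain ⟨lam, hlam⟩ := IntermediateField.mem_bot.1 hck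
  have hlam0 := coeff_ne_zero_of_addVal_eq hc
  have hlamR : (Polynomial.aeval u h.derivative).coeff c ∈ residueSubfield L := by
    rw [← hlam]
    exact mem_residueSubfield.2 ⟨_, hkL lam, by simp⟩
  have hθm : θ ^ (r ^ i) ∈ residueSubfield L := by
    have := mul_mem (inv_mem (pow_mem hlamR (r ^ i))) hres
    rwa [inv_mul_cancel_left₀ (pow_ne_zero _ hlam0)] at this
  have hθq : θ ^ q ∈ residueSubfield L := hs ▸ mem_residueSubfield.2 ⟨_, hsL, by simp⟩
  obtain ⟨a, b, hab⟩ := Nat.isCoprime_iff_coprime.2 hcop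
  refine C_mem_limitSubring_of_pow hq hθ hs hsL ?_
  have : θ = (θ ^ (r ^ i)) ^ a * (θ ^ q) ^ b := by
    rw [← zpow_natCast, ← zpow_natCast, ← zpow_mul, ← zpow_mul, ← zpow_add₀ hθ, mul_comm _ a,
      mul_comm _ b, hab, zpow_one]
  rw [this]
  exact mul_mem (zpow_mem hθm a) (zpow_mem hθq b)

end Hahn

section Hahn

open HahnSeries

/-- The exponents of the algebraic part of the series. -/
def auxExp (r : ℕ) (n : ℕ → ℕ) (j : ℕ) : ℚ := n j + 1 / (r : ℚ) ^ (j + 1)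

theorem natCast_lt_auxExp {r : ℕ} (hr : 2 ≤ r) (n : ℕ → ℕ) (j : ℕ) : (n j : ℚ) < auxExp r n j := by
  have : (0 : ℚ) < r := by exact_mod_cast (by omega : 0 < r)
  rw [auxExp]
  have : (0 : ℚ) < 1 / (r : ℚ) ^ (j + 1) := by positivity
  linarith

theorem auxExp_lt {r : ℕ} (hr : 2 ≤ r) (n : ℕ → ℕ) (j : ℕ) : auxExp r n j < n j + 1 := by
  have : (1 : ℚ) < r := by exact_mod_cast (by omega : 1 < r)
  rw [auxExp]
  have : 1 / (r : ℚ) ^ (j + 1) < 1 := by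
    rw [div_lt_one (by positivity)]
    exact one_lt_pow₀ this (by omega)
  linarith

theorem auxExp_mem {r : ℕ} (hr : 2 ≤ r) (n : ℕ → ℕ) {j i : ℕ} (hj : j < i) :
    auxExp r n j ∈ fracGroup r i := by
  refine fracGroup_mono r (Nat.succ_le_of_lt hj) (mem_fracGroup.2 ⟨n j * r ^ (j + 1) + 1, ?_⟩)
  have : (r : ℚ) ≠ 0 := by exact_mod_cast (by omega : r ≠ 0)
  rw [auxExp]
  push_cast
  field_simp

theorem auxExp_notMem {r : ℕ} (hr : 2 ≤ r) (n : ℕ → ℕ) (i : ℕ) :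
    auxExp r n i ∉ fracGroup r i := by
  intro h
  obtain ⟨z, hz⟩ := mem_fracGroup.1 h
  have hr0 : (r : ℚ) ≠ 0 := by exact_mod_cast (by omega : r ≠ 0)
  have h1 : ((z - n i * r ^ i : ℤ) : ℚ) * r = 1 := by
    push_cast
    rw [hz, auxExp]
    field_simp
    ring
  have h2 : (z - n i * r ^ i) * (r : ℤ) = 1 := by exact_mod_cast h1
  have h3 := Int.isUnit_iff.1 (IsUnit.of_mul_eq_one_right _ h2)
  omega

/-- The index of the root used at a given stage. -/
abbrev rootIndex (i : ℕ) : ℕ := i ^ 2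

variable (k : Type*) {F : Type*} [Field k] [Field F] [Algebra k F]

/-- A series whose partial sums are tangent to series algebraic over `k(t)`. -/
structure TangentData (ω : ℕ → F) (r : ℕ) where
  n : ℕ → ℕ
  n_pos : ∀ i, 0 < n i
  n_strictMono : StrictMono n
  y : HahnSeries ℚ F
  y_sub : ∀ i, ((n i : ℚ) : WithTop ℚ) ≤ addVal ℚ F (y - ∑ j ∈ Finset.range i,
    (single (n j : ℚ) (ω (rootIndex (j + 1))) + single (auxExp r n j) 1))
  h : ℕ → Polynomial (Algebra.adjoin k {(single (1 : ℚ) 1 : HahnSeries ℚ F)})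
  root : ∀ i, Polynomial.aeval (∑ j ∈ Finset.range i, single (auxExp r n j) 1 : HahnSeries ℚ F)
    (h i) = 0
  c : ℕ → ℚ
  c_eq : ∀ i, addVal ℚ F (Polynomial.aeval (∑ j ∈ Finset.range i, single (auxExp r n j) 1 :
    HahnSeries ℚ F) (h i).derivative) = (c i : WithTop ℚ)
  c_lt : ∀ i, c i < n i

variable {k}

theorem nonempty_tangentData (ω : ℕ → F) {r : ℕ} (hr : 2 ≤ r) (hrk : (r : k) ≠ 0) :
    Nonempty (TangentData k ω r) := by
  classical
  let Q : HahnSeries ℚ F → ℕ → Prop := fun u N =>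
    ∃ (h : Polynomial (Algebra.adjoin k {(single (1 : ℚ) 1 : HahnSeries ℚ F)})) (c : ℚ),
      Polynomial.aeval u h = 0 ∧
      addVal ℚ F (Polynomial.aeval u h.derivative) = (c : WithTop ℚ) ∧ c ≤ N
  have hb : ∀ u, ∃ N, (∃ N', Q u N') → Q u N := fun u => by
    by_cases hu : ∃ N', Q u N'
    · exact ⟨hu.choose, fun _ => hu.choose_spec⟩
    · exact ⟨0, fun hu' => (hu hu').elim⟩
  choose b hb using hb
  obtain ⟨n, hn, hbn⟩ := exists_increasing_seq b
    (fun j N => (single ((N : ℚ) + 1 / (r : ℚ) ^ (j + 1)) 1 : HahnSeries ℚ F))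
  obtain ⟨y, hy⟩ := exists_limit n hn
    (fun j => single (n j : ℚ) (ω (rootIndex (j + 1))) + single (auxExp r n j) 1) (fun j => by
      refine AddValuation.map_le_add _ ?_ ?_
      · rw [le_addVal_iff]
        intro q hq
        exact coeff_single_of_ne hq.ne
      · rw [addVal_single one_ne_zero]
        exact_mod_cast (natCast_lt_auxExp hr n j).le)
  have hQ : ∀ i, Q (∑ j ∈ Finset.range i, single (auxExp r n j) 1)
      (b (∑ j ∈ Finset.range i, single (auxExp r n j) 1)) := fun i => by
    refine hb _ ?_
    obtain ⟨h, h0, h1⟩ := exists_simple_root (F := F) hrk (Finset.range i) (auxExp r n)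
      (fun j hj => auxExp_mem hr n (Finset.mem_range.1 hj))
    have h2 : addVal ℚ F (Polynomial.aeval (∑ j ∈ Finset.range i, single (auxExp r n j) 1 :
        HahnSeries ℚ F) h.derivative) ≠ ⊤ := fun h' => h1 ((AddValuation.top_iff _).1 h')
    obtain ⟨c, hc⟩ := WithTop.ne_top_iff_exists.1 h2
    obtain ⟨N, hN⟩ := exists_nat_ge c
    exact ⟨N, h, c, h0, hc.symm, hN⟩
  choose h c h0 h1 h2 using hQ
  exact ⟨⟨n, fun i => lt_of_le_of_lt (Nat.zero_le _) (hbn i), hn, y, hy, h, h0, c, h1,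
    fun i => (h2 i).trans_lt (Nat.cast_lt.2 (hbn i))⟩⟩

namespace TangentData

variable {ω : ℕ → F} {r : ℕ} (d : TangentData k ω r)

/-- The algebraic part of the partial sums. -/
def u (i : ℕ) : HahnSeries ℚ F := ∑ j ∈ Finset.range i, single (auxExp r d.n j) 1

/-- The transcendental part of the partial sums. -/
def w (i : ℕ) : HahnSeries ℚ F :=
  ∑ j ∈ Finset.range i, single (d.n j : ℚ) (ω (rootIndex (j + 1)))

theorem le_addVal_y_sub (i : ℕ) :
    ((d.n i : ℚ) : WithTop ℚ) ≤ addVal ℚ F (d.y - (d.w i + d.u i)) := by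
  have := d.y_sub i
  rwa [Finset.sum_add_distrib] at this

theorem addVal_u_nonneg (hr : 2 ≤ r) (i : ℕ) : 0 ≤ addVal ℚ F (d.u i) :=
  AddValuation.map_le_sum _ fun j _ =>
    addVal_single_nonneg ((d.n j).cast_nonneg.trans (natCast_lt_auxExp hr d.n j).le) _

theorem u_mem (hr : 2 ≤ r) (i : ℕ) (E : IntermediateField k F) :
    d.u i ∈ suppSubalgebra (fracGroup r i) E :=
  sum_mem fun _ hj =>
    single_mem_suppSubalgebra (auxExp_mem hr d.n (Finset.mem_range.1 hj)) (one_mem E)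

theorem derivative_mem (hr : 2 ≤ r) (i : ℕ) :
    Polynomial.aeval (d.u i) (d.h i).derivative ∈
      suppSubalgebra (fracGroup r i) (⊥ : IntermediateField k F) :=
  aeval_mem_subring (suppSubalgebra (fracGroup r i) (⊥ : IntermediateField k F)).toSubring
    (fun a => adjoin_le_suppSubalgebra (by simpa using intCast_mem_fracGroup r i 1) _ a.2)
    (d.u_mem hr i _) _

theorem coeff_derivative_mem (hr : 2 ≤ r) (i : ℕ) :
    (Polynomial.aeval (d.u i) (d.h i).derivative).coeff (d.c i) ∈ (⊥ : IntermediateField k F) :=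
  (d.derivative_mem hr i _).1

theorem c_mem (hr : 2 ≤ r) (i : ℕ) : d.c i ∈ fracGroup r i :=
  (d.derivative_mem hr i _).2 (coeff_ne_zero_of_addVal_eq (d.c_eq i))

theorem c_nonneg (hr : 2 ≤ r) (i : ℕ) : 0 ≤ d.c i := by
  have := addVal_aeval_nonneg (fun a => addVal_nonneg_of_mem_adjoin a.2) (d.h i).derivative
    (d.addVal_u_nonneg hr i)
  rw [u, d.c_eq] at this
  exact_mod_cast this

theorem lt_addVal_sub_aux (i : ℕ) (hr : 2 ≤ r) : ((auxExp r d.n i : ℚ) : WithTop ℚ) <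
    addVal ℚ F (d.y - d.w (i + 1) - (d.u i + single (auxExp r d.n i) 1)) := by
  have h1 : d.u i + single (auxExp r d.n i) 1 = d.u (i + 1) := (Finset.sum_range_succ _ _).symm
  rw [h1, sub_sub]
  refine lt_of_lt_of_le ?_ (d.le_addVal_y_sub (i + 1))
  have h2 : d.n i + 1 ≤ d.n (i + 1) := d.n_strictMono (Nat.lt_succ_self i)
  have h3 : (d.n i + 1 : ℚ) ≤ d.n (i + 1) := by exact_mod_cast h2
  exact_mod_cast (auxExp_lt hr d.n i).trans_le h3

theorem lt_addVal_sub_root (i : ℕ) (hr : 2 ≤ r) : ((d.n i : ℚ) : WithTop ℚ) <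
    addVal ℚ F (d.y - d.w i - (d.u i + single (d.n i : ℚ) (ω (rootIndex (i + 1))))) := by
  have h1 : d.w (i + 1) = d.w i + single (d.n i : ℚ) (ω (rootIndex (i + 1))) :=
    Finset.sum_range_succ _ _
  have h2 := d.lt_addVal_sub_aux i hr
  rw [show d.y - d.w i - (d.u i + single (d.n i : ℚ) (ω (rootIndex (i + 1)))) =
    (d.y - d.w (i + 1) - (d.u i + single (auxExp r d.n i) 1)) + single (auxExp r d.n i) 1 by
      rw [h1]; ring]
  have h3 : ((d.n i : ℚ) : WithTop ℚ) < (auxExp r d.n i : ℚ) := by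
    exact_mod_cast natCast_lt_auxExp hr d.n i
  refine AddValuation.map_lt_add _ (h3.trans h2) ?_
  rwa [addVal_single one_ne_zero]

theorem addVal_y_pos : 0 < addVal ℚ F d.y := by
  have := d.le_addVal_y_sub 0
  simp only [w, u, Finset.range_zero, Finset.sum_empty, add_zero, sub_zero] at this
  refine lt_of_lt_of_le ?_ this
  exact_mod_cast d.n_pos 0

end TangentData

end Hahn

section Hahn

open HahnSeries

variable {k F : Type*} [Field k] [Field F] [Algebra k F]

theorem addVal_sub_le_eval₂_sub {R : Type*} [CommRing R] {f : R →+* HahnSeries ℚ F}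
    (hf : ∀ c, 0 ≤ addVal ℚ F (f c)) (p : Polynomial R) {a b : HahnSeries ℚ F}
    (ha : 0 ≤ addVal ℚ F a) (hb : 0 ≤ addVal ℚ F b) :
    addVal ℚ F (a - b) ≤ addVal ℚ F (p.eval₂ f a - p.eval₂ f b) := by
  let g : R →+* nonnegSubring F := f.codRestrict (nonnegSubring F)
    fun c => mem_nonnegSubring.2 (hf c)
  have hg : (nonnegSubring F).subtype.comp g = f := rfl
  obtain ⟨z, hz⟩ := Polynomial.sub_dvd_eval_sub (⟨a, mem_nonnegSubring.2 ha⟩ : nonnegSubring F)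
    ⟨b, mem_nonnegSubring.2 hb⟩ (p.map g)
  have h2 := congrArg (nonnegSubring F).subtype hz
  simp only [map_sub, map_mul, Polynomial.eval_map, Polynomial.hom_eval₂, hg,
    Subring.subtype_apply] at h2
  rw [h2, AddValuation.map_mul]
  exact le_add_of_nonneg_right (mem_nonnegSubring.1 z.2)

theorem root_pow {ω : ℕ → F} {l : ℕ} (hω : ∀ e, ω (e + 1) ^ l = ω e) (a b : ℕ) :
    ω (a + b) ^ l ^ b = ω a := by
  induction b with
  | zero => simp
  | succ b ih => rw [pow_succ', pow_mul, ← add_assoc, hω, ih]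

theorem root_pow_sub {ω : ℕ → F} {l : ℕ} (hω : ∀ e, ω (e + 1) ^ l = ω e) {a b : ℕ} (h : a ≤ b) :
    ω b ^ l ^ (b - a) = ω a := by
  have := root_pow hω a (b - a)
  rwa [Nat.add_sub_cancel' h] at this

theorem root_pow_self {ω : ℕ → F} {l : ℕ} (hω : ∀ e, ω (e + 1) ^ l = ω e) (b : ℕ) :
    ω b ^ l ^ b = ω 0 :=
  root_pow_sub hω (Nat.zero_le b)

theorem rootIndex_mono {i j : ℕ} (h : i ≤ j) : rootIndex i ≤ rootIndex j :=
  Nat.pow_le_pow_left h 2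

theorem single_natCast_eq (n : ℕ) (a : F) :
    single (n : ℚ) a = C a * (single (1 : ℚ) 1) ^ n := by
  rw [single_pow, C_apply, single_mul_single]
  simp

theorem natCast_ne_zero_of_algebra {n : ℕ} (h : (n : k) ≠ 0) : (n : F) ≠ 0 := by
  rw [← map_natCast (algebraMap k F)]
  exact (map_ne_zero _).2 h

namespace TangentData

variable {ω : ℕ → F} {r : ℕ} (d : TangentData k ω r)

theorem C_root_mem_limitSubring (hr : 2 ≤ r) {l : ℕ} (hcop : r.Coprime l) (hl : (l : k) ≠ 0)
    (hω : ∀ e, ω (e + 1) ^ l = ω e) (hω0 : ω 0 ≠ 0) {L : Subfield (HahnSeries ℚ F)}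
    (hkL : ∀ c : k, (C (algebraMap k F c) : HahnSeries ℚ F) ∈ L)
    (htL : (single (1 : ℚ) 1 : HahnSeries ℚ F) ∈ L) (hωL : C (ω 0) ∈ L) (hyL : d.y ∈ L) (i : ℕ) :
    C (ω (rootIndex (i + 1))) ∈ limitSubring L := by
  induction i using Nat.strong_induction_on with
  | _ i ih =>
    have hl0 : l ≠ 0 := by rintro rfl; simp at hl
    have ht : (single (1 : ℚ) 1 : HahnSeries ℚ F) ∈ limitSubring L :=
      mem_limitSubring_of_mem htL (addVal_single_nonneg zero_le_one _)
    have hw : d.w i ∈ limitSubring L := sum_mem fun j hj => by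
      rw [single_natCast_eq]
      exact mul_mem (ih j (Finset.mem_range.1 hj)) (pow_mem ht _)
    have hpow : ω (rootIndex (i + 1)) ^ l ^ rootIndex (i + 1) = ω 0 :=
      root_pow_self hω _
    refine C_mem_limitSubring_of_near_root hkL htL (r := r) (i := i)
      (q := l ^ rootIndex (i + 1)) (hcop.pow _ _) ?_ ?_ hpow hωL
      (sub_mem (mem_limitSubring_of_mem hyL d.addVal_y_pos.le) hw) (d.addVal_u_nonneg hr i)
      (d.root i) (d.c_mem hr i) (d.c_nonneg hr i) (d.c_eq i) (d.coeff_derivative_mem hr i)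
      (d.c_lt i) (d.lt_addVal_sub_root i hr)
    · rw [Nat.cast_pow]
      exact pow_ne_zero _ (natCast_ne_zero_of_algebra hl)
    · intro h
      rw [h, zero_pow (pow_ne_zero _ hl0)] at hpow
      exact hω0 hpow.symm

theorem exists_eval₂_root (hr : 2 ≤ r) {l : ℕ} (hω : ∀ e, ω (e + 1) ^ l = ω e)
    {φ : RP k →+* HahnSeries ℚ F} (hφk : ∀ c, φ (MvPolynomial.C c) = C (algebraMap k F c))
    (hφy : φ (MvPolynomial.X 1) = d.y) (hφt : φ (MvPolynomial.X 2) = single 1 1) (i : ℕ) :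
    ∃ g : Polynomial (RP k), addVal ℚ F (g.eval₂ φ (C (ω (rootIndex (i + 1))))) =
      ((d.c i + auxExp r d.n i : ℚ) : WithTop ℚ) := by
  set S : Subring (HahnSeries ℚ F) :=
    (Polynomial.eval₂RingHom φ (C (ω (rootIndex (i + 1))))).range
  have hφS : ∀ p, φ p ∈ S := fun p => ⟨Polynomial.C p, by simp⟩
  have hC : C (ω (rootIndex (i + 1))) ∈ S := ⟨Polynomial.X, by simp⟩
  have hw : d.w (i + 1) ∈ S := sum_mem fun j hj => by
    rw [single_natCast_eq, ← root_pow_sub hω (rootIndex_mono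
      (Nat.succ_le_of_lt (Finset.mem_range.1 hj))), map_pow, ← hφt]
    exact mul_mem (pow_mem hC _) (pow_mem (hφS _) _)
  have hadj : ∀ a : Algebra.adjoin k {(single (1 : ℚ) 1 : HahnSeries ℚ F)},
      (a : HahnSeries ℚ F) ∈ S := fun ⟨a, ha⟩ => by
    change a ∈ S
    induction ha using Algebra.adjoin_induction with
    | mem x hx => rw [Set.mem_singleton_iff.1 hx, ← hφt]; exact hφS _
    | algebraMap c => exact (hφk c) ▸ hφS _
    | add x y _ _ hx hy => exact add_mem hx hy
    | mul x y _ _ hx hy => exact mul_mem hx hy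
  obtain ⟨g, hg⟩ := aeval_mem_subring S hadj (sub_mem (hφy ▸ hφS _) hw) (d.h i)
  refine ⟨g, ?_⟩
  rw [Polynomial.coe_eval₂RingHom] at hg
  rw [hg]
  exact (aeval_near_root (fun c => addVal_nonneg_of_mem_adjoin c.2) (d.h i)
    (d.addVal_u_nonneg hr i) (d.root i) (d.c_eq i) ((d.c_lt i).trans (natCast_lt_auxExp hr d.n i))
    one_ne_zero (d.lt_addVal_sub_aux i hr)).1

theorem exists_approx (hr : 2 ≤ r) {l : ℕ} (hcop : r.Coprime l) (hl : (l : k) ≠ 0)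
    (hω : ∀ e, ω (e + 1) ^ l = ω e) (hω0 : ω 0 ≠ 0)
    {φ : RP k →+* HahnSeries ℚ F} (hφk : ∀ c, φ (MvPolynomial.C c) = C (algebraMap k F c))
    (hφx : φ (1 + MvPolynomial.X 0) = C (ω 0))
    (hφy : φ (MvPolynomial.X 1) = d.y) (hφt : φ (MvPolynomial.X 2) = single 1 1)
    (hφ : ∀ p, 0 ≤ addVal ℚ F (φ p)) {L : Subfield (HahnSeries ℚ F)} (hL : ∀ p, φ p ∈ L) (i : ℕ) :
    ∃ g : Polynomial (RP k), ∃ a ∈ L, 0 < addVal ℚ F (a - C (ω (rootIndex (i + 1)))) ∧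
      ((d.c i + auxExp r d.n i : ℚ) : WithTop ℚ) <
        addVal ℚ F (a ^ l ^ rootIndex (i + 1) - φ (1 + MvPolynomial.X 0)) ∧
      addVal ℚ F (g.eval₂ φ a) = ((d.c i + auxExp r d.n i : ℚ) : WithTop ℚ) := by
  obtain ⟨g, hg⟩ := d.exists_eval₂_root hr hω hφk hφy hφt i
  have hlim := d.C_root_mem_limitSubring hr hcop hl hω hω0 (L := L) (fun c => hφk c ▸ hL _)
    (hφt ▸ hL _) (hφx ▸ hL _) (hφy ▸ hL _) i
  obtain ⟨N, hN⟩ := exists_nat_gt (max 0 (d.c i + auxExp r d.n i))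
  obtain ⟨a, haL, ha0, ha⟩ := (mem_limitSubring.1 hlim).2 N
  have hN0 : (0 : WithTop ℚ) < ((N : ℚ) : WithTop ℚ) := by
    exact_mod_cast (le_max_left _ _).trans_lt hN
  have hNβ : ((d.c i + auxExp r d.n i : ℚ) : WithTop ℚ) < ((N : ℚ) : WithTop ℚ) :=
    WithTop.coe_lt_coe.2 ((le_max_right _ _).trans_lt hN)
  refine ⟨g, a, haL, hN0.trans_le ha, ?_, ?_⟩
  · have := addVal_sub_le_eval₂_sub hφ (Polynomial.X ^ l ^ rootIndex (i + 1)) ha0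
      (addVal_C_nonneg (ω (rootIndex (i + 1))))
    simp only [Polynomial.eval₂_pow, Polynomial.eval₂_X] at this
    rw [← map_pow C, root_pow_self hω] at this
    rw [hφx]
    exact (hNβ.trans_le ha).trans_le this
  · rw [← hg]
    refine AddValuation.map_eq_of_lt_sub _ ?_
    rw [hg]
    exact (hNβ.trans_le ha).trans_le (addVal_sub_le_eval₂_sub hφ g ha0 (addVal_C_nonneg _))

end TangentData

end Hahn

section Hahn

open HahnSeries

variable {k F : Type*} [Field k] [Field F] [Algebra k F]

/-- The elements of nonnegative order with given support and given coefficient field. -/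
def suppNonnegSubalgebra (Γ : AddSubgroup ℚ) (E : IntermediateField k F) :
    Subalgebra k (HahnSeries ℚ F) :=
  suppSubalgebra Γ E ⊓
    { nonnegSubring F with algebraMap_mem' := fun _ => mem_nonnegSubring.2 (addVal_C_nonneg _) }

theorem mem_suppNonnegSubalgebra {Γ : AddSubgroup ℚ} {E : IntermediateField k F}
    {f : HahnSeries ℚ F} :
    f ∈ suppNonnegSubalgebra Γ E ↔ f ∈ suppSubalgebra Γ E ∧ 0 ≤ addVal ℚ F f :=
  Iff.rfl

theorem single_mem_suppNonnegSubalgebra {Γ : AddSubgroup ℚ} {E : IntermediateField k F} {q : ℚ}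
    (hq : q ∈ Γ) (hq0 : 0 ≤ q) {a : F} (ha : a ∈ E) : single q a ∈ suppNonnegSubalgebra Γ E :=
  mem_suppNonnegSubalgebra.2
    ⟨single_mem_suppSubalgebra hq ha, addVal_single_nonneg hq0 a⟩

theorem C_mem_suppNonnegSubalgebra {Γ : AddSubgroup ℚ} {E : IntermediateField k F}
    {a : F} (ha : a ∈ E) : C a ∈ suppNonnegSubalgebra Γ E :=
  single_mem_suppNonnegSubalgebra (zero_mem Γ) le_rfl ha

theorem aeval_single_coeff {A : Subalgebra k (HahnSeries ℚ F)} (hA : ∀ f ∈ A, ∃ a, f = C a)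
    (p : Polynomial A) (n : ℕ) :
    C ((Polynomial.aeval (single (1 : ℚ) (1 : F)) p).coeff n) = (p.coeff n : HahnSeries ℚ F) := by
  induction p using Polynomial.induction_on' with
  | add p q hp hq => rw [map_add, coeff_add, map_add, hp, hq, Polynomial.coeff_add]; rfl
  | monomial m c =>
    obtain ⟨a, ha⟩ := hA c c.2
    rw [Polynomial.aeval_monomial, Polynomial.coeff_monomial]
    change C ((↑c * _ : HahnSeries ℚ F).coeff _) = _
    rw [ha, ← single_natCast_eq]
    by_cases h : m = n
    · subst h
      simp [ha]
    · rw [if_neg h, coeff_single_of_ne (by exact_mod_cast Ne.symm h)]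
      simp

theorem algebraicIndependent_C_single {x : F} (hx : Transcendental k x) :
    AlgebraicIndependent k
      (fun o : Option Unit => o.elim (single (1 : ℚ) (1 : F)) fun _ => C x) := by
  have hCx : Transcendental k (C x : HahnSeries ℚ F) := by
    rw [transcendental_iff] at hx ⊢
    intro p hp
    refine hx p (C_injective (Γ := ℚ) ?_)
    rw [map_zero, ← hp, Polynomial.aeval_def, Polynomial.aeval_def, Polynomial.hom_eval₂]
    rfl
  rw [AlgebraicIndependent.option_iff_transcendental
    (x := fun _ : Unit => (C x : HahnSeries ℚ F))
    ((algebraicIndependent_unique_type_iff).2 hCx), transcendental_iff]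
  have hA : ∀ f ∈ Algebra.adjoin k (Set.range fun _ : Unit => (C x : HahnSeries ℚ F)),
      ∃ a, f = C a := fun f hf => by
    induction hf using Algebra.adjoin_induction with
    | mem f hf => obtain ⟨-, rfl⟩ := hf; exact ⟨x, rfl⟩
    | algebraMap c => exact ⟨algebraMap k F c, rfl⟩
    | add f g _ _ hf hg =>
      obtain ⟨a, rfl⟩ := hf
      obtain ⟨b, rfl⟩ := hg
      exact ⟨a + b, (map_add C a b).symm⟩
    | mul f g _ _ hf hg =>
      obtain ⟨a, rfl⟩ := hf
      obtain ⟨b, rfl⟩ := hg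
      exact ⟨a * b, (map_mul C a b).symm⟩
  intro p hp
  ext n
  rw [← aeval_single_coeff hA, hp]
  simp

namespace TangentData

variable {ω : ℕ → F} {r l : ℕ} (d : TangentData k ω r)

/-- The coefficient ring of the partial sums of index less than `i`. -/
abbrev base (_ : TangentData k ω r) (i : ℕ) : Subalgebra k (HahnSeries ℚ F) :=
  suppNonnegSubalgebra (fracGroup r i) (IntermediateField.adjoin k {ω (rootIndex i)})

theorem root_mem_adjoin (hω : ∀ e, ω (e + 1) ^ l = ω e) {i j : ℕ} (h : i ≤ j) :
    ω i ∈ IntermediateField.adjoin k {ω j} := by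
  rw [← root_pow_sub hω h]
  exact pow_mem (IntermediateField.mem_adjoin_simple_self k _) _

theorem w_mem_base (hω : ∀ e, ω (e + 1) ^ l = ω e) (i : ℕ) : d.w i ∈ d.base i :=
  sum_mem fun j hj => single_mem_suppNonnegSubalgebra
    (by simpa using intCast_mem_fracGroup r i (d.n j)) (Nat.cast_nonneg _)
    (root_mem_adjoin hω (rootIndex_mono (Nat.succ_le_of_lt (Finset.mem_range.1 hj))))

theorem u_mem_base (hr : 2 ≤ r) (i : ℕ) : d.u i ∈ d.base i :=
  mem_suppNonnegSubalgebra.2 ⟨d.u_mem hr i _, d.addVal_u_nonneg hr i⟩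

/-- The degree of an extension of coefficient fields. -/
abbrev stepDegree (l i : ℕ) : ℕ := l ^ (rootIndex (i + 1) - rootIndex i)

theorem linearIndependent_root (hω : ∀ e, ω (e + 1) ^ l = ω e) (hl : 0 < l)
    (hω0 : Transcendental k (ω 0)) (i : ℕ) :
    LinearIndependent (IntermediateField.adjoin k {ω (rootIndex i)})
      (fun j : Fin (stepDegree l i) => ω (rootIndex (i + 1)) ^ (j : ℕ)) := by
  have h1 : Transcendental k (ω (rootIndex (i + 1))) := fun h => hω0 <| by
    rw [← root_pow_self hω (rootIndex (i + 1))]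
    exact h.pow _
  have h2 := linearIndependent_pow_of_transcendental h1 (D := stepDegree l i) (pow_pos hl _)
  rwa [root_pow_sub hω (rootIndex_mono i.le_succ)] at h2

theorem exists_eq_mul (hr : 2 ≤ r) (i : ℕ) :
    ∃ W : HahnSeries ℚ F, d.y = single (d.n i : ℚ) 1 * W + (d.w i + d.u i) ∧
      0 ≤ addVal ℚ F W ∧ W.coeff 0 = ω (rootIndex (i + 1)) := by
  set s : HahnSeries ℚ F := single (d.n i : ℚ) 1
  have hs : s * single (-(d.n i : ℚ)) 1 = 1 := by
    rw [single_mul_single]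
    simp
  refine ⟨single (-(d.n i : ℚ)) 1 * (d.y - (d.w i + d.u i)), ?_, ?_⟩
  · rw [← mul_assoc, hs]
    ring
  have h1 : 0 < addVal ℚ F (single (-(d.n i : ℚ)) 1 * (d.y - (d.w i + d.u i)) -
      C (ω (rootIndex (i + 1)))) := by
    have h2 := d.lt_addVal_sub_root i hr
    have h3 : d.y - d.w i - (d.u i + single (d.n i : ℚ) (ω (rootIndex (i + 1)))) =
        s * (single (-(d.n i : ℚ)) 1 * (d.y - (d.w i + d.u i)) -
          C (ω (rootIndex (i + 1)))) := by
      rw [mul_sub, ← mul_assoc, hs, C_apply, single_mul_single, add_zero, one_mul, one_mul]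
      ring
    rw [h3, AddValuation.map_mul, addVal_single one_ne_zero] at h2
    generalize addVal ℚ F (single (-(d.n i : ℚ)) 1 * (d.y - (d.w i + d.u i)) -
          C (ω (rootIndex (i + 1)))) = z at h2 ⊢
    induction z using WithTop.recTopCoe with
    | top => exact WithTop.coe_lt_top 0
    | coe z =>
      have : (d.n i : ℚ) < d.n i + z := by exact_mod_cast h2
      exact_mod_cast (by linarith : (0 : ℚ) < z)
  refine ⟨?_, coeff_zero_eq_of_addVal_sub_pos h1⟩
  have := AddValuation.map_add (addVal ℚ F) (single (-(d.n i : ℚ)) 1 * (d.y - (d.w i + d.u i)) -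
      C (ω (rootIndex (i + 1)))) (C (ω (rootIndex (i + 1))))
  rw [sub_add_cancel] at this
  exact (le_min h1.le (addVal_C_nonneg _)).trans this

theorem exists_aeval_eq (hr : 2 ≤ r) (hω : ∀ e, ω (e + 1) ^ l = ω e) (i : ℕ)
    {W : HahnSeries ℚ F} (hW : d.y = single (d.n i : ℚ) 1 * W + (d.w i + d.u i))
    (G : Polynomial (d.base i)) :
    ∃ G' : Polynomial (d.base i), G'.natDegree = G.natDegree ∧ (G ≠ 0 → G' ≠ 0) ∧
      Polynomial.aeval d.y G = Polynomial.aeval (single (d.n i : ℚ) 1 * W) G' := by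
  set v : d.base i := ⟨d.w i + d.u i, add_mem (d.w_mem_base hω i) (d.u_mem_base hr i)⟩
  refine ⟨G.comp (Polynomial.X + Polynomial.C v), ?_, ?_, ?_⟩
  · simp [Polynomial.natDegree_comp]
  · intro h h'
    refine h ?_
    rwa [Polynomial.comp_X_add_C_eq_zero_iff] at h'
  · rw [Polynomial.aeval_comp, hW]
    simp only [map_add, Polynomial.aeval_X, Polynomial.aeval_C]
    rfl

theorem addVal_aeval_alternative (hr : 2 ≤ r) (hω : ∀ e, ω (e + 1) ^ l = ω e) (hl : 0 < l)
    (hω0 : Transcendental k (ω 0)) (i : ℕ) (G : Polynomial (d.base i)) :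
    ((stepDegree l i * d.n i : ℚ) : WithTop ℚ) ≤ addVal ℚ F (Polynomial.aeval d.y G) ∨
      ∃ q ∈ fracGroup r i, addVal ℚ F (Polynomial.aeval d.y G) = (q : WithTop ℚ) := by
  obtain ⟨W, hW, hW0, hWc⟩ := d.exists_eq_mul hr i
  obtain ⟨G', -, -, hG'⟩ := d.exists_aeval_eq hr hω i hW G
  rw [hG']
  exact _root_.aeval_addVal_alternative (linearIndependent_root hω hl hω0 i) (inf_le_left)
    (fun s hs => (mem_suppNonnegSubalgebra.1 hs).2)
    (by simpa using intCast_mem_fracGroup r i (d.n i)) hW0 hWc G'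

theorem lt_stepDegree (hl : 2 ≤ l) (i : ℕ) : i < stepDegree l i := by
  refine lt_of_lt_of_le Nat.lt_two_pow_self ((Nat.pow_le_pow_left hl i).trans
    (Nat.pow_le_pow_right (by omega) ?_))
  have : rootIndex (i + 1) = rootIndex i + (2 * i + 1) := by
    simp only [rootIndex]
    ring
  omega

theorem algebraicIndependent (hr : 2 ≤ r) (hω : ∀ e, ω (e + 1) ^ l = ω e) (hl : 2 ≤ l)
    {x : F} (hx : Transcendental k x) (hω0 : ω 0 = 1 + x) :
    AlgebraicIndependent k (fun o : Option (Option Unit) => o.elim d.y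
      fun o => o.elim (single (1 : ℚ) (1 : F)) fun _ => C x) := by
  have hω0' : Transcendental k (ω 0) := fun h => hx <| by
    have := h.sub (isAlgebraic_one (R := k))
    rwa [hω0, add_sub_cancel_left] at this
  rw [AlgebraicIndependent.option_iff_transcendental (algebraicIndependent_C_single hx),
    transcendental_iff]
  intro p hp
  by_contra h0
  set i := p.natDegree
  have hle : Algebra.adjoin k (Set.range fun o : Option Unit =>
      o.elim (single (1 : ℚ) (1 : F)) fun _ => C x) ≤ d.base i := by
    rw [Algebra.adjoin_le_iff]
    rintro _ ⟨_ | _, rfl⟩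
    · exact single_mem_suppNonnegSubalgebra (by simpa using intCast_mem_fracGroup r i 1)
        zero_le_one (one_mem _)
    · refine C_mem_suppNonnegSubalgebra ?_
      have := sub_mem (root_mem_adjoin (k := k) hω (Nat.zero_le (rootIndex i))) (one_mem _)
      rwa [hω0, add_sub_cancel_left] at this
  have hinj : Function.Injective (Subalgebra.inclusion hle) := Subalgebra.inclusion_injective hle
  obtain ⟨W, hW, hW0, hWc⟩ := d.exists_eq_mul hr i
  obtain ⟨G', hdeg, hne, hG'⟩ := d.exists_aeval_eq hr hω i hW
    (p.map (Subalgebra.inclusion hle).toRingHom)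
  refine _root_.aeval_ne_zero_of_natDegree_lt (linearIndependent_root hω (by omega) hω0' i)
    (S := d.base i) inf_le_left (by simpa using intCast_mem_fracGroup r i (d.n i)) hW0 hWc
    (hne ((Polynomial.map_ne_zero_iff hinj).2 h0)) ?_ ?_
  · rw [hdeg]
    exact (Polynomial.natDegree_map_le).trans_lt (lt_stepDegree hl i)
  · rw [← hG', ← hp, Polynomial.aeval_def, Polynomial.aeval_def, Polynomial.eval₂_map]
    rfl

end TangentData

end Hahn

theorem ValuationSubring.valuation_lt_one_iff_inv_notMem {K : Type*} [Field K]
    (V : ValuationSubring K) (z : K) : V.valuation z < 1 ↔ z = 0 ∨ z⁻¹ ∉ V := by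
  by_cases hz : z = 0
  · simp [hz]
  · rw [← V.valuation_le_one_iff, map_inv₀, not_le, or_iff_right hz,
      one_lt_inv₀ (zero_lt_iff.2 ((map_ne_zero _).2 hz))]

theorem ValuationSubring.valuation_comap_lt_one_iff {K L : Type*} [Field K] [Field L]
    (V : ValuationSubring L) (j : K →+* L) (z : K) :
    (V.comap j).valuation z < 1 ↔ V.valuation (j z) < 1 := by
  rw [valuation_lt_one_iff_inv_notMem, valuation_lt_one_iff_inv_notMem, mem_comap, map_inv₀,
    map_eq_zero]

theorem ValuationSubring.mem_of_valuation_lt_one {K : Type*} [Field K]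
    (V : ValuationSubring K) {z : K} (h : V.valuation z < 1) : z ∈ V :=
  V.mem_of_valuation_le_one z h.le

/-- A Hensel type statement for the extraction of roots of one-units. -/
theorem exists_pow_eq_of_isAdicComplete {R : Type*} [CommRing R] (I : Ideal R) [IsAdicComplete I R]
    {q : ℕ} (hq : IsUnit (q : R)) (hq0 : q ≠ 0) {a : R} (ha : a - 1 ∈ I) :
    ∃ θ : R, θ ^ q = a ∧ θ - 1 ∈ I := by
  obtain ⟨θ, h1, h2⟩ := HenselianRing.is_henselian (I := I) (Polynomial.X ^ q - Polynomial.C a)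
    (Polynomial.monic_X_pow_sub_C a hq0) 1
    (by simpa using neg_mem ha)
    (by simpa [Polynomial.derivative_X_pow] using hq.map (Ideal.Quotient.mk I))
  refine ⟨θ, ?_, h2⟩
  simpa [Polynomial.IsRoot, sub_eq_zero] using h1

section Hahn

open HahnSeries

variable {F : Type*} [Field F]

/-- The composite of the order of a series with a valuation of the coefficient field. -/
def compositeSubring (O : ValuationSubring F) : ValuationSubring (HahnSeries ℚ F) where
  carrier := {f | 0 ≤ addVal ℚ F f ∧ f.coeff 0 ∈ O}
  zero_mem' := ⟨by simp, by simp⟩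
  one_mem' := ⟨by simp, by simp⟩
  add_mem' ha hb := ⟨(le_min ha.1 hb.1).trans (AddValuation.map_add _ _ _), by
    rw [coeff_add]
    exact add_mem ha.2 hb.2⟩
  neg_mem' ha := ⟨by rw [AddValuation.map_neg]; exact ha.1, by
    rw [coeff_neg]
    exact neg_mem ha.2⟩
  mul_mem' ha hb := ⟨by rw [AddValuation.map_mul]; exact add_nonneg ha.1 hb.1, by
    rw [coeff_mul_of_le (γ := 0) ha.1 hb.1]
    exact mul_mem ha.2 hb.2⟩
  mem_or_inv_mem' f := by
    have key : ∀ g : HahnSeries ℚ F, 0 < addVal ℚ F g → 0 ≤ addVal ℚ F g ∧ g.coeff 0 ∈ O :=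
      fun g hg => ⟨hg.le, by rw [(lt_addVal_iff (γ := 0)).1 hg 0 le_rfl]; exact zero_mem O⟩
    by_cases h0 : f = 0
    · exact Or.inl (key f (by simp [h0]))
    have h1 : addVal ℚ F f + addVal ℚ F f⁻¹ = 0 := by
      rw [← AddValuation.map_mul, mul_inv_cancel₀ h0, AddValuation.map_one]
    rcases lt_trichotomy (addVal ℚ F f) 0 with h | h | h
    · refine Or.inr (key _ (lt_of_not_ge fun h2 => ?_))
      have := (add_le_add (le_refl (addVal ℚ F f)) h2).trans_lt ((add_zero _).trans_lt h)
      exact this.ne h1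
    · have h2 : addVal ℚ F f⁻¹ = 0 := by rwa [h, zero_add] at h1
      have h3 := coeff_mul_of_le (γ := 0) h.ge h2.ge
      rw [mul_inv_cancel₀ h0, coeff_one, if_pos rfl] at h3
      have h4 : f⁻¹.coeff 0 = (f.coeff 0)⁻¹ := (inv_eq_of_mul_eq_one_right h3.symm).symm
      rcases O.mem_or_inv_mem (f.coeff 0) with h5 | h5
      · exact Or.inl ⟨h.ge, h5⟩
      · exact Or.inr ⟨h2.ge, h4 ▸ h5⟩
    · exact Or.inl (key f h)

theorem mem_compositeSubring {O : ValuationSubring F} {f : HahnSeries ℚ F} :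
    f ∈ compositeSubring O ↔ 0 ≤ addVal ℚ F f ∧ f.coeff 0 ∈ O :=
  Iff.rfl

theorem compositeSubring_valuation_lt_one {O : ValuationSubring F} {f : HahnSeries ℚ F}
    (hf : 0 ≤ addVal ℚ F f) (h : O.valuation (f.coeff 0) < 1) :
    (compositeSubring O).valuation f < 1 := by
  rw [ValuationSubring.valuation_lt_one_iff_inv_notMem] at h ⊢
  by_contra! h'
  obtain ⟨h0, h1⟩ := h'
  have h3 := coeff_mul_of_le (γ := 0) hf (mem_compositeSubring.1 h1).1
  rw [mul_inv_cancel₀ h0, coeff_one, if_pos rfl] at h3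
  have h4 : f⁻¹.coeff 0 = (f.coeff 0)⁻¹ := (inv_eq_of_mul_eq_one_right h3.symm).symm
  rcases h with h | h
  · rw [h, zero_mul] at h3
    exact one_ne_zero h3
  · exact h (h4 ▸ (mem_compositeSubring.1 h1).2)

theorem compositeSubring_valuation_lt_one_of_pos {O : ValuationSubring F} {f : HahnSeries ℚ F}
    (hf : 0 < addVal ℚ F f) : (compositeSubring O).valuation f < 1 :=
  compositeSubring_valuation_lt_one hf.le (by
    rw [(lt_addVal_iff (γ := 0)).1 hf 0 le_rfl, map_zero]
    exact zero_lt_one)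

end Hahn

theorem exists_root_tower {k : Type*} [Field k] {l : ℕ} (hl : (l : k) ≠ 0) :
    ∃ ω : ℕ → PowerSeries k, ω 0 = 1 + PowerSeries.X ∧ (∀ e, ω (e + 1) ^ l = ω e) ∧
      ∀ e, ω e - 1 ∈ Ideal.span {(PowerSeries.X : PowerSeries k)} := by
  have hl0 : l ≠ 0 := by rintro rfl; simp at hl
  have hlu : IsUnit (l : PowerSeries k) := by
    rw [← map_natCast (algebraMap k (PowerSeries k))]
    exact (Ne.isUnit hl).map _
  have key : ∀ a : {a : PowerSeries k // a - 1 ∈ Ideal.span {(PowerSeries.X : PowerSeries k)}},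
      ∃ b : {a : PowerSeries k // a - 1 ∈ Ideal.span {(PowerSeries.X : PowerSeries k)}},
        (b : PowerSeries k) ^ l = a := fun a => by
    obtain ⟨θ, h1, h2⟩ := exists_pow_eq_of_isAdicComplete _ hlu hl0 a.2
    exact ⟨⟨θ, h2⟩, h1⟩
  choose g hg using key
  let a : ℕ → {a : PowerSeries k // a - 1 ∈ Ideal.span {(PowerSeries.X : PowerSeries k)}} :=
    fun e => Nat.rec ⟨1 + PowerSeries.X, by
      rw [add_sub_cancel_left]
      exact Ideal.mem_span_singleton_self (PowerSeries.X : PowerSeries k)⟩ (fun _ b => g b) e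
  refine ⟨fun e => (a e).1, rfl, fun e => hg (a e), fun e => (a e).2⟩

theorem PowerSeries.transcendental_X (k : Type*) [Field k] :
    Transcendental k (PowerSeries.X : PowerSeries k) := by
  rw [transcendental_iff]
  intro p hp
  have h : Polynomial.aeval (PowerSeries.X : PowerSeries k) p = (p : PowerSeries k) := by
    have : Polynomial.aeval (R := k) (PowerSeries.X : PowerSeries k) =
        Polynomial.coeToPowerSeries.algHom (R := k) k :=
      Polynomial.algHom_ext (by simp [Polynomial.coeToPowerSeries.algHom_apply])
    rw [this]
    simp
  rw [h] at hp
  exact_mod_cast hp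

/-- The power series, as a valuation ring of their fraction field. -/
def powerSeriesSubring (k : Type*) [Field k] : ValuationSubring (FractionRing (PowerSeries k)) :=
  ValuationSubring.ofSubring (algebraMap (PowerSeries k) (FractionRing (PowerSeries k))).range
    fun x => (ValuationRing.isInteger_or_isInteger (PowerSeries k) x)

theorem mem_powerSeriesSubring {k : Type*} [Field k] {x : FractionRing (PowerSeries k)} :
    x ∈ powerSeriesSubring k ↔
      ∃ f, algebraMap (PowerSeries k) (FractionRing (PowerSeries k)) f = x :=
  Iff.rfl

theorem powerSeriesSubring_valuation_lt_one {k : Type*} [Field k] {f : PowerSeries k}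
    (hf : PowerSeries.constantCoeff f = 0) :
    (powerSeriesSubring k).valuation
      (algebraMap (PowerSeries k) (FractionRing (PowerSeries k)) f) < 1 := by
  rw [ValuationSubring.valuation_lt_one_iff_inv_notMem]
  by_contra! h
  obtain ⟨h0, h1⟩ := h
  obtain ⟨g, hg⟩ := mem_powerSeriesSubring.1 h1
  have h2 : f * g = 1 := by
    apply IsFractionRing.injective (PowerSeries k) (FractionRing (PowerSeries k))
    rw [map_mul, hg, mul_inv_cancel₀ h0, map_one]
  have h3 := congrArg PowerSeries.constantCoeff h2
  rw [map_mul, hf, zero_mul, map_one] at h3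
  exact zero_ne_one h3

universe u

/-- A field with a valuation trivial on `k`, with residue field `k` and with enough roots. -/
theorem exists_coefficientField (k : Type u) [Field k] {l : ℕ} (hl : (l : k) ≠ 0) :
    ∃ (F : Type u) (_ : Field F) (_ : Algebra k F) (O : ValuationSubring F) (x : F) (ω : ℕ → F),
      Transcendental k x ∧ O.valuation x < 1 ∧ ω 0 = 1 + x ∧ (∀ e, ω (e + 1) ^ l = ω e) ∧
      (∀ e, O.valuation (ω e - 1) < 1) ∧ (∀ c, algebraMap k F c ∈ O) ∧
      ∀ z ∈ O, ∃ c, O.valuation (z - algebraMap k F c) < 1 := by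
  obtain ⟨ω, h0, h1, h2⟩ := exists_root_tower hl
  refine ⟨FractionRing (PowerSeries k), inferInstance, inferInstance, powerSeriesSubring k,
    algebraMap _ _ PowerSeries.X, fun e => algebraMap _ _ (ω e),
    ?_, powerSeriesSubring_valuation_lt_one (by simp), by simp [h0], fun e => by rw [← map_pow, h1],
    fun e => ?_, fun c => ?_, fun z hz => ?_⟩
  · exact (transcendental_algebraMap_iff (IsFractionRing.injective _ _)).2
      (PowerSeries.transcendental_X k)
  · rw [← map_one (algebraMap (PowerSeries k) (FractionRing (PowerSeries k))), ← map_sub]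
    refine powerSeriesSubring_valuation_lt_one ?_
    obtain ⟨g, hg⟩ := Ideal.mem_span_singleton'.1 (h2 e)
    rw [← hg]
    simp
  · exact mem_powerSeriesSubring.2 ⟨algebraMap k _ c, (IsScalarTower.algebraMap_apply _ _ _ _).symm⟩
  · obtain ⟨f, rfl⟩ := mem_powerSeriesSubring.1 hz
    refine ⟨PowerSeries.constantCoeff f, ?_⟩
    rw [IsScalarTower.algebraMap_apply k (PowerSeries k) (FractionRing (PowerSeries k)),
      ← map_sub]
    refine powerSeriesSubring_valuation_lt_one ?_
    rw [map_sub]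
    simp

theorem IsLocalization.mem_range_lift {R S K : Type*} [CommRing R] [CommRing S] [Algebra R S]
    (M : Submonoid R) [IsLocalization M S] [Field K] {g : R →+* K} (hg : ∀ y : M, IsUnit (g y))
    {x : K} : x ∈ (IsLocalization.lift hg : S →+* K).range ↔ ∃ a, ∃ s ∈ M, x = g a / g s := by
  constructor
  · rintro ⟨z, rfl⟩
    obtain ⟨a, s, rfl⟩ := IsLocalization.exists_mk'_eq M z
    refine ⟨a, s, s.2, ?_⟩
    rw [eq_div_iff (hg s).ne_zero, mul_comm]
    exact ((IsLocalization.lift_mk'_spec (M := M) _ _ _ _).1 rfl).symm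
  · rintro ⟨a, s, hs, rfl⟩
    refine ⟨IsLocalization.mk' S a (⟨s, hs⟩ : M), ?_⟩
    rw [eq_div_iff (hg ⟨s, hs⟩).ne_zero, mul_comm]
    exact ((IsLocalization.lift_mk'_spec (M := M) _ _ _ _).1 rfl).symm

theorem mem_T0 {k : Type*} [Field k] {x : KK k} : x ∈ T0 k ↔
    ∃ g s : RP k, MvPolynomial.eval (0 : Fin 3 → k) s ≠ 0 ∧
      x = algebraMap (RP k) (KK k) g / algebraMap (RP k) (KK k) s :=
  IsLocalization.mem_range_lift (M0 k) _

/-- A valuation ring which contains the constants and in whose maximal ideal the variables lie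
dominates the local ring of the origin. -/
theorem vDominates_T0 {k : Type*} [Field k] {V : ValuationSubring (KK k)}
    (hC : ∀ c, algebraMap (RP k) (KK k) (MvPolynomial.C c) ∈ V)
    (hX : ∀ i, V.valuation (algebraMap (RP k) (KK k) (MvPolynomial.X i)) < 1) :
    VDominates V (T0 k) := by
  have hV : ∀ g : RP k, algebraMap (RP k) (KK k) g ∈ V := fun g => by
    induction g using MvPolynomial.induction_on with
    | C c => exact hC c
    | add p q hp hq => rw [map_add]; exact add_mem hp hq
    | mul_X p i hp => rw [map_mul]; exact mul_mem hp (V.mem_of_valuation_lt_one (hX i))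
  have hV0 : ∀ g : RP k, V.valuation (algebraMap (RP k) (KK k) g -
      algebraMap (RP k) (KK k) (MvPolynomial.C (MvPolynomial.eval 0 g))) < 1 := fun g => by
    induction g using MvPolynomial.induction_on with
    | C c => simp
    | add p q hp hq =>
      have := V.valuation.map_add_lt hp hq
      simp only [map_add] at this ⊢
      convert this using 2
      ring
    | mul_X p i hp =>
      simp only [map_mul, MvPolynomial.eval_X, Pi.zero_apply, mul_zero, map_zero, sub_zero]
      exact mul_lt_one_of_nonneg_of_lt_one_right
        ((V.valuation_le_one_iff _).2 (hV p)) zero_le (hX i)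
  have hV1 : ∀ g : RP k, MvPolynomial.eval 0 g ≠ 0 →
      V.valuation (algebraMap (RP k) (KK k) g) = 1 := fun g hg => by
    have h1 :
        V.valuation (algebraMap (RP k) (KK k) (MvPolynomial.C (MvPolynomial.eval 0 g))) = 1 := by
      refine le_antisymm ((V.valuation_le_one_iff _).2 (hC _)) ?_
      have h2 := (V.valuation_le_one_iff _).2 (hC (MvPolynomial.eval 0 g)⁻¹)
      have h3 : V.valuation (algebraMap (RP k) (KK k) (MvPolynomial.C (MvPolynomial.eval 0 g))) *
          V.valuation
            (algebraMap (RP k) (KK k) (MvPolynomial.C (MvPolynomial.eval 0 g)⁻¹)) = 1 := by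
        rw [← map_mul, ← map_mul, ← map_mul, mul_inv_cancel₀ hg, map_one, map_one, map_one]
      rw [← h3]
      exact mul_le_of_le_one_right' h2
    rw [← h1]
    exact Valuation.map_eq_of_sub_lt _ (h1 ▸ hV0 g)
  refine ⟨fun x hx => ?_, fun x hx => ?_⟩
  · obtain ⟨g, s, hs, rfl⟩ := mem_T0.1 hx
    refine V.mem_of_valuation_le_one _ ?_
    rw [map_div₀, hV1 s hs, div_one]
    exact (V.valuation_le_one_iff _).2 (hV g)
  · obtain ⟨g, s, hs, rfl⟩ := mem_T0.1 hx
    constructor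
    · refine fun h => ⟨hx, fun ⟨h0, h'⟩ => ?_⟩
      obtain ⟨g', s', hs', h2⟩ := mem_T0.1 h'
      rw [ValuationSubring.valuation_lt_one_iff_inv_notMem] at h
      refine h.elim h0 fun h => h ?_
      rw [h2]
      refine V.mem_of_valuation_le_one _ ?_
      rw [map_div₀, hV1 s' hs', div_one]
      exact (V.valuation_le_one_iff _).2 (hV g')
    · intro h
      by_cases hg : MvPolynomial.eval 0 g = 0
      · rw [map_div₀, hV1 s hs, div_one]
        have := hV0 g
        rwa [hg, map_zero, map_zero, sub_zero] at this
      · refine absurd ⟨fun h0 => ?_, mem_T0.2 ⟨s, g, hg, (inv_div _ _)⟩⟩ h.2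
        have := congrArg V.valuation h0
        rw [map_div₀, hV1 s hs, hV1 g hg, map_zero, div_one] at this
        exact one_ne_zero this

section Hahn

open HahnSeries

namespace TangentData

variable {k F : Type*} [Field k] [Field F] [Algebra k F]

variable {ω : ℕ → F} {r l : ℕ} (d : TangentData k ω r)

/-- The substitution which sends the variables to a constant, to the given series, and to `t`. -/
def subst (x : F) : RP k →ₐ[k] HahnSeries ℚ F :=
  MvPolynomial.aeval ![C x, d.y, single 1 1]

theorem subst_X0 (x : F) : d.subst x (MvPolynomial.X 0) = C x := by simp [subst]

theorem subst_X1 (x : F) : d.subst x (MvPolynomial.X 1) = d.y := by simp [subst]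

theorem subst_X2 (x : F) : d.subst x (MvPolynomial.X 2) = single 1 1 := by simp [subst]

theorem subst_C (x : F) (c : k) : d.subst x (MvPolynomial.C c) = C (algebraMap k F c) := by
  rw [subst, MvPolynomial.aeval_C]
  rfl

theorem addVal_subst_nonneg (x : F) (p : RP k) : 0 ≤ addVal ℚ F (d.subst x p) := by
  induction p using MvPolynomial.induction_on with
  | C c => rw [subst_C]; exact addVal_C_nonneg _
  | add p q hp hq => rw [map_add]; exact (le_min hp hq).trans (AddValuation.map_add _ _ _)
  | mul_X p i hp =>
    rw [map_mul, AddValuation.map_mul]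
    refine add_nonneg hp ?_
    fin_cases i
    · exact (d.subst_X0 x) ▸ addVal_C_nonneg _
    · exact (d.subst_X1 x) ▸ d.addVal_y_pos.le
    · exact (d.subst_X2 x) ▸ addVal_single_nonneg zero_le_one _

theorem subst_injective (hr : 2 ≤ r) (hω : ∀ e, ω (e + 1) ^ l = ω e) (hl : 2 ≤ l)
    {x : F} (hx : Transcendental k x) (hω0 : ω 0 = 1 + x) :
    Function.Injective (d.subst x) := by
  let f : Fin 3 → Option (Option Unit) := ![some (some ()), none, some none]
  have hf : Function.Injective f := by decide
  have := (d.algebraicIndependent hr hω hl hx hω0).comp f hf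
  rw [AlgebraicIndependent] at this
  convert this using 3
  rw [subst]
  congr 1
  ext i
  fin_cases i <;> rfl

/-- The embedding of the field of rational functions. -/
def embed (hr : 2 ≤ r) (hω : ∀ e, ω (e + 1) ^ l = ω e) (hl : 2 ≤ l)
    {x : F} (hx : Transcendental k x) (hω0 : ω 0 = 1 + x) : KK k →ₐ[k] HahnSeries ℚ F :=
  IsFractionRing.liftAlgHom (g := d.subst x) (d.subst_injective hr hω hl hx hω0)

theorem embed_algebraMap (hr : 2 ≤ r) (hω : ∀ e, ω (e + 1) ^ l = ω e) (hl : 2 ≤ l)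
    {x : F} (hx : Transcendental k x) (hω0 : ω 0 = 1 + x) (p : RP k) :
    d.embed hr hω hl hx hω0 (algebraMap (RP k) (KK k) p) = d.subst x p := by
  simp [embed]

end TangentData

end Hahn

/-- The field generated by the first variable. -/
abbrev coeffField (k : Type*) [Field k] : IntermediateField k (KK k) :=
  IntermediateField.adjoin k {algebraMap (RP k) (KK k) (MvPolynomial.X 0)}

/-- The polynomials in the last two variables over the field generated by the first one. -/
abbrev planeSubalgebra (k : Type*) [Field k] : Subalgebra (coeffField k) (KK k) :=
  Algebra.adjoin (coeffField k)
    {algebraMap (RP k) (KK k) (MvPolynomial.X 1), algebraMap (RP k) (KK k) (MvPolynomial.X 2)}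

theorem exists_coprime_natCast_ne_zero (k : Type*) [Field k] :
    ∃ r l : ℕ, 2 ≤ r ∧ 2 ≤ l ∧ r.Coprime l ∧ (r : k) ≠ 0 ∧ (l : k) ≠ 0 := by
  by_cases h2 : (2 : k) = 0
  · refine ⟨3, 5, by norm_num, by norm_num, by norm_num, ?_, ?_⟩
    · intro h
      exact one_ne_zero (α := k) (by push_cast at h; linear_combination h - h2)
    · intro h
      exact one_ne_zero (α := k) (by push_cast at h; linear_combination h - 2 * h2)
  · by_cases h3 : (3 : k) = 0
    · refine ⟨2, 5, by norm_num, by norm_num, by norm_num, by exact_mod_cast h2, fun h => h2 ?_⟩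
      push_cast at h
      linear_combination h - h3
    · exact ⟨2, 3, by norm_num, by norm_num, by norm_num, by exact_mod_cast h2,
        by exact_mod_cast h3⟩

section Hahn

open HahnSeries

namespace TangentData

variable {k F : Type*} [Field k] [Field F] [Algebra k F]

variable {ω : ℕ → F} {r l : ℕ} (d : TangentData k ω r)

theorem exists_eq_C_of_mem_coeffField (hr : 2 ≤ r) (hω : ∀ e, ω (e + 1) ^ l = ω e) (hl : 2 ≤ l)
    {x : F} (hx : Transcendental k x) (hω0 : ω 0 = 1 + x) {z : KK k} (hz : z ∈ coeffField k) :
    ∃ a ∈ IntermediateField.adjoin k {x}, d.embed hr hω hl hx hω0 z = C a := by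
  induction hz using IntermediateField.adjoin_induction with
  | mem z hz =>
    rw [Set.mem_singleton_iff.1 hz, embed_algebraMap, subst_X0]
    exact ⟨x, IntermediateField.mem_adjoin_simple_self k x, rfl⟩
  | algebraMap c => exact ⟨algebraMap k F c, algebraMap_mem _ c, AlgHom.commutes _ c⟩
  | add a b _ _ ha hb =>
    obtain ⟨a', ha, ha'⟩ := ha
    obtain ⟨b', hb, hb'⟩ := hb
    exact ⟨a' + b', add_mem ha hb, by rw [map_add, ha', hb', map_add]⟩
  | mul a b _ _ ha hb =>
    obtain ⟨a', ha, ha'⟩ := ha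
    obtain ⟨b', hb, hb'⟩ := hb
    exact ⟨a' * b', mul_mem ha hb, by rw [map_mul, ha', hb', map_mul]⟩
  | inv a _ ha =>
    obtain ⟨a', ha, ha'⟩ := ha
    exact ⟨a'⁻¹, inv_mem ha, by rw [map_inv₀, ha', map_inv₀]⟩

theorem mem_adjoin_of_root (hω : ∀ e, ω (e + 1) ^ l = ω e) {x : F} (hω0 : ω 0 = 1 + x) (e : ℕ) :
    IntermediateField.adjoin k {x} ≤ IntermediateField.adjoin k {ω e} := by
  rw [IntermediateField.adjoin_simple_le_iff]
  have := sub_mem (root_mem_adjoin (k := k) hω (Nat.zero_le e)) (one_mem _)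
  rwa [hω0, add_sub_cancel_left] at this

theorem exists_aeval_eq_of_mem_planeSubalgebra (hr : 2 ≤ r) (hω : ∀ e, ω (e + 1) ^ l = ω e)
    (hl : 2 ≤ l) {x : F} (hx : Transcendental k x) (hω0 : ω 0 = 1 + x) (i : ℕ) {z : KK k}
    (hz : z ∈ planeSubalgebra k) :
    ∃ G : Polynomial (d.base i), d.embed hr hω hl hx hω0 z = Polynomial.aeval d.y G := by
  have hbase : ∀ b ∈ d.base i, ∃ G : Polynomial (d.base i), b = Polynomial.aeval d.y G :=
    fun b hb => ⟨Polynomial.C ⟨b, hb⟩, by rw [Polynomial.aeval_C]; rfl⟩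
  induction hz using Algebra.adjoin_induction with
  | mem z hz =>
    rcases hz with rfl | rfl
    · rw [embed_algebraMap, subst_X1]
      exact ⟨Polynomial.X, (Polynomial.aeval_X _).symm⟩
    · rw [embed_algebraMap, subst_X2]
      exact hbase _ (single_mem_suppNonnegSubalgebra
        (by simpa using intCast_mem_fracGroup r i 1) zero_le_one (one_mem _))
  | algebraMap c =>
    obtain ⟨a, ha, h⟩ := d.exists_eq_C_of_mem_coeffField hr hω hl hx hω0 c.2
    obtain ⟨G, hG⟩ := hbase (C a)
      (C_mem_suppNonnegSubalgebra (mem_adjoin_of_root hω hω0 (rootIndex i) ha))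
    exact ⟨G, h.trans hG⟩
  | add a b _ _ ha hb =>
    obtain ⟨a', ha'⟩ := ha
    obtain ⟨b', hb'⟩ := hb
    exact ⟨a' + b', by rw [map_add, ha', hb', map_add]⟩
  | mul a b _ _ ha hb =>
    obtain ⟨a', ha'⟩ := ha
    obtain ⟨b', hb'⟩ := hb
    exact ⟨a' * b', by rw [map_mul, ha', hb', map_mul]⟩

theorem exists_forall_mul_lt (hr : 2 ≤ r) (hl : 2 ≤ l) (b : ℚ) :
    ∃ i₀, ∀ i ≥ i₀, b * (d.c i + auxExp r d.n i + 1) < stepDegree l i * d.n i := by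
  obtain ⟨N, hN⟩ := exists_nat_gt (4 * |b|)
  refine ⟨N, fun i hi => ?_⟩
  have h1 := auxExp_lt hr d.n i
  have h2 : (d.c i : ℚ) < d.n i := d.c_lt i
  have h3 : (1 : ℚ) ≤ d.n i := by exact_mod_cast d.n_pos i
  have h4 : (N : ℚ) < stepDegree l i := by exact_mod_cast hi.trans_lt (lt_stepDegree hl i)
  have h5 : 0 ≤ d.c i + auxExp r d.n i + 1 := by
    have := d.c_nonneg hr i
    have := natCast_lt_auxExp hr d.n i
    linarith
  calc b * (d.c i + auxExp r d.n i + 1) ≤ |b| * (d.c i + auxExp r d.n i + 1) :=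
        mul_le_mul_of_nonneg_right (le_abs_self b) h5
    _ ≤ |b| * (4 * d.n i) := mul_le_mul_of_nonneg_left (by linarith) (abs_nonneg b)
    _ = (4 * |b|) * d.n i := by ring
    _ < stepDegree l i * d.n i := mul_lt_mul_of_pos_right (hN.trans h4) (by linarith)

end TangentData

theorem exists_valuation_with_approximate_roots (k : Type*) [Field k] :
    ∃ (V : ValuationSubring (KK k)) (ν : AddValuation (KK k) (WithTop ℚ)) (r : ℕ) (β B : ℕ → ℚ),
      VDominates V (T0 k) ∧
      (∀ x ∈ V, ∃ c : k, V.valuation (x - algebraMap (RP k) (KK k) (MvPolynomial.C c)) < 1) ∧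
      (∀ x ∈ V, 0 ≤ ν x) ∧
      (∀ x, 0 < ν x → V.valuation x < 1) ∧
      (∀ x ∈ coeffField k, x ≠ 0 → ν x = 0) ∧
      ν (algebraMap (RP k) (KK k) (MvPolynomial.X 2)) = ((1 : ℚ) : WithTop ℚ) ∧
      (∀ i, β i ∉ fracGroup r i) ∧
      (∀ i, β i ∈ fracGroup r (i + 1)) ∧
      (∀ i, ∀ f ∈ planeSubalgebra k, (B i : WithTop ℚ) ≤ ν f ∨
        ∃ q ∈ fracGroup r i, ν f = (q : WithTop ℚ)) ∧
      (∀ b : ℚ, ∃ i₀, ∀ i ≥ i₀, b * (β i + 1) < B i) ∧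
      ∀ i, ∃ q : ℕ, (q : k) ≠ 0 ∧ ∃ (g : Polynomial (RP k)) (a : KK k),
        V.valuation (a - 1) < 1 ∧
        (β i : WithTop ℚ) < ν (a ^ q - algebraMap (RP k) (KK k) (1 + MvPolynomial.X 0)) ∧
        ν (g.eval₂ (algebraMap (RP k) (KK k)) a) = (β i : WithTop ℚ) := by
  obtain ⟨r, l, hr, hl, hcop, hrk, hlk⟩ := exists_coprime_natCast_ne_zero k
  obtain ⟨F, _, _, O, x, ω, hx, hxO, hω0, hω, hωO, hkO, hres⟩ := exists_coefficientField k hlk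
  obtain ⟨d⟩ := nonempty_tangentData (k := k) ω hr hrk
  have hω0' : Transcendental k (ω 0) := fun h => hx <| by
    have := h.sub (isAlgebraic_one (R := k))
    rwa [hω0, add_sub_cancel_left] at this
  have hω00 : ω 0 ≠ 0 := fun h => hω0' (h ▸ isAlgebraic_zero)
  set j : KK k →ₐ[k] HahnSeries ℚ F := d.embed hr hω hl hx hω0
  have hj : ∀ p, j (algebraMap (RP k) (KK k) p) = d.subst x p := d.embed_algebraMap hr hω hl hx hω0
  have hν : ∀ z, (addVal ℚ F).comap (j : KK k →+* HahnSeries ℚ F) z = addVal ℚ F (j z) :=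
    fun _ => rfl
  have hV : ∀ z, z ∈ (compositeSubring O).comap (j : KK k →+* HahnSeries ℚ F) ↔
    0 ≤ addVal ℚ F (j z) ∧ (j z).coeff 0 ∈ O := fun _ => Iff.rfl
  refine ⟨(compositeSubring O).comap (j : KK k →+* HahnSeries ℚ F),
    (addVal ℚ F).comap (j : KK k →+* HahnSeries ℚ F), r, fun i => d.c i + auxExp r d.n i,
    fun i => TangentData.stepDegree l i * d.n i, ?_, ?_, ?_, ?_, ?_, ?_, ?_, ?_, ?_, ?_, ?_⟩
  · refine vDominates_T0 (fun c => ?_) fun i => ?_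
    · rw [hV, hj, d.subst_C]
      exact ⟨addVal_C_nonneg _, by simpa using hkO c⟩
    · rw [ValuationSubring.valuation_comap_lt_one_iff]
      change (compositeSubring O).valuation (j _) < 1
      rw [hj]
      fin_cases i
      · refine (d.subst_X0 x).symm ▸ compositeSubring_valuation_lt_one (addVal_C_nonneg _) ?_
        simpa using hxO
      · exact (d.subst_X1 x).symm ▸ compositeSubring_valuation_lt_one_of_pos d.addVal_y_pos
      · refine (d.subst_X2 x).symm ▸ compositeSubring_valuation_lt_one_of_pos ?_
        rw [addVal_single one_ne_zero]
        exact WithTop.coe_lt_coe.2 zero_lt_one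
  · intro z hz
    obtain ⟨hz0, hz1⟩ := (hV z).1 hz
    obtain ⟨c, hc⟩ := hres _ hz1
    refine ⟨c, ?_⟩
    rw [ValuationSubring.valuation_comap_lt_one_iff]
    change (compositeSubring O).valuation (j _) < 1
    rw [map_sub, hj, d.subst_C]
    refine compositeSubring_valuation_lt_one
      ((le_min hz0 (addVal_C_nonneg _)).trans (AddValuation.map_sub _ _ _)) ?_
    rwa [coeff_sub, C_apply, coeff_single_same]
  · exact fun z hz => ((hV z).1 hz).1
  · intro z hz
    rw [ValuationSubring.valuation_comap_lt_one_iff]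
    exact compositeSubring_valuation_lt_one_of_pos hz
  · intro z hz h0
    obtain ⟨a, -, ha⟩ := d.exists_eq_C_of_mem_coeffField hr hω hl hx hω0 hz
    rw [hν]
    change addVal ℚ F (d.embed hr hω hl hx hω0 z) = 0
    rw [ha]
    refine addVal_C ?_
    rintro rfl
    rw [map_zero] at ha
    exact h0 ((map_eq_zero _).1 ha)
  · rw [hν, hj, d.subst_X2, addVal_single one_ne_zero]
  · intro i h
    refine auxExp_notMem hr d.n i ?_
    have := sub_mem h (d.c_mem hr i)
    rwa [add_sub_cancel_left] at this
  · exact fun i => add_mem (fracGroup_mono r i.le_succ (d.c_mem hr i))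
      (auxExp_mem hr d.n i.lt_succ_self)
  · intro i f hf
    obtain ⟨G, hG⟩ := d.exists_aeval_eq_of_mem_planeSubalgebra hr hω hl hx hω0 i hf
    rw [hν]
    change _ ≤ addVal ℚ F (d.embed hr hω hl hx hω0 f) ∨
      ∃ q ∈ _, addVal ℚ F (d.embed hr hω hl hx hω0 f) = _
    rw [hG]
    exact d.addVal_aeval_alternative hr hω (by omega) hω0' i G
  · exact d.exists_forall_mul_lt hr hl
  · intro i
    have hL : ∀ p, (d.subst x : RP k →+* HahnSeries ℚ F) p ∈
        (j : KK k →+* HahnSeries ℚ F).fieldRange := fun p => ⟨_, hj p⟩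
    obtain ⟨g, b, ⟨a, rfl⟩, h1, h2, h3⟩ := d.exists_approx hr hcop hlk hω hω00 (d.subst_C x)
      (by rw [hω0]; simp [d.subst_X0]) (d.subst_X1 x) (d.subst_X2 x) (d.addVal_subst_nonneg x) hL i
    refine ⟨l ^ rootIndex (i + 1), ?_, g, a, ?_, ?_, ?_⟩
    · rw [Nat.cast_pow]
      exact pow_ne_zero _ hlk
    · rw [ValuationSubring.valuation_comap_lt_one_iff, map_sub, map_one]
      have h4 := coeff_zero_eq_of_addVal_sub_pos h1
      refine compositeSubring_valuation_lt_one ?_ ?_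
      · have h5 := (le_min h1.le (addVal_C_nonneg (ω (rootIndex (i + 1))))).trans
          (AddValuation.map_add _ _ _)
        rw [sub_add_cancel] at h5
        exact (le_min h5 (by simp)).trans (AddValuation.map_sub _ _ _)
      · rw [coeff_sub, h4, coeff_one, if_pos rfl]
        exact hωO _
    · rw [hν, map_sub, map_pow, hj]
      exact h2
    · rw [hν, ← h3, ← AlgHom.coe_toRingHom, Polynomial.hom_eval₂]
      congr 2
      ext p <;> simp [hj]

end Hahn

theorem algebraMap_mem_planeSubalgebra {k : Type*} [Field k] (p : RP k) :
    algebraMap (RP k) (KK k) p ∈ planeSubalgebra k := by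
  induction p using MvPolynomial.induction_on with
  | C c =>
    have : algebraMap (RP k) (KK k) (MvPolynomial.C c) =
        algebraMap (coeffField k) (KK k) (algebraMap k (coeffField k) c) := by
      rw [← IsScalarTower.algebraMap_apply]
      exact (IsScalarTower.algebraMap_apply k (RP k) (KK k) c).symm
    rw [this]
    exact Subalgebra.algebraMap_mem _ _
  | add p q hp hq => rw [map_add]; exact add_mem hp hq
  | mul_X p i hp =>
    rw [map_mul]
    refine mul_mem hp ?_
    fin_cases i
    · exact (planeSubalgebra k).algebraMap_mem
        ⟨_, IntermediateField.mem_adjoin_simple_self k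
          (algebraMap (RP k) (KK k) (MvPolynomial.X 0))⟩
    · exact Algebra.subset_adjoin (Or.inl rfl)
    · exact Algebra.subset_adjoin (Or.inr rfl)

theorem exists_denominator_planeSubalgebra {k : Type*} [Field k] (s : Finset (KK k)) :
    ∃ d ∈ planeSubalgebra k, d ≠ 0 ∧ ∀ z ∈ s, d * z ∈ planeSubalgebra k := by
  obtain ⟨b, hb⟩ := IsLocalization.exist_integer_multiples_of_finset (nonZeroDivisors (RP k)) s
  refine ⟨algebraMap (RP k) (KK k) b, algebraMap_mem_planeSubalgebra _, ?_, fun z hz => ?_⟩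
  · exact IsFractionRing.to_map_ne_zero_of_mem_nonZeroDivisors b.2
  · obtain ⟨a, ha⟩ := hb z hz
    rw [← Algebra.smul_def]
    change ((b : RP k) • z) ∈ _
    rw [← ha]
    exact algebraMap_mem_planeSubalgebra a

theorem trdeg_coeffField_le (k : Type*) [Field k] : Algebra.trdeg (coeffField k) (KK k) ≤ 2 := by
  have : Algebra.IsAlgebraic (planeSubalgebra k) (KK k) := ⟨fun z => by
    obtain ⟨d, hd, h0, h⟩ := exists_denominator_planeSubalgebra {z}
    have h1 := h z (Finset.mem_singleton_self z)
    have h2 : z = d⁻¹ * (d * z) := by rw [← mul_assoc, inv_mul_cancel₀ h0, one_mul]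
    rw [h2]
    exact (isAlgebraic_algebraMap (⟨d, hd⟩ : planeSubalgebra k)).inv.mul
      (isAlgebraic_algebraMap (⟨d * z, h1⟩ : planeSubalgebra k))⟩
  refine (Algebra.IsAlgebraic.trdeg_le_cardinalMk (alg := this)).trans ?_
  refine (Cardinal.mk_insert_le).trans ?_
  rw [Cardinal.mk_singleton]
  norm_num

instance essFiniteType_coeffField (k : Type*) [Field k] :
    Algebra.EssFiniteType (coeffField k) (KK k) := by
  have h1 : Algebra.EssFiniteType (RP k) (KK k) :=
    Algebra.EssFiniteType.of_isLocalization _ (nonZeroDivisors (RP k))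
  have h2 : Algebra.EssFiniteType k (KK k) := Algebra.EssFiniteType.comp k (RP k) (KK k)
  exact Algebra.EssFiniteType.of_comp k (coeffField k) (KK k)

section Localization

variable {K : Type*} [Field K]

/-- The elements of a subring which are units for a valuation. -/
def valUnits (ν : AddValuation K (WithTop ℚ)) (T : Subring K) : Submonoid T where
  carrier := {s | ν s = 0}
  one_mem' := ν.map_one
  mul_mem' {a b} ha hb := by
    change ν ((a : K) * b) = 0
    rw [ν.map_mul, show ν (a : K) = 0 from ha, show ν (b : K) = 0 from hb, add_zero]

theorem isUnit_of_valUnits {ν : AddValuation K (WithTop ℚ)} {T : Subring K} (s : valUnits ν T) :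
    IsUnit (T.subtype s) := by
  refine isUnit_iff_ne_zero.2 fun h => ?_
  have h1 : ν (T.subtype s) = 0 := s.2
  rw [h, ν.map_zero] at h1
  exact WithTop.top_ne_zero h1

/-- The localization of a subring at the center of a valuation. -/
def valLocalization (ν : AddValuation K (WithTop ℚ)) (T : Subring K) : Subring K :=
  (IsLocalization.lift (M := valUnits ν T) (S := Localization (valUnits ν T))
    (g := T.subtype) isUnit_of_valUnits).range

theorem mem_valLocalization {ν : AddValuation K (WithTop ℚ)} {T : Subring K} {x : K} :
    x ∈ valLocalization ν T ↔ ∃ a ∈ T, ∃ s ∈ T, ν s = 0 ∧ x = a / s := by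
  refine (IsLocalization.mem_range_lift (valUnits ν T) _).trans ?_
  constructor
  · rintro ⟨a, s, hs, h⟩
    exact ⟨a, a.2, s, s.2, hs, h⟩
  · rintro ⟨a, ha, s, hs, h0, h⟩
    exact ⟨⟨a, ha⟩, ⟨s, hs⟩, h0, h⟩

theorem isNoetherianRing_valLocalization (ν : AddValuation K (WithTop ℚ)) (T : Subring K)
    [IsNoetherianRing T] : IsNoetherianRing (valLocalization ν T) := by
  have : IsNoetherianRing (Localization (valUnits ν T)) :=
    IsLocalization.isNoetherianRing (valUnits ν T) _ inferInstance
  exact isNoetherianRing_range _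

theorem le_valLocalization (ν : AddValuation K (WithTop ℚ)) (T : Subring K) :
    T ≤ valLocalization ν T :=
  fun a ha => mem_valLocalization.2 ⟨a, ha, 1, one_mem T, ν.map_one, (div_one a).symm⟩

theorem AddValuation.map_div_of_eq_zero (ν : AddValuation K (WithTop ℚ)) (a : K) {s : K}
    (hs : ν s = 0) : ν (a / s) = ν a := by
  have h0 : s ≠ 0 := by
    rintro rfl
    rw [ν.map_zero] at hs
    exact WithTop.top_ne_zero hs
  have := ν.map_mul (a / s) s
  rw [div_mul_cancel₀ a h0, hs, add_zero] at this
  exact this.symm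

theorem nonneg_of_mem_valLocalization {ν : AddValuation K (WithTop ℚ)} {T : Subring K}
    (hT : ∀ a ∈ T, 0 ≤ ν a) {x : K} (hx : x ∈ valLocalization ν T) : 0 ≤ ν x := by
  obtain ⟨a, ha, s, -, h0, rfl⟩ := mem_valLocalization.1 hx
  rw [ν.map_div_of_eq_zero a h0]
  exact hT a ha

theorem inv_mem_valLocalization {ν : AddValuation K (WithTop ℚ)} {T : Subring K} {x : K}
    (hx : x ∈ valLocalization ν T) (h : ν x = 0) : x⁻¹ ∈ valLocalization ν T := by
  obtain ⟨a, ha, s, hs, h0, rfl⟩ := mem_valLocalization.1 hx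
  rw [ν.map_div_of_eq_zero a h0] at h
  exact mem_valLocalization.2 ⟨s, hs, a, ha, h, inv_div a s⟩

end Localization

theorem coeffField_le_valLocalization {k : Type*} [Field k] {ν : AddValuation (KK k) (WithTop ℚ)}
    (hν : ∀ x ∈ coeffField k, x ≠ 0 → ν x = 0) {T : Subring (KK k)}
    (hT : ∀ p, algebraMap (RP k) (KK k) p ∈ T) {x : KK k} (hx : x ∈ coeffField k) :
    x ∈ valLocalization ν T := by
  obtain ⟨p, q, rfl⟩ := (IntermediateField.mem_adjoin_simple_iff k x).1 hx
  by_cases h0 : Polynomial.aeval (algebraMap (RP k) (KK k) (MvPolynomial.X 0)) q = 0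
  · rw [h0, div_zero]
    exact zero_mem _
  · have h1 : ∀ p : Polynomial k,
        Polynomial.aeval (algebraMap (RP k) (KK k) (MvPolynomial.X 0)) p ∈ T := fun p => by
      rw [Polynomial.aeval_algebraMap_apply]
      exact hT _
    refine mem_valLocalization.2 ⟨_, h1 p, _, h1 q, hν _ ?_ h0, rfl⟩
    exact IntermediateField.algebra_adjoin_le_adjoin k _ (Polynomial.aeval_mem_adjoin_singleton k _)

theorem ValuationSubring.exists_mul_eq_eval₂_sub {F R : Type*} [Field F] [CommRing R]
    (W : ValuationSubring F) (φ : R →+* F) (hφ : ∀ r, φ r ∈ W) {a b : F} (ha : a ∈ W) (hb : b ∈ W)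
    (g : Polynomial R) : ∃ c ∈ W, g.eval₂ φ b - g.eval₂ φ a = (b - a) * c := by
  have h1 : ∀ z : W, g.eval₂ φ (z : F) =
      (((g.map (φ.codRestrict W.toSubring hφ)).eval (R := W) z : W) : F) := fun z => by
    rw [Polynomial.eval_map]
    exact (Polynomial.hom_eval₂ g (φ.codRestrict W.toSubring hφ) W.subtype z).symm
  obtain ⟨c, hc⟩ := Polynomial.sub_dvd_eval_sub (R := W) ⟨b, hb⟩ ⟨a, ha⟩
    (g.map (φ.codRestrict W.toSubring hφ))
  refine ⟨c, c.2, ?_⟩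
  rw [h1 ⟨a, ha⟩, h1 ⟨b, hb⟩]
  exact congrArg (Subtype.val) hc

theorem Valuation.map_geom_sum₂_sub_lt_one {F Γ : Type*} [Field F]
    [LinearOrderedCommGroupWithZero Γ] (w : Valuation F Γ) {a b : F} (ha : w (a - 1) < 1)
    (hb : w (b - 1) < 1) (q : ℕ) :
    w (∑ i ∈ Finset.range q, a ^ i * b ^ (q - 1 - i) - q) < 1 := by
  have hone : ∀ {z : F}, w (z - 1) < 1 → w z = 1 := fun {z} hz => by
    have := w.map_eq_of_sub_lt (x := 1) (y := z) (by rwa [w.map_one])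
    rwa [w.map_one] at this
  have hmul : ∀ {x y : F}, w (x - 1) < 1 → w (y - 1) < 1 → w (x * y - 1) < 1 := by
    intro x y hx hy
    have h1 : x * y - 1 = x * (y - 1) + (x - 1) := by ring
    rw [h1]
    refine w.map_add_lt ?_ hx
    rwa [w.map_mul, hone hx, one_mul]
  have hpow : ∀ {x : F} (n : ℕ), w (x - 1) < 1 → w (x ^ n - 1) < 1 := by
    intro x n hx
    induction n with
    | zero => simp
    | succ n ih => rw [pow_succ]; exact hmul ih hx
  have h2 : ∑ i ∈ Finset.range q, a ^ i * b ^ (q - 1 - i) - q =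
      ∑ i ∈ Finset.range q, (a ^ i * b ^ (q - 1 - i) - 1) := by
    rw [Finset.sum_sub_distrib]; simp
  rw [h2]
  exact w.map_sum_lt one_ne_zero fun i _ => hmul (hpow _ ha) (hpow _ hb)

theorem Valuation.map_pow_sub_pow {F Γ : Type*} [Field F]
    [LinearOrderedCommGroupWithZero Γ] (w : Valuation F Γ) {a b : F} (ha : w (a - 1) < 1)
    (hb : w (b - 1) < 1) {q : ℕ} (hq : w q = 1) : w (a ^ q - b ^ q) = w (a - b) := by
  have h := w.map_eq_of_sub_lt (x := (q : F)) (y := ∑ i ∈ Finset.range q, a ^ i * b ^ (q - 1 - i))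
    (by rw [hq]; exact w.map_geom_sum₂_sub_lt_one ha hb q)
  rw [← geom_sum₂_mul, w.map_mul, h, hq, one_mul]

theorem ValuationSubring.valuation_le_iff_of_comap {K F : Type*} [Field K] [Field F]
    {V : ValuationSubring K} {W : ValuationSubring F} {ι : K →+* F} (h : ∀ x, ι x ∈ W ↔ x ∈ V)
    (x y : K) : W.valuation (ι x) ≤ W.valuation (ι y) ↔ V.valuation x ≤ V.valuation y := by
  rcases eq_or_ne y 0 with rfl | hy
  · simp
  · have h1 : ι y ≠ 0 := (map_ne_zero ι).2 hy
    rw [← div_le_one₀ (zero_lt_iff.2 (V.valuation.ne_zero_iff.2 hy)),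
      ← div_le_one₀ (zero_lt_iff.2 (W.valuation.ne_zero_iff.2 h1)), ← map_div₀, ← map_div₀,
      ← map_div₀, V.valuation_le_one_iff, W.valuation_le_one_iff, h]

theorem ValuationSubring.valuation_lt_iff_of_comap {K F : Type*} [Field K] [Field F]
    {V : ValuationSubring K} {W : ValuationSubring F} {ι : K →+* F} (h : ∀ x, ι x ∈ W ↔ x ∈ V)
    (x y : K) : W.valuation (ι x) < W.valuation (ι y) ↔ V.valuation x < V.valuation y := by
  rw [← not_le, ← not_le, valuation_le_iff_of_comap h]

theorem AddValuation.le_of_valuation_le {K : Type*} [Field K] {V : ValuationSubring K}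
    {ν : AddValuation K (WithTop ℚ)} (hν : ∀ x ∈ V, 0 ≤ ν x) {x y : K}
    (h : V.valuation x ≤ V.valuation y) : ν y ≤ ν x := by
  rcases eq_or_ne y 0 with rfl | hy
  · rw [V.valuation.map_zero, le_zero_iff, V.valuation.zero_iff] at h
    rw [h]
  · have h1 : x / y ∈ V := by
      rw [← V.valuation_le_one_iff, map_div₀]
      exact (div_le_one₀ (zero_lt_iff.2 (V.valuation.ne_zero_iff.2 hy))).2 h
    have h2 := ν.map_mul (x / y) y
    rw [div_mul_cancel₀ x hy] at h2
    rw [h2]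
    exact le_add_of_nonneg_left (hν _ h1)

theorem AddValuation.valuation_lt_of_lt {K : Type*} [Field K] {V : ValuationSubring K}
    {ν : AddValuation K (WithTop ℚ)} (hν : ∀ x ∈ V, 0 ≤ ν x) {x y : K}
    (h : ν y < ν x) : V.valuation x < V.valuation y :=
  lt_of_not_ge fun h1 => (le_of_valuation_le hν h1).not_gt h

theorem ValuationSubring.valuation_eval₂_eq_of_approximate_root {K F R : Type*} [Field K]
    [Field F] [CommRing R] {V : ValuationSubring K} {W : ValuationSubring F} {ι : K →+* F}
    (h : ∀ x, ι x ∈ W ↔ x ∈ V) {ν : AddValuation K (WithTop ℚ)} (hν : ∀ x ∈ V, 0 ≤ ν x)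
    {φ : R →+* K} (hφ : ∀ r, φ r ∈ V) {q : ℕ} (hq : V.valuation q = 1) {a X : K}
    (ha : V.valuation (a - 1) < 1) {Θ : F} (hΘ : W.valuation (Θ - 1) < 1) (hX : Θ ^ q = ι X)
    {g : Polynomial R} {β : ℚ} (h1 : (β : WithTop ℚ) < ν (a ^ q - X))
    (h2 : ν (g.eval₂ φ a) = (β : WithTop ℚ)) :
    W.valuation (g.eval₂ (ι.comp φ) Θ) = W.valuation (ι (g.eval₂ φ a)) := by
  have hle : ∀ {z : F}, W.valuation (z - 1) < 1 → z ∈ W := fun {z} hz => by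
    have h3 : z - 1 ∈ W := (W.valuation_le_one_iff _).1 hz.le
    rw [← sub_add_cancel z 1]
    exact W.add_mem _ _ h3 W.one_mem
  have ha' : W.valuation (ι a - 1) < 1 := by
    have := (valuation_lt_iff_of_comap h (a - 1) 1).2 (by rwa [map_one])
    simpa using this
  have hq' : W.valuation (q : F) = 1 := by
    have h3 := (valuation_le_iff_of_comap h q 1).2 (by rw [hq, map_one])
    have h4 := (valuation_le_iff_of_comap h 1 q).2 (by rw [hq, map_one])
    simp only [map_natCast, map_one] at h3 h4
    exact le_antisymm h3 h4
  obtain ⟨c, hc, hgc⟩ := W.exists_mul_eq_eval₂_sub (ι.comp φ) (fun r => (h _).2 (hφ r))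
    (hle ha') (hle hΘ) g
  rw [← Polynomial.hom_eval₂] at hgc
  refine Valuation.map_eq_of_sub_lt _ ?_
  rw [hgc, map_mul]
  calc W.valuation (Θ - ι a) * W.valuation c ≤ W.valuation (Θ - ι a) :=
        mul_le_of_le_one_right' ((W.valuation_le_one_iff c).2 hc)
    _ = W.valuation (ι (a ^ q - X)) := by
        rw [← W.valuation.map_pow_sub_pow hΘ ha' hq', hX, Valuation.map_sub_swap,
          map_sub ι, map_pow ι]
    _ < _ := (valuation_lt_iff_of_comap h _ _).2
        (AddValuation.valuation_lt_of_lt hν (by rwa [h2]))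

theorem exists_pow_eq_adicCompletion {R : Type*} [CommRing R] [IsNoetherianRing R] (I : Ideal R)
    {q : ℕ} (hq : IsUnit (q : R)) (hq0 : q ≠ 0) {x : R} (hx : x ∈ I) :
    ∃ θ : AdicCompletion I R, θ ^ q = algebraMap R (AdicCompletion I R) (1 + x) ∧
      θ - 1 ∈ I.map (algebraMap R (AdicCompletion I R)) := by
  have : IsAdicComplete (I.map (algebraMap R (AdicCompletion I R))) (AdicCompletion I R) :=
    (IsAdicComplete.map_algebraMap_iff _ _).mpr
      (AdicCompletion.isAdicComplete (IsNoetherian.noetherian I))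
  refine exists_pow_eq_of_isAdicComplete _ ?_ hq0 ?_
  · simpa using hq.map (algebraMap R (AdicCompletion I R))
  · rw [map_add, map_one, add_sub_cancel_left]
    exact Ideal.mem_map_of_mem _ hx

theorem ValuationSubring.valuation_lt_one_of_mem_map {R S F : Type*} [CommRing R] [CommRing S]
    [Field F] (W : ValuationSubring F) (f : R →+* S) (g : S →+* F) (hg : ∀ s, g s ∈ W) {I : Ideal R}
    (hI : ∀ a ∈ I, W.valuation (g (f a)) < 1) {s : S} (hs : s ∈ I.map f) :
    W.valuation (g s) < 1 := by
  induction hs using Submodule.span_induction with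
  | mem s hs =>
    obtain ⟨a, ha, rfl⟩ := hs
    exact hI a ha
  | zero => rw [map_zero, W.valuation.map_zero]; exact zero_lt_one
  | add x y _ _ hx hy => rw [map_add]; exact W.valuation.map_add_lt hx hy
  | smul a x _ hx =>
    rw [smul_eq_mul, map_mul, W.valuation.map_mul]
    exact (mul_le_of_le_one_left' ((W.valuation_le_one_iff _).2 (hg a))).trans_lt hx

theorem algebraMap_mem_T0 {k : Type*} [Field k] (p : RP k) :
    algebraMap (RP k) (KK k) p ∈ T0 k :=
  mem_T0.2 ⟨p, 1, by simp, by simp⟩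

theorem natCast_inv_mem {k : Type*} [Field k] {T : Subring (KK k)}
    (hT : ∀ p, algebraMap (RP k) (KK k) p ∈ T) {q : ℕ} (hq : (q : k) ≠ 0) :
    (q : KK k) ≠ 0 ∧ (q : KK k)⁻¹ ∈ T := by
  have h1 : (q : KK k) * algebraMap (RP k) (KK k) (MvPolynomial.C (q : k)⁻¹) = 1 := by
    have : (q : KK k) = algebraMap (RP k) (KK k) (MvPolynomial.C (q : k)) := by simp
    rw [this, ← map_mul, ← MvPolynomial.C_mul, mul_inv_cancel₀ hq]
    simp
  exact ⟨left_ne_zero_of_mul_eq_one h1, by rw [inv_eq_of_mul_eq_one_right h1]; exact hT _⟩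

/-- The valuation below takes new values on any ring which contains approximable roots of
`1 + x`. -/
theorem exists_valuation_with_new_values (k : Type*) [Field k] [IsAlgClosed k] :
    ∃ V : ValuationSubring (KK k), VDominates V (T0 k) ∧
      (∀ x ∈ V, ∃ c : k,
        V.valuation (x - algebraMap (RP k) (KK k) (MvPolynomial.C c)) < 1) ∧
      ∀ (T : Subring (KK k)) [IsNoetherianRing T], T0 k ≤ T → (T : Set (KK k)) ⊆ V →
        ∀ {D F : Type*} [CommRing D] [Field F] (φ : D →+* F) (j : T →+* D)
          (W : ValuationSubring F) (ι : KK k →+* F), (∀ a : T, ι (a : KK k) = φ (j a)) →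
          (∀ x, ι x ∈ W ↔ x ∈ V) →
          (∀ q : ℕ, (q : k) ≠ 0 → ∃ θ : D, W.valuation (φ θ - 1) < 1 ∧
            φ θ ^ q = ι (algebraMap (RP k) (KK k) (1 + MvPolynomial.X 0))) →
          ∃ h : D, φ h ≠ 0 ∧ ∀ f ∈ T, f ≠ 0 → W.valuation (φ h) ≠ W.valuation (ι f) := by
  obtain ⟨V, ν, r, β, B, hdom, hres, hν, -, hνk, hνt, hβ, hβ', hB, hgrow, happ⟩ :=
    exists_valuation_with_approximate_roots k
  refine ⟨V, hdom, hres, ?_⟩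
  intro T _ hT0 hTV D F _ _ φ j W ι hι hW hroot
  by_contra! hcon
  have hpT : ∀ p, algebraMap (RP k) (KK k) p ∈ T := fun p => hT0 (algebraMap_mem_T0 p)
  have key : ∀ i, ∃ f ∈ T, ν f = (β i : WithTop ℚ) := by
    intro i
    obtain ⟨q, hq, g, a, ha, h1, h2⟩ := happ i
    obtain ⟨θ, hθ, hθq⟩ := hroot q hq
    have hqV : V.valuation (q : KK k) = 1 := by
      obtain ⟨h3, h4⟩ := natCast_inv_mem hpT hq
      refine le_antisymm ((V.valuation_le_one_iff _).2 (natCast_mem V q)) ?_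
      have h5 := (V.valuation_le_one_iff _).2 (hTV h4)
      rwa [map_inv₀, inv_le_one₀ (zero_lt_iff.2 (V.valuation.ne_zero_iff.2 h3))] at h5
    have h3 := ValuationSubring.valuation_eval₂_eq_of_approximate_root hW hν
      (fun p => hTV (hpT p)) hqV ha hθ hθq h1 h2
    have h4 : ι.comp (algebraMap (RP k) (KK k)) =
        φ.comp (j.comp ((algebraMap (RP k) (KK k)).codRestrict T hpT)) :=
      RingHom.ext fun p => hι ⟨_, hpT p⟩
    rw [h4, ← Polynomial.hom_eval₂] at h3
    have h5 : g.eval₂ (algebraMap (RP k) (KK k)) a ≠ 0 := by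
      intro h
      rw [h, ν.map_zero] at h2
      exact WithTop.top_ne_coe h2
    obtain ⟨f, hf, hf0, hfv⟩ := hcon _ (by
      rw [← W.valuation.ne_zero_iff, h3, W.valuation.ne_zero_iff]
      exact (map_ne_zero ι).2 h5)
    rw [h3] at hfv
    refine ⟨f, hf, h2 ▸ le_antisymm ?_ ?_⟩
    · exact AddValuation.le_of_valuation_le hν
        ((ValuationSubring.valuation_le_iff_of_comap hW _ _).1 hfv.le)
    · exact AddValuation.le_of_valuation_le hν
        ((ValuationSubring.valuation_le_iff_of_comap hW _ _).1 hfv.ge)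
  choose f hf hfβ using key
  have : Infinite k := IsAlgClosed.instInfinite
  have : Infinite (coeffField k) := Infinite.of_injective _ (algebraMap k (coeffField k)).injective
  let A : Subalgebra (coeffField k) (KK k) :=
    { valLocalization ν T with
      algebraMap_mem' := fun c => coeffField_le_valLocalization hνk hpT c.2 }
  have hA : IsNoetherianRing A := isNoetherianRing_valLocalization ν T
  refine false_of_values (trdeg_coeffField_le k) ν A
    (fun a ha => nonneg_of_mem_valLocalization (fun b hb => hν b (hTV hb)) ha)
    (fun a ha h => inv_mem_valLocalization ha h) (planeSubalgebra k) ?_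
    exists_denominator_planeSubalgebra _ (le_valLocalization ν T (hpT _)) hνt r β f
    (fun i => le_valLocalization ν T (hf i)) hfβ hβ hβ' B hB hgrow
  refine Algebra.adjoin_le ?_
  rintro z (rfl | rfl) <;> exact le_valLocalization ν T (hpT _)

set_option synthInstance.maxHeartbeats 1000000 in
set_option maxHeartbeats 2000000 in
theorem extensions_of_valuations_statement1 (k : Type*) [Field k] [IsAlgClosed k] :
    ∃ V : ValuationSubring (KK k),
      VDominates V (T0 k) ∧
      (∀ x ∈ V, ∃ c : k,
        V.valuation (x - algebraMap (RP k) (KK k) (MvPolynomial.C c)) < 1) ∧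
      ∀ (T : Subring (KK k)) [IsLocalRing T], IsRegularLocal T → IsFractionSubring T →
        SDominates T (T0 k) → VDominates V T →
        ∀ (p : Ideal (AdicCompletion (IsLocalRing.maximalIdeal T) T)) [p.IsPrime],
          p.comap (algebraMap T (AdicCompletion (IsLocalRing.maximalIdeal T) T)) = ⊥ →
          ∀ (Vh : ValuationSubring
              (FractionRing (AdicCompletion (IsLocalRing.maximalIdeal T) T ⧸ p))),
            VDominates Vh
              (algebraMap (AdicCompletion (IsLocalRing.maximalIdeal T) T ⧸ p)
                (FractionRing (AdicCompletion (IsLocalRing.maximalIdeal T) T ⧸ p))).range →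
            ∀ ι : KK k →+* FractionRing (AdicCompletion (IsLocalRing.maximalIdeal T) T ⧸ p),
              (∀ a : T, ι (a : KK k) =
                algebraMap (AdicCompletion (IsLocalRing.maximalIdeal T) T ⧸ p)
                  (FractionRing (AdicCompletion (IsLocalRing.maximalIdeal T) T ⧸ p))
                  (Ideal.Quotient.mk p
                    (algebraMap T (AdicCompletion (IsLocalRing.maximalIdeal T) T) a))) →
              (∀ x : KK k, (ι x ∈ Vh ↔ x ∈ V)) →
              ∃ h : AdicCompletion (IsLocalRing.maximalIdeal T) T ⧸ p, h ≠ 0 ∧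
                ∀ f : KK k, f ∈ T → f ≠ 0 →
                  Vh.valuation
                    (algebraMap (AdicCompletion (IsLocalRing.maximalIdeal T) T ⧸ p)
                      (FractionRing (AdicCompletion (IsLocalRing.maximalIdeal T) T ⧸ p)) h)
                  ≠ Vh.valuation (ι f) := by
  obtain ⟨V, hdom, hres, hnew⟩ := exists_valuation_with_new_values k
  refine ⟨V, hdom, hres, ?_⟩
  intro T _ hreg _ hT0 hVT p _ _ Vh hVh ι hι hιV
  have : IsNoetherianRing T := hreg.1
  have hpT : ∀ p, algebraMap (RP k) (KK k) p ∈ T := fun p => hT0.1 (algebraMap_mem_T0 p)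
  have hmax : ∀ a : T, a ∈ IsLocalRing.maximalIdeal T ↔ V.valuation (a : KK k) < 1 := by
    intro a
    rw [IsLocalRing.mem_maximalIdeal, mem_nonunits_iff, hVT.2 a a.2, Subring.inNonunits,
      and_iff_right a.2, not_iff_not]
    constructor
    · intro h
      have h0 : (a : KK k) ≠ 0 := (h.map T.subtype).ne_zero
      obtain ⟨b, hb⟩ := h.exists_right_inv
      have hb' : (a : KK k) * b = 1 := congrArg Subtype.val hb
      exact ⟨h0, by rw [inv_eq_of_mul_eq_one_right hb']; exact b.2⟩
    · rintro ⟨h0, h⟩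
      exact IsUnit.of_mul_eq_one ⟨_, h⟩ (Subtype.ext (mul_inv_cancel₀ h0))
  let φ := algebraMap (AdicCompletion (IsLocalRing.maximalIdeal T) T ⧸ p)
    (FractionRing (AdicCompletion (IsLocalRing.maximalIdeal T) T ⧸ p))
  obtain ⟨h, h0, hh⟩ := hnew T hT0.1 hVT.1 φ ((Ideal.Quotient.mk p).comp
    (algebraMap T (AdicCompletion (IsLocalRing.maximalIdeal T) T))) Vh ι hι hιV (by
      intro q hq
      obtain ⟨hq1, hq2⟩ := natCast_inv_mem hpT hq
      have hx : (⟨_, hpT (MvPolynomial.X 0)⟩ : T) ∈ IsLocalRing.maximalIdeal T := by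
        rw [hmax]
        refine (hdom.2 _ (algebraMap_mem_T0 _)).2 ⟨algebraMap_mem_T0 _, ?_⟩
        rintro ⟨h1, h2⟩
        obtain ⟨g, s, hs, hgs⟩ := mem_T0.1 h2
        have hs0 : algebraMap (RP k) (KK k) s ≠ 0 := by
          rw [Ne, map_eq_zero_iff _ (IsFractionRing.injective (RP k) (KK k))]
          rintro rfl
          simp at hs
        rw [eq_div_iff hs0, inv_mul_eq_iff_eq_mul₀ h1, ← map_mul] at hgs
        have h3 := IsFractionRing.injective (RP k) (KK k) hgs
        rw [h3] at hs
        simp at hs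
      obtain ⟨θ, h1, h2⟩ := exists_pow_eq_adicCompletion (IsLocalRing.maximalIdeal T)
        (q := q) (IsUnit.of_mul_eq_one ⟨_, hq2⟩ (Subtype.ext (by simpa using mul_inv_cancel₀ hq1)))
        (by rintro rfl; simp at hq) hx
      refine ⟨Ideal.Quotient.mk p θ, ?_, ?_⟩
      · have h3 := Vh.valuation_lt_one_of_mem_map
          (algebraMap T (AdicCompletion (IsLocalRing.maximalIdeal T) T))
          (φ.comp (Ideal.Quotient.mk p)) (fun s => hVh.1 ⟨_, rfl⟩) (fun a ha => by
            have h4 := (ValuationSubring.valuation_lt_iff_of_comap hιV (a : KK k) 1).2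
              (by rw [map_one]; exact (hmax a).1 ha)
            rw [map_one, map_one, hι] at h4
            exact h4) h2
        rw [map_sub, map_one] at h3
        exact h3
      · have h3 := congrArg (φ.comp (Ideal.Quotient.mk p)) h1
        rw [map_pow] at h3
        refine h3.trans ?_
        have h4 := hι (1 + ⟨_, hpT (MvPolynomial.X 0)⟩)
        refine h4.symm.trans ?_
        simp)
  exact ⟨h, fun h' => h0 (by rw [h', map_zero]), hh⟩
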